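/- Let Ω ⊂ ℝ³ be a nonempty bounded open set and let k > 0 with k ≠ 1. Suppose that for every a ∈ ℝ³ there exists a solution of the conductivity inclusion problem with background field a that is linear in Ω. Then the Newtonian potential of Ω agrees with a polynomial of degree at most 2 on Ω: there exist a symmetric 3×3 real matrix A, a vector b ∈ ℝ³, and C ∈ ℝ such that N_Ω(x) = ⟨x, Ax⟩ + ⟨b, x⟩ + C for all x ∈ Ω. -/

import Mathlib

open MeasureTheory
open scoped RealInnerProductSpace

noncomputable section

abbrev Euc (d : ℕ) := EuclideanSpace ℝ (Fin d)

/-- `u` is a solution of the conductivity inclusion problem with inclusion `Ω`,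
contrast `k`, and background field `a`. -/
def IsCondSol (d : ℕ) (Ω : Set (Euc d)) (k : ℝ) (a : Euc d) (u : Euc d → ℝ) : Prop :=
  Continuous u ∧ ContDiffOn ℝ (⊤ : ℕ∞) u Ω ∧ ContDiffOn ℝ (⊤ : ℕ∞) u (closure Ω)ᶜ ∧
  (∀ φ : Euc d → ℝ, ContDiff ℝ (⊤ : ℕ∞) φ → HasCompactSupport φ →
    ∫ x, (1 + (k - 1) * Set.indicator Ω (fun _ => (1 : ℝ)) x) *
      ⟪gradient u x, gradient φ x⟫ = 0) ∧
  ∃ C R : ℝ, 0 < C ∧ 0 < R ∧ ∀ x : Euc d, R ≤ ‖x‖ → |u x - ⟪a, x⟫| ≤ C * ‖x‖ ^ (1 - (d : ℤ))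

/-- `u` is linear in `Ω`. -/
def IsLinIn (d : ℕ) (Ω : Set (Euc d)) (u : Euc d → ℝ) : Prop :=
  ∃ (b : Euc d) (c : ℝ), ∀ x ∈ Ω, u x = ⟪b, x⟫ + c

/-- `M` is a polarization tensor of `Ω` with contrast `k`:  for every background field `a`
there is a solution `u_a` with `u_a(x) = ⟨a,x⟩ + (1/ω_d)⟨a, Mx⟩/|x|^d + O(|x|^{-d})`. -/
def IsPolTensor (d : ℕ) (Ω : Set (Euc d)) (k : ℝ) (M : Matrix (Fin d) (Fin d) ℝ) : Prop :=
  ∀ a : Euc d, ∃ u, IsCondSol d Ω k a u ∧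
    ∃ C R : ℝ, 0 < C ∧ 0 < R ∧ ∀ x : Euc d, R ≤ ‖x‖ →
      |u x - (⟪a, x⟫ + (1 / (if d = 2 then 2 * Real.pi else 4 * Real.pi)) *
        (∑ i, a i * ∑ j, M i j * x j) / ‖x‖ ^ d)| ≤ C * ‖x‖ ^ (-(d : ℤ))

/-- `Ω` is an ellipse (d = 2) or an ellipsoid (d = 3): the image of the open unit ball
under an invertible affine map. -/
def IsEllipsoid (d : ℕ) (Ω : Set (Euc d)) : Prop :=
  ∃ (T : Euc d ≃ₗ[ℝ] Euc d) (x₀ : Euc d), Ω = (fun x => x₀ + T x) '' Metric.ball 0 1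

/-- The Newtonian potential of a bounded measurable set `D ⊂ ℝ³`. -/
def newtonPot (D : Set (Euc 3)) (x : Euc 3) : ℝ :=
  (1 / (4 * Real.pi)) * ∫ y in D, ‖x - y‖⁻¹

section

open Set Filter Topology Metric

/-- Integration in polar coordinates: if the radial integrals of `g` are given by a function `H`
that is homogeneous of degree `0`, then the integral of `g` is three times that of `H` over the
unit ball. -/
theorem integral_eq_of_radial {g H : Euc 3 → ℝ} (hg : Integrable g)
    (hH : ∀ w : Euc 3, ‖w‖ = 1 → ∫ r in Ioi (0 : ℝ), r ^ 2 * g (r • w) = H w)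
    (hom : ∀ (r : ℝ) (w : Euc 3), 0 < r → H (r • w) = H w)
    (hHi : IntegrableOn H (ball 0 1)) :
    ∫ z, g z = 3 * ∫ y in ball (0 : Euc 3) 1, H y := by
  have key : ∀ g : Euc 3 → ℝ, Integrable g → ∫ z, g z =
      ∫ w : sphere (0 : Euc 3) 1, (∫ r in Ioi (0 : ℝ), r ^ 2 * g (r • (w : Euc 3)))
        ∂(volume : Measure (Euc 3)).toSphere := by
    intro g hg
    have hmp := (volume : Measure (Euc 3)).measurePreserving_homeomorphUnitSphereProd
    have hemb := (Homeomorph.measurableEmbedding (homeomorphUnitSphereProd (Euc 3)))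
    let G : sphere (0 : Euc 3) 1 × Ioi (0 : ℝ) → ℝ := fun p => g (p.2.1 • (p.1 : Euc 3))
    have hG : ∀ x : ({(0)}ᶜ : Set (Euc 3)), G (homeomorphUnitSphereProd (Euc 3) x) = g x := by
      intro x
      have : ‖(x : Euc 3)‖ ≠ 0 := norm_ne_zero_iff.2 x.2
      simp [G, smul_smul, this]
    have h1 : ∫ z, g z = ∫ p, G p ∂((volume : Measure (Euc 3)).toSphere.prod
        (Measure.volumeIoiPow (Module.finrank ℝ (Euc 3) - 1))) := by
      rw [← hmp.integral_comp hemb G]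
      simp only [hG]
      rw [integral_subtype_comap (measurableSet_singleton _).compl fun x ↦ g x,
        restrict_compl_singleton]
    have hGi : Integrable G ((volume : Measure (Euc 3)).toSphere.prod
        (Measure.volumeIoiPow (Module.finrank ℝ (Euc 3) - 1))) := by
      rw [← hmp.integrable_comp_emb hemb]
      have : G ∘ (homeomorphUnitSphereProd (Euc 3)) = fun x => g x.1 := funext hG
      rw [this]
      have h2 := (integrableOn_iff_comap_subtypeVal (μ := (volume : Measure (Euc 3))) (f := g)
        (s := ({(0)}ᶜ : Set (Euc 3))) (by measurability)).1 hg.integrableOn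
      exact h2
    rw [h1, integral_prod _ hGi]
    congr 1
    ext w
    simp only [Measure.volumeIoiPow, ENNReal.ofReal, finrank_euclideanSpace, Fintype.card_fin, G]
    rw [integral_withDensity_eq_integral_smul
      ((measurable_subtype_coe.pow_const _).real_toNNReal)]
    refine (integral_subtype_comap measurableSet_Ioi
      fun a ↦ Real.toNNReal (a ^ 2) • g (a • (w : Euc 3))).trans ?_
    refine setIntegral_congr_fun measurableSet_Ioi fun x hx ↦ ?_
    simp only [NNReal.smul_def, smul_eq_mul]
    rw [Real.coe_toNNReal _ (pow_nonneg (le_of_lt hx) _)]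
  have h1 := key g hg
  have h2 := key ((ball (0 : Euc 3) 1).indicator H) (hHi.integrable_indicator measurableSet_ball)
  rw [integral_indicator measurableSet_ball] at h2
  rw [h1, h2, ← integral_const_mul]
  congr 1
  ext w
  have hw : ‖(w : Euc 3)‖ = 1 := by simp
  rw [hH _ hw]
  have : ∀ r ∈ Ioi (0 : ℝ), r ^ 2 * (ball (0 : Euc 3) 1).indicator H (r • (w : Euc 3)) =
      (Ioo 0 1).indicator (fun r => r ^ 2 * H w) r := by
    intro r hr
    have hr' : 0 < r := hr
    by_cases h : r < 1
    · rw [indicator_of_mem, indicator_of_mem, hom _ _ hr']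
      · exact ⟨hr, h⟩
      · simp [norm_smul, abs_of_pos hr', h]
    · rw [indicator_of_notMem, indicator_of_notMem, mul_zero]
      · exact fun h' => h h'.2
      · simpa [norm_smul, abs_of_pos hr'] using h
  rw [setIntegral_congr_fun measurableSet_Ioi this, setIntegral_indicator measurableSet_Ioo]
  have : Ioi (0 : ℝ) ∩ Ioo 0 1 = Ioo 0 1 := by ext; simp
  rw [this, integral_mul_const, ← integral_Ioc_eq_integral_Ioo,
    ← intervalIntegral.integral_of_le zero_le_one, integral_pow]
  norm_num
  ring

theorem volume_real_unitBall : (volume : Measure (Euc 3)).real (ball 0 1) = Real.pi * 4 / 3 := by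
  rw [Measure.real, EuclideanSpace.volume_ball_fin_three]
  simp
  positivity

theorem integral_radial (f : ℝ → ℝ) :
    ∫ z : Euc 3, f ‖z‖ = 4 * Real.pi * ∫ r in Ioi (0 : ℝ), r ^ 2 * f r := by
  rw [integral_fun_norm_addHaar, volume_real_unitBall]
  simp
  ring

theorem integrable_radial (f : ℝ → ℝ) :
    Integrable (fun z : Euc 3 => f ‖z‖) ↔ IntegrableOn (fun r : ℝ => r ^ 2 * f r) (Ioi 0) := by
  rw [integrable_fun_norm_addHaar]
  simp

/-- `‖z‖⁻²` is integrable on balls. -/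
theorem integrableOn_norm_inv_sq (r : ℝ) :
    IntegrableOn (fun z : Euc 3 => (‖z‖ ^ 2)⁻¹) (ball 0 r) := by
  rw [integrableOn_fun_norm_addHaar volume (f := fun t => (t ^ 2)⁻¹)]
  refine (integrableOn_const (C := (1 : ℝ)) (by simp)).congr_fun (fun x hx => ?_) measurableSet_Ioo
  have : x ≠ 0 := hx.1.ne'
  simp [this]

theorem setIntegral_norm_inv_sq {r : ℝ} (hr : 0 ≤ r) :
    ∫ z in ball (0 : Euc 3) r, (‖z‖ ^ 2)⁻¹ = 4 * Real.pi * r := by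
  have h : ∫ z in ball (0 : Euc 3) r, (‖z‖ ^ 2)⁻¹ =
      ∫ z : Euc 3, (Iio r).indicator (fun t => (t ^ 2)⁻¹) ‖z‖ := by
    rw [← integral_indicator measurableSet_ball]
    congr 1; ext z; simp [indicator]
  rw [h, integral_radial]
  have : ∀ t ∈ Ioi (0 : ℝ), t ^ 2 * (Iio r).indicator (fun t => (t ^ 2)⁻¹) t =
      (Ioo 0 r).indicator (fun _ => 1) t := by
    intro t ht
    have h0 : t ≠ 0 := (ne_of_gt ht)
    have ht' : 0 < t := ht
    by_cases h : t < r <;> simp [indicator, h, h0, ht']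
  rw [setIntegral_congr_fun measurableSet_Ioi this, setIntegral_indicator measurableSet_Ioo]
  have : Ioi (0 : ℝ) ∩ Ioo 0 r = Ioo 0 r := by ext; simp
  rw [this]; simp [hr]

theorem integrableOn_norm_inv_four {r : ℝ} (hr : 0 < r) :
    IntegrableOn (fun z : Euc 3 => (‖z‖ ^ 4)⁻¹) (ball 0 r)ᶜ ∧
    ∫ z in (ball (0 : Euc 3) r)ᶜ, (‖z‖ ^ 4)⁻¹ = 4 * Real.pi / r := by
  have e : (ball (0 : Euc 3) r)ᶜ.indicator (fun z : Euc 3 => (‖z‖ ^ 4)⁻¹) =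
      fun z => (Ici r).indicator (fun t => (t ^ 4)⁻¹) ‖z‖ := by
    ext z; simp [indicator]
  have : ∀ t ∈ Ioi (0 : ℝ), t ^ 2 * (Ici r).indicator (fun t => (t ^ 4)⁻¹) t =
      (Ici r).indicator (fun t => t ^ (-2 : ℝ)) t := by
    intro t ht
    have h0 : t ≠ 0 := (ne_of_gt ht)
    have ht' : 0 < t := ht
    by_cases h : r ≤ t
    · simp [indicator, h]
      field_simp
    · simp [indicator, h]
  have hI : Ioi (0 : ℝ) ∩ Ici r = Ici r := by
    ext t; simp; intro h; linarith
  constructor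
  · rw [← integrable_indicator_iff measurableSet_ball.compl, e, integrable_radial]
    rw [integrableOn_congr_fun this measurableSet_Ioi, IntegrableOn,
      integrable_indicator_iff measurableSet_Ici, IntegrableOn,
       Measure.restrict_restrict measurableSet_Ici, inter_comm, hI, ← IntegrableOn, integrableOn_Ici_iff_integrableOn_Ioi]
    exact integrableOn_Ioi_rpow_of_lt (by norm_num) hr
  · rw [← integral_indicator measurableSet_ball.compl, e, integral_radial,
      setIntegral_congr_fun measurableSet_Ioi this, setIntegral_indicator measurableSet_Ici, hI,
      integral_Ici_eq_integral_Ioi, integral_Ioi_rpow_of_lt (by norm_num) hr]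
    norm_num
    rw [Real.rpow_neg hr.le]
    simp
    ring

/-- The gradient of the fundamental solution `1 / (4π‖z‖)`. -/
def newtonField (z : Euc 3) : Euc 3 := (-((4 * Real.pi)⁻¹ * (‖z‖ ^ 3)⁻¹)) • z

theorem newtonField_neg (z : Euc 3) : newtonField (-z) = -newtonField z := by
  simp [newtonField]

theorem norm_newtonField (z : Euc 3) :
    ‖newtonField z‖ = (4 * Real.pi)⁻¹ * (‖z‖ ^ 2)⁻¹ := by
  rcases eq_or_ne z 0 with rfl | hz
  · simp [newtonField]
  · have h : ‖z‖ ≠ 0 := norm_ne_zero_iff.2 hz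
    have hp := Real.pi_pos
    rw [newtonField, norm_smul, norm_neg, Real.norm_of_nonneg (by positivity)]
    field_simp

theorem newtonField_smul {r : ℝ} (hr : 0 < r) (z : Euc 3) :
    newtonField (r • z) = (r ^ 2)⁻¹ • newtonField z := by
  simp only [newtonField, norm_smul, smul_smul, Real.norm_of_nonneg hr.le]
  congr 1
  rcases eq_or_ne z 0 with rfl | hz
  · simp
  · have h : ‖z‖ ≠ 0 := norm_ne_zero_iff.2 hz
    field_simp

theorem measurable_newtonField : Measurable newtonField := by
  unfold newtonField; fun_prop

/-- A smooth function on `ℝ` that equals `t ^ (-1/2)` for `t ≥ 1/2`. -/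
def invSqrtCut (t : ℝ) : ℝ := Real.smoothTransition (4 * t - 1) * (√t)⁻¹

theorem contDiff_invSqrtCut {n : ℕ∞} : ContDiff ℝ n invSqrtCut := by
  rw [contDiff_iff_contDiffAt]
  intro t
  rcases lt_or_ge t (1 / 4) with h | h
  · have : invSqrtCut =ᶠ[𝓝 t] fun _ => 0 := by
      filter_upwards [Iio_mem_nhds h] with s hs
      have hs' : s < 1 / 4 := hs
      rw [invSqrtCut, Real.smoothTransition.zero_of_nonpos (by linarith), zero_mul]
    exact contDiffAt_const.congr_of_eventuallyEq this
  · have ht : t ≠ 0 := by linarith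
    refine ContDiffAt.mul ?_ ((contDiffAt_id.sqrt ht).inv ?_)
    · exact Real.smoothTransition.contDiff.contDiffAt.comp t (by fun_prop)
    · exact (Real.sqrt_pos.2 (show (0 : ℝ) < t by linarith)).ne'

theorem invSqrtCut_eq {t : ℝ} (ht : 1 / 2 ≤ t) : invSqrtCut t = (√t)⁻¹ := by
  rw [invSqrtCut, Real.smoothTransition.one_of_one_le (by linarith), one_mul]

theorem abs_invSqrtCut_le (t : ℝ) : |invSqrtCut t| ≤ (√t)⁻¹ := by
  rw [invSqrtCut, abs_mul, abs_of_nonneg (Real.smoothTransition.nonneg _),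
    abs_of_nonneg (by positivity)]
  exact mul_le_of_le_one_left (by positivity) (Real.smoothTransition.le_one _)

theorem hasDerivAt_invSqrtCut (t : ℝ) : HasDerivAt invSqrtCut (deriv invSqrtCut t) t :=
  ((contDiff_invSqrtCut (n := 1)).differentiable (by norm_num) t).hasDerivAt

theorem contDiff_deriv_invSqrtCut {n : ℕ∞} : ContDiff ℝ n (deriv invSqrtCut) := by
  have h := contDiff_invSqrtCut (n := ⊤)
  have := (contDiff_infty_iff_deriv.1 h).2
  exact this.of_le (by exact_mod_cast le_top)

theorem hasDerivAt_deriv_invSqrtCut (t : ℝ) :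
    HasDerivAt (deriv invSqrtCut) (deriv (deriv invSqrtCut) t) t :=
  ((contDiff_deriv_invSqrtCut (n := 1)).differentiable (by norm_num) t).hasDerivAt

theorem continuous_deriv_deriv_invSqrtCut : Continuous (deriv (deriv invSqrtCut)) :=
  (contDiff_deriv_invSqrtCut (n := 1)).continuous_deriv (by norm_num)

theorem deriv_invSqrtCut_sq {r : ℝ} (hr : 0 < r) (h : 1 / 2 < r ^ 2) :
    deriv invSqrtCut (r ^ 2) = -(2 * r ^ 3)⁻¹ := by
  have h1 : HasDerivAt (fun r : ℝ => invSqrtCut (r ^ 2)) (deriv invSqrtCut (r ^ 2) * (2 * r)) r := by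
    have h2 := HasDerivAt.comp r (hasDerivAt_invSqrtCut (r ^ 2)) (hasDerivAt_pow 2 r)
    exact h2.congr_deriv (by simp)
  have h2 : (fun r : ℝ => invSqrtCut (r ^ 2)) =ᶠ[𝓝 r] fun r => r⁻¹ := by
    have : ∀ᶠ s in 𝓝 r, 1 / 2 < s ^ 2 := (continuous_pow 2).continuousAt.eventually_const_lt h
    filter_upwards [this, lt_mem_nhds hr] with s hs hs'
    rw [invSqrtCut_eq hs.le, Real.sqrt_sq hs'.le]
  have h3 := (hasDerivAt_inv hr.ne').congr_of_eventuallyEq h2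
  have h4 := h1.unique h3
  field_simp at h4 ⊢
  linarith

/-- The flux of the regularized field through the sphere of radius `r`. -/
theorem hasDerivAt_flux (r : ℝ) : HasDerivAt (fun r : ℝ => -(2 * r ^ 3 * deriv invSqrtCut (r ^ 2)))
    (r ^ 2 * -(6 * deriv invSqrtCut (r ^ 2) + 4 * r ^ 2 * deriv (deriv invSqrtCut) (r ^ 2))) r := by
  have h2 := HasDerivAt.comp r (hasDerivAt_deriv_invSqrtCut (r ^ 2)) (hasDerivAt_pow 2 r)
  have h3 := (((hasDerivAt_pow 3 r).const_mul 2).mul h2).neg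
  refine h3.congr_deriv ?_
  simp only [Function.comp]
  push_cast
  ring

theorem density_profile_eq_zero {r : ℝ} (hr : 1 ≤ r) :
    6 * deriv invSqrtCut (r ^ 2) + 4 * r ^ 2 * deriv (deriv invSqrtCut) (r ^ 2) = 0 := by
  have h0 : 0 < r := by linarith
  have hr2 : 1 / 2 < r ^ 2 := by nlinarith
  have h2 : (fun r : ℝ => -(2 * r ^ 3 * deriv invSqrtCut (r ^ 2))) =ᶠ[𝓝 r] fun _ => 1 := by
    have : ∀ᶠ s in 𝓝 r, 1 / 2 < s ^ 2 := (continuous_pow 2).continuousAt.eventually_const_lt hr2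
    filter_upwards [this, lt_mem_nhds h0] with s hs hs'
    rw [deriv_invSqrtCut_sq hs' hs]
    field_simp
  have h := (hasDerivAt_flux r).unique ((hasDerivAt_const r (1 : ℝ)).congr_of_eventuallyEq h2)
  have h3 : r ^ 2 ≠ 0 := by positivity
  have h4 := (mul_eq_zero.1 h).resolve_left h3
  linarith

/-- A smooth regularization of `1 / (4π‖z‖)`, unchanged for `‖z‖ ≥ e`. -/
def regPot (e : ℝ) (z : Euc 3) : ℝ := (4 * Real.pi)⁻¹ * e⁻¹ * invSqrtCut (‖z‖ ^ 2 / e ^ 2)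

/-- The gradient of `regPot`. -/
def regField (e : ℝ) (z : Euc 3) : Euc 3 :=
  ((4 * Real.pi)⁻¹ * (e ^ 3)⁻¹ * (2 * deriv invSqrtCut (‖z‖ ^ 2 / e ^ 2))) • z

/-- Minus the Laplacian of `regPot`. -/
def regDensity (e : ℝ) (z : Euc 3) : ℝ :=
  (4 * Real.pi)⁻¹ * (e ^ 3)⁻¹ * -(6 * deriv invSqrtCut (‖z‖ ^ 2 / e ^ 2) +
    4 * (‖z‖ ^ 2 / e ^ 2) * deriv (deriv invSqrtCut) (‖z‖ ^ 2 / e ^ 2))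

theorem contDiff_regPot (e : ℝ) {n : ℕ∞} : ContDiff ℝ n (regPot e) := by
  unfold regPot
  exact contDiff_const.mul (contDiff_invSqrtCut.comp ((contDiff_norm_sq ℝ).div_const _))

theorem contDiff_regField (e : ℝ) {n : ℕ∞} : ContDiff ℝ n (regField e) := by
  unfold regField
  exact (contDiff_const.mul (contDiff_const.mul
    (contDiff_deriv_invSqrtCut.comp ((contDiff_norm_sq ℝ).div_const _)))).smul contDiff_id

theorem continuous_regDensity (e : ℝ) : Continuous (regDensity e) := by
  unfold regDensity
  have h1 := continuous_deriv_deriv_invSqrtCut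
  have h2 : Continuous (deriv invSqrtCut) := (contDiff_deriv_invSqrtCut (n := 0)).continuous
  fun_prop

theorem hasFDerivAt_regPot (e : ℝ) (z : Euc 3) :
    HasFDerivAt (regPot e) (innerSL ℝ (regField e z)) z := by
  have h1 : HasFDerivAt (fun z : Euc 3 => ‖z‖ ^ 2 / e ^ 2) ((e ^ 2)⁻¹ • (2 • innerSL ℝ z)) z := by
    have := (hasStrictFDerivAt_norm_sq z).hasFDerivAt.const_mul (e ^ 2)⁻¹
    simpa [div_eq_inv_mul] using this
  have h2 := ((hasDerivAt_invSqrtCut (‖z‖ ^ 2 / e ^ 2)).comp_hasFDerivAt z h1).const_mul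
    ((4 * Real.pi)⁻¹ * e⁻¹)
  refine h2.congr_fderiv ?_
  ext w
  simp [regField]
  field_simp

theorem hasFDerivAt_regField_coord (e : ℝ) (z : Euc 3) (i : Fin 3) :
    ∃ L : Euc 3 →L[ℝ] ℝ, HasFDerivAt (fun z => regField e z i) L z ∧
      L (EuclideanSpace.single i 1) = (4 * Real.pi)⁻¹ * (e ^ 3)⁻¹ *
        (2 * deriv invSqrtCut (‖z‖ ^ 2 / e ^ 2) +
          4 * (z i ^ 2 / e ^ 2) * deriv (deriv invSqrtCut) (‖z‖ ^ 2 / e ^ 2)) := by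
  have h1 : HasFDerivAt (fun z : Euc 3 => ‖z‖ ^ 2 / e ^ 2) ((e ^ 2)⁻¹ • (2 • innerSL ℝ z)) z := by
    have := (hasStrictFDerivAt_norm_sq z).hasFDerivAt.const_mul (e ^ 2)⁻¹
    simpa [div_eq_inv_mul] using this
  have h2 := (((hasDerivAt_deriv_invSqrtCut (‖z‖ ^ 2 / e ^ 2)).comp_hasFDerivAt z h1).const_mul
    2).const_mul ((4 * Real.pi)⁻¹ * (e ^ 3)⁻¹)
  have h3 := h2.mul (EuclideanSpace.proj (𝕜 := ℝ) i : Euc 3 →L[ℝ] ℝ).hasFDerivAt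
  refine ⟨_, h3, ?_⟩
  simp [EuclideanSpace.inner_single_right]
  ring

theorem sum_fderiv_regField (e : ℝ) (z : Euc 3) :
    ∑ i, fderiv ℝ (fun z => regField e z i) z (EuclideanSpace.single i 1) = -regDensity e z := by
  have : ∀ i, fderiv ℝ (fun z => regField e z i) z (EuclideanSpace.single i 1) =
      (4 * Real.pi)⁻¹ * (e ^ 3)⁻¹ *
        (2 * deriv invSqrtCut (‖z‖ ^ 2 / e ^ 2) +
          4 * (z i ^ 2 / e ^ 2) * deriv (deriv invSqrtCut) (‖z‖ ^ 2 / e ^ 2)) := by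
    intro i
    obtain ⟨L, h1, h2⟩ := hasFDerivAt_regField_coord e z i
    rw [h1.fderiv, h2]
  simp only [this, regDensity]
  rw [Fin.sum_univ_three, EuclideanSpace.real_norm_sq_eq z, Fin.sum_univ_three]
  ring

theorem norm_sq_div {e : ℝ} (z : Euc 3) : ‖z‖ ^ 2 / e ^ 2 = (‖z‖ / e) ^ 2 := by
  rw [div_pow]

theorem regPot_eq {e : ℝ} (he : 0 < e) {z : Euc 3} (hz : e ≤ ‖z‖) :
    regPot e z = (4 * Real.pi)⁻¹ * ‖z‖⁻¹ := by
  have h1 : 1 ≤ ‖z‖ / e := (one_le_div he).2 hz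
  have h0 : 0 < ‖z‖ := he.trans_le hz
  rw [regPot, norm_sq_div, invSqrtCut_eq (by nlinarith), Real.sqrt_sq (by positivity)]
  field_simp

theorem regField_eq {e : ℝ} (he : 0 < e) {z : Euc 3} (hz : e ≤ ‖z‖) :
    regField e z = newtonField z := by
  have h1 : 1 ≤ ‖z‖ / e := (one_le_div he).2 hz
  have h0 : 0 < ‖z‖ := he.trans_le hz
  rw [regField, norm_sq_div, deriv_invSqrtCut_sq (by positivity) (by nlinarith), newtonField]
  congr 1
  field_simp

theorem regDensity_eq_zero {e : ℝ} (he : 0 < e) {z : Euc 3} (hz : e ≤ ‖z‖) :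
    regDensity e z = 0 := by
  have h1 : 1 ≤ ‖z‖ / e := (one_le_div he).2 hz
  rw [regDensity, norm_sq_div, density_profile_eq_zero h1]
  simp

theorem abs_regPot_le {e : ℝ} (he : 0 < e) (z : Euc 3) :
    |regPot e z| ≤ (4 * Real.pi)⁻¹ * ‖z‖⁻¹ := by
  have hp := Real.pi_pos
  rw [regPot, abs_mul, abs_of_nonneg (by positivity)]
  refine (mul_le_mul_of_nonneg_left (abs_invSqrtCut_le _) (by positivity)).trans_eq ?_
  rw [norm_sq_div, Real.sqrt_sq (by positivity)]
  field_simp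

theorem exists_norm_regField_le : ∃ C : ℝ, 0 < C ∧ ∀ e : ℝ, 0 < e → ∀ z : Euc 3,
    ‖regField e z‖ ≤ C * (‖z‖ ^ 2)⁻¹ ∧ ‖regField e z‖ ≤ C * (e ^ 2)⁻¹ := by
  have hp := Real.pi_pos
  have hc : Continuous (deriv invSqrtCut) := (contDiff_deriv_invSqrtCut (n := 0)).continuous
  obtain ⟨C, hC⟩ := (isCompact_Icc (a := (0 : ℝ)) (b := 1)).exists_bound_of_continuousOn
    hc.continuousOn
  have hC0 : 0 ≤ C := (norm_nonneg _).trans (hC 0 (by simp))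
  have key : ∀ r : ℝ, 0 ≤ r → r ^ 3 * |deriv invSqrtCut (r ^ 2)| ≤ C + 1 ∧
      r * |deriv invSqrtCut (r ^ 2)| ≤ C + 1 := by
    intro r hr
    rcases le_or_gt r 1 with h | h
    · have h1 := hC (r ^ 2) ⟨by positivity, by nlinarith⟩
      rw [Real.norm_eq_abs] at h1
      have h2 : r ^ 3 ≤ 1 := pow_le_one₀ hr h
      constructor <;> nlinarith [abs_nonneg (deriv invSqrtCut (r ^ 2)), pow_nonneg hr 3]
    · have h0 : 0 < r := by linarith
      rw [deriv_invSqrtCut_sq h0 (by nlinarith), abs_neg, abs_of_nonneg (by positivity)]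
      have e1 : r ^ 3 * (2 * r ^ 3)⁻¹ = 1 / 2 := by field_simp
      have e2 : r * (2 * r ^ 3)⁻¹ ≤ 1 / 2 := by
        rw [show r * (2 * r ^ 3)⁻¹ = (1 / 2) * (r ^ 2)⁻¹ by field_simp]
        have : (r ^ 2)⁻¹ ≤ 1 := inv_le_one_of_one_le₀ (by nlinarith)
        linarith
      constructor <;> linarith
  refine ⟨(4 * Real.pi)⁻¹ * (2 * (C + 1)), by positivity, fun e he z => ?_⟩
  have hn : ‖regField e z‖ = (4 * Real.pi)⁻¹ * 2 * (e ^ 2)⁻¹ *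
      ((‖z‖ / e) * |deriv invSqrtCut ((‖z‖ / e) ^ 2)|) := by
    rw [regField, norm_smul, norm_sq_div, norm_mul, norm_mul _ (deriv _ _),
      Real.norm_of_nonneg (show 0 ≤ (4 * Real.pi)⁻¹ * (e ^ 3)⁻¹ by positivity),
      Real.norm_of_nonneg (show (0 : ℝ) ≤ 2 by norm_num), Real.norm_eq_abs]
    field_simp
  obtain ⟨k1, k2⟩ := key (‖z‖ / e) (by positivity)
  constructor
  · rcases eq_or_ne z 0 with rfl | hz
    · simp [regField]
    have h : 0 < ‖z‖ := norm_pos_iff.2 hz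
    rw [hn]
    calc _ = (4 * Real.pi)⁻¹ * 2 * (‖z‖ ^ 2)⁻¹ *
          ((‖z‖ / e) ^ 3 * |deriv invSqrtCut ((‖z‖ / e) ^ 2)|) := by field_simp
      _ ≤ (4 * Real.pi)⁻¹ * 2 * (‖z‖ ^ 2)⁻¹ * (C + 1) := by gcongr
      _ = _ := by ring
  · rw [hn]
    calc _ ≤ (4 * Real.pi)⁻¹ * 2 * (e ^ 2)⁻¹ * (C + 1) := by gcongr
      _ = _ := by ring

theorem integral_regDensity {e : ℝ} (he : 0 < e) :
    Integrable (regDensity e) ∧ ∫ z, regDensity e z = 1 := by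
  have hsupp : HasCompactSupport (regDensity e) := by
    refine HasCompactSupport.intro (isCompact_closedBall (0 : Euc 3) e) fun z hz => ?_
    exact regDensity_eq_zero he (by rw [mem_closedBall_zero_iff, not_le] at hz; exact hz.le)
  refine ⟨(continuous_regDensity e).integrable_of_hasCompactSupport hsupp, ?_⟩
  let p : ℝ → ℝ := fun r => (4 * Real.pi)⁻¹ * (e ^ 3)⁻¹ *
    -(6 * deriv invSqrtCut ((r / e) ^ 2) + 4 * ((r / e) ^ 2) * deriv (deriv invSqrtCut) ((r / e) ^ 2))
  have h1 : ∀ z, regDensity e z = p ‖z‖ := fun z => by simp only [regDensity, norm_sq_div, p]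
  have hp := Real.pi_pos
  have hd : ∀ r, HasDerivAt (fun r => (4 * Real.pi)⁻¹ *
      -(2 * (r / e) ^ 3 * deriv invSqrtCut ((r / e) ^ 2))) (r ^ 2 * p r) r := by
    intro r
    have := (HasDerivAt.comp r (hasDerivAt_flux (r / e)) ((hasDerivAt_id r).div_const e)).const_mul
      (4 * Real.pi)⁻¹
    refine this.congr_deriv ?_
    simp only [p]
    field_simp
  have hlim : Tendsto (fun r => (4 * Real.pi)⁻¹ *
      -(2 * (r / e) ^ 3 * deriv invSqrtCut ((r / e) ^ 2))) atTop (𝓝 (4 * Real.pi)⁻¹) := by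
    refine tendsto_const_nhds.congr' ?_
    filter_upwards [eventually_ge_atTop e] with r hr
    have h1 : 1 ≤ r / e := (one_le_div he).2 hr
    rw [deriv_invSqrtCut_sq (by positivity) (by nlinarith)]
    have : 0 < r := he.trans_le hr
    field_simp
  have hint : IntegrableOn (fun r => r ^ 2 * p r) (Ioi 0) := by
    rw [← integrable_radial]
    refine ((continuous_regDensity e).integrable_of_hasCompactSupport hsupp).congr ?_
    exact Eventually.of_forall h1
  simp only [h1]
  rw [integral_radial, integral_Ioi_of_hasDerivAt_of_tendsto (hd 0).continuousAt.continuousWithinAt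
    (fun r _ => hd r) hint hlim]
  simp
  field_simp

/-- Measurable densities bounded by `M` that vanish outside the ball of radius `R`. -/
structure IsDensity (f : Euc 3 → ℝ) (M R : ℝ) : Prop where
  measurable : Measurable f
  bound : ∀ y, |f y| ≤ M
  eq_zero : ∀ y, R ≤ ‖y‖ → f y = 0

/-- The gradient of the Newtonian potential with density `f`. -/
def fieldPot (f : Euc 3 → ℝ) (x : Euc 3) : Euc 3 := ∫ y, f y • newtonField (x - y)

/-- The Newtonian potential with density `f`. -/
def densityPot (f : Euc 3 → ℝ) (x : Euc 3) : ℝ := ∫ y, f y * ((4 * Real.pi)⁻¹ * ‖x - y‖⁻¹)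

namespace IsDensity

variable {f g : Euc 3 → ℝ} {M R M' R' : ℝ} {E : Type*} [NormedAddCommGroup E] [NormedSpace ℝ E]

theorem nonneg (hf : IsDensity f M R) : 0 ≤ M := (abs_nonneg _).trans (hf.bound 0)

theorem add (hf : IsDensity f M R) (hg : IsDensity g M' R') :
    IsDensity (fun y => f y + g y) (M + M') (max R R') where
  measurable := hf.measurable.add hg.measurable
  bound y := (abs_add_le _ _).trans (add_le_add (hf.bound y) (hg.bound y))
  eq_zero y hy := by
    rw [hf.eq_zero y ((le_max_left _ _).trans hy), hg.eq_zero y ((le_max_right _ _).trans hy),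
      add_zero]

theorem const_mul (hf : IsDensity f M R) (c : ℝ) : IsDensity (fun y => c * f y) (|c| * M) R where
  measurable := hf.measurable.const_mul c
  bound y := by rw [abs_mul]; gcongr; exact hf.bound y
  eq_zero y hy := by rw [hf.eq_zero y hy, mul_zero]

theorem indicator_one {s : Set (Euc 3)} (hs : MeasurableSet s) (hR : s ⊆ ball 0 R) :
    IsDensity (s.indicator fun _ => 1) 1 R where
  measurable := measurable_const.indicator hs
  bound y := by by_cases h : y ∈ s <;> simp [h]
  eq_zero y hy := indicator_of_notMem (fun h => by
    have := hR h
    rw [mem_ball_zero_iff] at this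
    linarith) _

theorem integrable_kernel (hf : IsDensity f M R) {k : Euc 3 → E}
    (hk : ∀ r, IntegrableOn k (ball 0 r)) (x : Euc 3) :
    Integrable (fun y => f y • k (x - y)) := by
  have h1 : Integrable ((ball 0 (R + ‖x‖)).indicator k) :=
    (integrable_indicator_iff measurableSet_ball).2 (hk _)
  have h2 := h1.comp_sub_left x
  refine (h2.bdd_smul M (hf.measurable.aestronglyMeasurable)
    (Eventually.of_forall fun y => hf.bound y)).congr (Eventually.of_forall fun y => ?_)
  by_cases hy : R ≤ ‖y‖
  · simp [hf.eq_zero y hy]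
  · have : x - y ∈ ball (0 : Euc 3) (R + ‖x‖) := by
      rw [mem_ball_zero_iff]
      have := norm_sub_le x y
      linarith [not_le.1 hy]
    simp [indicator_of_mem this]

theorem integrable (hf : IsDensity f M R) : Integrable f := by
  have := hf.integrable_kernel (k := fun _ => (1 : ℝ)) (fun r => integrableOn_const measure_ball_lt_top.ne) 0
  simpa using this

theorem norm_integral_kernel_le (hf : IsDensity f M R) {k : Euc 3 → E} (hk : Integrable k)
    (x : Euc 3) : ‖∫ y, f y • k (x - y)‖ ≤ M * ∫ z, ‖k z‖ := by
  have h := hk.norm.comp_sub_left x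
  rw [← integral_sub_left_eq_self (fun z => ‖k z‖) volume x, ← integral_const_mul]
  refine norm_integral_le_of_norm_le (h.const_mul M) (Eventually.of_forall fun y => ?_)
  rw [norm_smul]
  exact mul_le_mul_of_nonneg_right (hf.bound y) (norm_nonneg _)

end IsDensity

theorem integrableOn_newtonField (r : ℝ) : IntegrableOn newtonField (ball 0 r) := by
  refine ((integrableOn_norm_inv_sq r).const_mul (4 * Real.pi)⁻¹).mono'
    measurable_newtonField.aestronglyMeasurable (Eventually.of_forall fun z => ?_)
  rw [norm_newtonField]

theorem integrableOn_norm_inv (r : ℝ) : IntegrableOn (fun z : Euc 3 => ‖z‖⁻¹) (ball 0 r) := by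
  refine ((integrableOn_norm_inv_sq r).const_mul r).mono'
    (by fun_prop) ?_
  filter_upwards [ae_restrict_mem measurableSet_ball] with z hz
  rw [mem_ball_zero_iff] at hz
  rcases eq_or_ne z 0 with rfl | h
  · simp
  have h0 : 0 < ‖z‖ := norm_pos_iff.2 h
  rw [norm_inv, norm_norm, ← div_eq_mul_inv, le_div_iff₀ (by positivity)]
  field_simp
  exact hz.le

theorem integrable_of_norm_le_inv_sq {E : Type*} [NormedAddCommGroup E] {k : Euc 3 → E} {C e : ℝ}
    (hk : AEStronglyMeasurable k) (hC : ∀ z, ‖k z‖ ≤ C * (‖z‖ ^ 2)⁻¹)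
    (he : 0 < e) (hz : ∀ z, e ≤ ‖z‖ → k z = 0) :
    Integrable k ∧ ∫ z, ‖k z‖ ≤ C * (4 * Real.pi * e) := by
  have h1 : Integrable ((ball (0 : Euc 3) e).indicator fun z => C * (‖z‖ ^ 2)⁻¹) :=
    (integrable_indicator_iff measurableSet_ball).2 ((integrableOn_norm_inv_sq e).const_mul C)
  have h2 : ∀ z, ‖k z‖ ≤ (ball (0 : Euc 3) e).indicator (fun z => C * (‖z‖ ^ 2)⁻¹) z := by
    intro z
    by_cases h : z ∈ ball (0 : Euc 3) e
    · rw [indicator_of_mem h]; exact hC z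
    · rw [indicator_of_notMem h, hz z (by simpa using h), norm_zero]
  have h3 := h1.mono' hk (Eventually.of_forall h2)
  refine ⟨h3, (integral_mono h3.norm h1 h2).trans_eq ?_⟩
  rw [integral_indicator measurableSet_ball, integral_const_mul, setIntegral_norm_inv_sq he.le]

theorem exists_regField_sub_le : ∃ C : ℝ, 0 < C ∧ ∀ e : ℝ, 0 < e →
    Integrable (fun z => regField e z - newtonField z) ∧
    ∫ z, ‖regField e z - newtonField z‖ ≤ C * e := by
  obtain ⟨C, hC, h⟩ := exists_norm_regField_le
  have hp := Real.pi_pos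
  refine ⟨(C + (4 * Real.pi)⁻¹) * (4 * Real.pi), by positivity, fun e he => ?_⟩
  rw [mul_assoc]
  refine integrable_of_norm_le_inv_sq ?_ (fun z => ?_) he fun z hz => ?_
  · exact ((contDiff_regField e (n := 0)).continuous.measurable.sub
      measurable_newtonField).aestronglyMeasurable
  · refine (norm_sub_le _ _).trans ?_
    rw [norm_newtonField, add_mul]
    exact add_le_add (h e he z).1 le_rfl
  · rw [regField_eq he hz, sub_self]

theorem regPot_sub_le {e : ℝ} (he : 0 < e) :
    Integrable (fun z : Euc 3 => regPot e z - (4 * Real.pi)⁻¹ * ‖z‖⁻¹) ∧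
    ∫ z : Euc 3, ‖regPot e z - (4 * Real.pi)⁻¹ * ‖z‖⁻¹‖ ≤ 2 * e * e := by
  have hp := Real.pi_pos
  have key := integrable_of_norm_le_inv_sq (C := 2 * (4 * Real.pi)⁻¹ * e)
    (k := fun z : Euc 3 => regPot e z - (4 * Real.pi)⁻¹ * ‖z‖⁻¹) (e := e) ?_ (fun z => ?_) he
    fun z hz => ?_
  · refine ⟨key.1, key.2.trans_eq ?_⟩
    field_simp
  · have := (contDiff_regPot e (n := 0)).continuous
    exact (this.measurable.sub (by fun_prop)).aestronglyMeasurable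
  · rcases le_or_gt e ‖z‖ with h | h
    · rw [regPot_eq he h, sub_self, norm_zero]; positivity
    rcases eq_or_ne z 0 with rfl | hz
    · simp [regPot, invSqrtCut]
    have h0 : 0 < ‖z‖ := norm_pos_iff.2 hz
    refine (norm_sub_le _ _).trans ?_
    rw [Real.norm_eq_abs, Real.norm_of_nonneg (by positivity)]
    refine (add_le_add (abs_regPot_le he z) le_rfl).trans ?_
    rw [← two_mul, ← mul_assoc, mul_assoc _ e]
    gcongr
    rw [← div_eq_mul_inv, le_div_iff₀ (by positivity)]
    field_simp
    exact h.le
  · simp only [regPot_eq he hz, sub_self]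

namespace IsDensity

variable {f g : Euc 3 → ℝ} {M R M' R' : ℝ}

theorem integrable_field (hf : IsDensity f M R) (x : Euc 3) :
    Integrable (fun y => f y • newtonField (x - y)) :=
  hf.integrable_kernel integrableOn_newtonField x

theorem integrable_pot (hf : IsDensity f M R) (x : Euc 3) :
    Integrable (fun y => f y * ((4 * Real.pi)⁻¹ * ‖x - y‖⁻¹)) :=
  hf.integrable_kernel (fun r => (integrableOn_norm_inv r).const_mul (4 * Real.pi)⁻¹) x

theorem integrable_of_continuous {E : Type*} [NormedAddCommGroup E] [NormedSpace ℝ E]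
    (hf : IsDensity f M R) {k : Euc 3 → E}
    (hk : Continuous k) (x : Euc 3) : Integrable (fun y => f y • k (x - y)) :=
  hf.integrable_kernel (fun r => (hk.continuousOn.integrableOn_compact
    (isCompact_closedBall 0 r)).mono_set ball_subset_closedBall) x

theorem continuous_regField (hf : IsDensity f M R) {e : ℝ} (he : 0 < e) :
    Continuous fun x => ∫ y, f y • regField e (x - y) := by
  obtain ⟨C, hC, h⟩ := exists_norm_regField_le
  have hc := (contDiff_regField e (n := 0)).continuous
  refine continuous_of_dominated (bound := fun y => |f y| * (C * (e ^ 2)⁻¹))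
    (fun x => (hf.integrable_of_continuous hc x).aestronglyMeasurable)
    (fun x => Eventually.of_forall fun y => ?_) (hf.integrable.abs.mul_const _)
    (Eventually.of_forall fun y => by fun_prop)
  rw [norm_smul]
  exact mul_le_mul_of_nonneg_left (h e he _).2 (norm_nonneg _)

theorem tendstoUniformly_regField (hf : IsDensity f M R) :
    TendstoUniformly (fun e x => ∫ y, f y • regField e (x - y)) (fieldPot f) (𝓝[>] 0) := by
  obtain ⟨C, hC, h⟩ := exists_regField_sub_le
  have h0 := hf.nonneg
  rw [Metric.tendstoUniformly_iff]
  intro ε hε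
  have : ∀ᶠ e : ℝ in 𝓝[>] 0, M * (C * e) < ε := by
    have : Tendsto (fun e : ℝ => M * (C * e)) (𝓝[>] 0) (𝓝 (M * (C * 0))) :=
      ((continuous_const.mul (continuous_const.mul continuous_id)).tendsto 0).mono_left
        nhdsWithin_le_nhds
    exact this.eventually_lt_const (by simpa using hε)
  filter_upwards [this, self_mem_nhdsWithin] with e h1 he x
  obtain ⟨h2, h3⟩ := h e he
  rw [dist_comm, dist_eq_norm, fieldPot, ← integral_sub
    (hf.integrable_of_continuous (contDiff_regField e (n := 0)).continuous x) (hf.integrable_field x)]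
  simp only [← smul_sub]
  refine (hf.norm_integral_kernel_le h2 x).trans_lt (lt_of_le_of_lt ?_ h1)
  gcongr

theorem continuous_fieldPot (hf : IsDensity f M R) : Continuous (fieldPot f) := by
  refine hf.tendstoUniformly_regField.continuous (Eventually.frequently ?_)
  filter_upwards [self_mem_nhdsWithin] with e he
  exact hf.continuous_regField he

theorem tendsto_regPot (hf : IsDensity f M R) (x : Euc 3) :
    Tendsto (fun e => ∫ y, f y * regPot e (x - y)) (𝓝[>] 0) (𝓝 (densityPot f x)) := by
  have h0 := hf.nonneg
  rw [tendsto_iff_norm_sub_tendsto_zero]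
  have h : Tendsto (fun e : ℝ => M * (2 * e * e)) (𝓝[>] 0) (𝓝 0) := by
    have : Tendsto (fun e : ℝ => M * (2 * e * e)) (𝓝 0) (𝓝 (M * (2 * 0 * 0))) :=
      (by fun_prop : Continuous fun e : ℝ => M * (2 * e * e)).tendsto 0
    simpa using this.mono_left nhdsWithin_le_nhds
  refine squeeze_zero' (Eventually.of_forall fun _ => norm_nonneg _) ?_ h
  filter_upwards [self_mem_nhdsWithin] with e he
  obtain ⟨h2, h3⟩ := regPot_sub_le (mem_Ioi.1 he)
  have hi := hf.integrable_of_continuous (contDiff_regPot e (n := 0)).continuous x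
  simp only [smul_eq_mul] at hi
  rw [densityPot, ← integral_sub hi (hf.integrable_pot x)]
  simp only [← mul_sub]
  have := hf.norm_integral_kernel_le h2 x
  simp only [smul_eq_mul] at this
  exact this.trans (by gcongr)

theorem hasFDerivAt_regPot (hf : IsDensity f M R) {e : ℝ} (he : 0 < e) (x : Euc 3) :
    HasFDerivAt (fun x => ∫ y, f y * regPot e (x - y))
      (innerSL ℝ (∫ y, f y • regField e (x - y))) x := by
  obtain ⟨C, hC, h⟩ := exists_norm_regField_le
  have hc := (contDiff_regField e (n := 0)).continuous
  have hc' := (contDiff_regPot e (n := 0)).continuous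
  have hi : ∀ x, Integrable (fun y => f y * regPot e (x - y)) := fun x =>
    hf.integrable_of_continuous hc' x
  have hi2 := hf.integrable_of_continuous hc x
  have key := hasFDerivAt_integral_of_dominated_of_fderiv_le (μ := volume)
    (F := fun x y => f y * regPot e (x - y))
    (F' := fun x y => innerSL ℝ (f y • regField e (x - y))) (x₀ := x) (s := univ)
    (bound := fun y => |f y| * (C * (e ^ 2)⁻¹)) univ_mem
    (Eventually.of_forall fun x => (hi x).aestronglyMeasurable) (hi x)
    ((innerSL ℝ).continuous.comp_aestronglyMeasurable hi2.aestronglyMeasurable)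
    (Eventually.of_forall fun y x _ => ?_)
    (hf.integrable.abs.mul_const _) (Eventually.of_forall fun y x _ => ?_)
  · rwa [ContinuousLinearMap.integral_comp_comm _ hi2] at key
  · rw [innerSL_apply_norm, norm_smul]
    exact mul_le_mul_of_nonneg_left (h e he _).2 (norm_nonneg _)
  · have h1 := ((_root_.hasFDerivAt_regPot e (x - y)).comp x ((hasFDerivAt_id x).sub_const y)).const_mul
      (f y)
    refine h1.congr_fderiv ?_
    ext w
    simp

theorem hasFDerivAt_densityPot (hf : IsDensity f M R) (x : Euc 3) :
    HasFDerivAt (densityPot f) (innerSL ℝ (fieldPot f x)) x := by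
  have h1 : TendstoUniformly (fun e x => innerSL ℝ (∫ y, f y • regField e (x - y)))
      (fun x => innerSL ℝ (fieldPot f x)) (𝓝[>] 0) :=
    (innerSL ℝ : Euc 3 →L[ℝ] _).uniformContinuous.comp_tendstoUniformly
      hf.tendstoUniformly_regField
  have ht : Tendsto (fun n : ℕ => 1 / ((n : ℝ) + 1)) atTop (𝓝[>] 0) :=
    tendsto_nhdsWithin_iff.2 ⟨tendsto_one_div_add_atTop_nhds_zero_nat,
      Eventually.of_forall fun n => mem_Ioi.2 (by positivity)⟩
  have h2 : TendstoUniformly (fun (n : ℕ) x =>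
      innerSL ℝ (∫ y, f y • regField (1 / ((n : ℝ) + 1)) (x - y)))
      (fun x => innerSL ℝ (fieldPot f x)) atTop := fun u hu => ht.eventually (h1 u hu)
  exact hasFDerivAt_of_tendstoUniformly h2 (fun n x => hf.hasFDerivAt_regPot (by positivity) x)
    (fun x => (hf.tendsto_regPot x).comp ht) x

end IsDensity

theorem fieldPot_add {f g : Euc 3 → ℝ} {M R M' R' : ℝ} (hf : IsDensity f M R)
    (hg : IsDensity g M' R') (x : Euc 3) :
    fieldPot (fun y => f y + g y) x = fieldPot f x + fieldPot g x := by
  simp only [fieldPot, add_smul]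
  exact integral_add (hf.integrable_field x) (hg.integrable_field x)

theorem fieldPot_const_mul (f : Euc 3 → ℝ) (c : ℝ) (x : Euc 3) :
    fieldPot (fun y => c * f y) x = c • fieldPot f x := by
  simp only [fieldPot, mul_smul]
  exact integral_smul c _

theorem densityPot_indicator {D : Set (Euc 3)} (hD : MeasurableSet D) :
    densityPot (D.indicator fun _ => 1) = newtonPot D := by
  ext x
  rw [densityPot, newtonPot, ← integral_indicator hD, ← integral_const_mul]
  congr 1
  ext y
  by_cases h : y ∈ D <;> simp [h]

/-- The Laplacian in coordinates. -/
def lap (φ : Euc 3 → ℝ) (y : Euc 3) : ℝ :=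
  ∑ i, fderiv ℝ (fun z => fderiv ℝ φ z (EuclideanSpace.single i 1)) y (EuclideanSpace.single i 1)

theorem regField_neg (e : ℝ) (z : Euc 3) : regField e (-z) = -regField e z := by
  simp [regField]

theorem fderiv_regPot_sub_sub (e L : ℝ) (x y : Euc 3) :
    fderiv ℝ (fun y => regPot e (y - x) - regPot L (y - x)) y =
      innerSL ℝ (regField e (y - x)) - innerSL ℝ (regField L (y - x)) := by
  have h := (hasFDerivAt_regPot e (y - x)).comp y ((hasFDerivAt_id y).sub_const x)
  have h' := (hasFDerivAt_regPot L (y - x)).comp y ((hasFDerivAt_id y).sub_const x)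
  exact (h.sub h').fderiv

theorem lap_regPot_sub_sub (e L : ℝ) (x y : Euc 3) :
    lap (fun y => regPot e (y - x) - regPot L (y - x)) y =
      -regDensity e (y - x) + regDensity L (y - x) := by
  have hd : ∀ e i, DifferentiableAt ℝ (fun z => regField e z i) (y - x) := fun e i =>
    (hasFDerivAt_regField_coord e (y - x) i).choose_spec.1.differentiableAt
  have h : ∀ e i, HasFDerivAt (fun z => regField e (z - x) i)
      (fderiv ℝ (fun z => regField e z i) (y - x)) y := fun e i =>
    (hd e i).hasFDerivAt.comp (f := fun z => z - x) y ((hasFDerivAt_id y).sub_const x)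
  rw [lap, ← sum_fderiv_regField, ← sub_neg_eq_add, ← sum_fderiv_regField,
    ← Finset.sum_sub_distrib]
  refine Finset.sum_congr rfl fun i _ => ?_
  have h1 : (fun z => fderiv ℝ (fun y => regPot e (y - x) - regPot L (y - x)) z
      (EuclideanSpace.single i 1)) = fun z => regField e (z - x) i - regField L (z - x) i := by
    ext z
    rw [fderiv_regPot_sub_sub]
    simp [EuclideanSpace.inner_single_right]
  rw [h1, fderiv_fun_sub (h e i).differentiableAt (h L i).differentiableAt, (h e i).fderiv,
    (h L i).fderiv]
  simp

theorem regDensity_scale {e : ℝ} (he : 0 < e) (z : Euc 3) :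
    regDensity e z = (e ^ 3)⁻¹ * regDensity 1 (e⁻¹ • z) := by
  have : ‖e⁻¹ • z‖ ^ 2 / 1 ^ 2 = ‖z‖ ^ 2 / e ^ 2 := by
    rw [norm_smul, norm_inv, Real.norm_of_nonneg he.le]
    field_simp
  rw [regDensity, regDensity, this]
  simp only [one_pow, inv_one]
  ring

theorem integral_mul_regDensity {v : Euc 3 → ℝ} {e : ℝ} (he : 0 < e) (x : Euc 3) :
    ∫ y, v y * regDensity e (y - x) = ∫ w, v (x + e • w) * regDensity 1 w := by
  have h1 := integral_add_right_eq_self (μ := (volume : Measure (Euc 3)))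
    (fun y => v y * regDensity e (y - x)) x
  have h2 := Measure.integral_comp_smul (volume : Measure (Euc 3))
    (fun z => v (z + x) * regDensity e (z + x - x)) e
  rw [← h1, ← one_smul ℝ (∫ y, v (y + x) * _)]
  have h3 : |(e ^ Module.finrank ℝ (Euc 3))⁻¹| = (e ^ 3)⁻¹ := by
    rw [finrank_euclideanSpace_fin, abs_of_nonneg (by positivity)]
  rw [h3] at h2
  rw [show (1 : ℝ) = e ^ 3 * (e ^ 3)⁻¹ by field_simp, mul_smul, ← h2, smul_eq_mul,
    ← integral_const_mul]
  congr 1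
  ext w
  rw [add_sub_cancel_right, regDensity_scale he, smul_smul, inv_mul_cancel₀ he.ne', one_smul,
    add_comm x]
  field_simp

theorem tendsto_integral_mul_regDensity {v : Euc 3 → ℝ} {B c : ℝ} (hv : Continuous v)
    (hB : ∀ y, |v y| ≤ B) {l : Filter ℝ} [l.IsCountablyGenerated] (hl : ∀ᶠ e in l, 0 < e)
    (x : Euc 3) (h : ∀ w ≠ 0, Tendsto (fun e : ℝ => v (x + e • w)) l (𝓝 c)) :
    Tendsto (fun e => ∫ y, v y * regDensity e (y - x)) l (𝓝 c) := by
  obtain ⟨hi, h1⟩ := integral_regDensity one_pos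
  have h2 : c = ∫ w, c * regDensity 1 w := by rw [integral_const_mul, h1, mul_one]
  have hc := continuous_regDensity 1
  have key : Tendsto (fun e : ℝ => ∫ w, v (x + e • w) * regDensity 1 w) l (𝓝 c) := by
    rw [h2]
    refine tendsto_integral_filter_of_dominated_convergence (fun w => B * |regDensity 1 w|)
      (Eventually.of_forall fun e => ?_) (Eventually.of_forall fun e => Eventually.of_forall
        fun w => ?_) (hi.abs.const_mul B) ?_
    · have : Continuous fun w => v (x + e • w) * regDensity 1 w := by fun_prop
      exact this.aestronglyMeasurable
    · rw [norm_mul]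
      exact mul_le_mul_of_nonneg_right (hB _) (norm_nonneg _)
    · have : ∀ᵐ w : Euc 3, w ≠ 0 := by simp [ae_iff]
      filter_upwards [this] with w hw
      exact (h w hw).mul_const _
  refine key.congr' ?_
  filter_upwards [hl] with e he
  exact (integral_mul_regDensity he x).symm

/-- A continuous function vanishing at infinity whose distributional Laplacian is
`-div (f b)` is the corresponding dipole potential. -/
theorem eq_inner_fieldPot {v f : Euc 3 → ℝ} {M R : ℝ} {b : Euc 3} (hv : Continuous v)
    (hlim : Tendsto v (cocompact _) (𝓝 0)) (hf : IsDensity f M R)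
    (hw : ∀ φ : Euc 3 → ℝ, ContDiff ℝ (⊤ : ℕ∞) φ → HasCompactSupport φ →
      ∫ y, v y * lap φ y = ∫ y, f y * fderiv ℝ φ y b) (x : Euc 3) :
    v x = ⟪fieldPot f x, b⟫ := by
  obtain ⟨B, hB⟩ : ∃ B, ∀ y, |v y| ≤ B := by
    obtain ⟨B, hB⟩ := (ZeroAtInftyContinuousMap.mk ⟨v, hv⟩ hlim).isBounded_range.exists_norm_le
    exact ⟨B, fun y => hB _ ⟨y, rfl⟩⟩
  have hinv : Tendsto (fun e : ℝ => e⁻¹) (𝓝[>] 0) atTop := tendsto_inv_nhdsGT_zero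
  have t1 : Tendsto (fun e => ∫ y, v y * regDensity e (y - x)) (𝓝[>] 0) (𝓝 (v x)) := by
    refine tendsto_integral_mul_regDensity (l := 𝓝[>] 0) hv hB self_mem_nhdsWithin x fun w _ => ?_
    have : Continuous fun e : ℝ => v (x + e • w) := by fun_prop
    simpa using (this.tendsto 0).mono_left (nhdsWithin_le_nhds (s := Ioi 0))
  have t2 : Tendsto (fun e => ∫ y, v y * regDensity e (y - x)) atTop (𝓝 0) := by
    refine tendsto_integral_mul_regDensity hv hB (eventually_gt_atTop 0) x fun w hw => ?_
    refine hlim.comp ?_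
    rw [← Metric.cobounded_eq_cocompact, ← tendsto_norm_atTop_iff_cobounded]
    have h1 : Tendsto (fun e : ℝ => e * ‖w‖ - ‖x‖) atTop atTop :=
      tendsto_atTop_add_const_right _ _ (tendsto_id.atTop_mul_const (norm_pos_iff.2 hw))
    refine tendsto_atTop_mono' _ ?_ h1
    filter_upwards [eventually_gt_atTop 0] with e he
    have := norm_sub_le (x + e • w) x
    rw [add_sub_cancel_left, norm_smul, Real.norm_of_nonneg he.le] at this
    linarith
  have hfi : ∀ e, Integrable fun y => f y • regField e (x - y) := fun e =>
    hf.integrable_of_continuous (contDiff_regField e (n := 0)).continuous x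
  have t3 : Tendsto (fun e => ⟪∫ y, f y • regField e (x - y), b⟫) (𝓝[>] 0)
      (𝓝 ⟪fieldPot f x, b⟫) :=
    (hf.tendstoUniformly_regField.tendsto_at x).inner tendsto_const_nhds
  have t4 : Tendsto (fun e => ⟪∫ y, f y • regField e (x - y), b⟫) atTop (𝓝 0) := by
    obtain ⟨C, hC, h⟩ := exists_norm_regField_le
    have h1 : Tendsto (fun e => ∫ y, f y • regField e (x - y)) atTop (𝓝 0) := by
      have h2 : Tendsto (fun e : ℝ => (∫ y, |f y|) * (C * (e ^ 2)⁻¹)) atTop (𝓝 0) := by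
        have : Tendsto (fun e : ℝ => (e ^ 2)⁻¹) atTop (𝓝 0) :=
          tendsto_inv_atTop_zero.comp (tendsto_pow_atTop two_ne_zero)
        simpa using (this.const_mul C).const_mul (∫ y, |f y|)
      refine squeeze_zero_norm' ?_ h2
      filter_upwards [eventually_gt_atTop 0] with e he
      rw [← integral_mul_const]
      refine norm_integral_le_of_norm_le (hf.integrable.abs.mul_const _)
        (Eventually.of_forall fun y => ?_)
      rw [norm_smul]
      exact mul_le_mul_of_nonneg_left (h e he _).2 (norm_nonneg _)
    simpa using h1.inner (tendsto_const_nhds (x := b))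
  have hvi : ∀ e, 0 < e → Integrable fun y => v y * regDensity e (y - x) := fun e he =>
    ((integral_regDensity he).1.comp_sub_right x).bdd_mul (c := B) hv.aestronglyMeasurable
      (Eventually.of_forall hB)
  have key : ∀ᶠ e : ℝ in 𝓝[>] 0, -(∫ y, v y * regDensity e (y - x)) +
      ∫ y, v y * regDensity e⁻¹ (y - x) =
      -⟪∫ y, f y • regField e (x - y), b⟫ + ⟪∫ y, f y • regField e⁻¹ (x - y), b⟫ := by
    have : ∀ᶠ e : ℝ in 𝓝[>] 0, e < 1 := nhdsWithin_le_nhds (Iio_mem_nhds one_pos)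
    filter_upwards [self_mem_nhdsWithin, this] with e he he1
    rw [mem_Ioi] at he
    have hei : 0 < e⁻¹ := inv_pos.2 he
    have hle : e ≤ e⁻¹ := he1.le.trans ((one_le_inv₀ he).2 he1.le)
    have h1 := hw (fun y => regPot e (y - x) - regPot e⁻¹ (y - x))
      (((contDiff_regPot e).comp (contDiff_id.sub contDiff_const)).sub
        ((contDiff_regPot e⁻¹).comp (contDiff_id.sub contDiff_const)))
      (HasCompactSupport.intro (isCompact_closedBall x e⁻¹) fun y hy => by
        rw [mem_closedBall, not_le, dist_eq_norm] at hy
        simp only [regPot_eq he (hle.trans hy.le), regPot_eq hei hy.le, sub_self])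
    have h2 : ∀ e, ⟪∫ y, f y • regField e (x - y), b⟫ = ∫ y, f y * ⟪regField e (x - y), b⟫ := by
      intro e
      rw [real_inner_comm, ← integral_inner (hfi e)]
      simp only [inner_smul_right, real_inner_comm]
    have h3 : ∀ e, Integrable fun y => f y * ⟪regField e (x - y), b⟫ := by
      intro e
      refine ((hfi e).inner_const b).congr (Eventually.of_forall fun y => ?_)
      simp [inner_smul_left]
    simp only [lap_regPot_sub_sub, fderiv_regPot_sub_sub] at h1
    rw [h2, h2, ← integral_neg, ← integral_neg, ← integral_add (by exact (hvi e he).neg) (hvi _ hei),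
      ← integral_add (by exact (h3 e).neg) (h3 _)]
    convert h1 using 1
    · congr 1; ext y; ring
    · congr 1; ext y
      rw [← neg_sub y x, regField_neg, regField_neg]
      simp
      ring
  have l1 := t1.neg.add (t2.comp hinv)
  have l2 := t3.neg.add (t4.comp hinv)
  have := tendsto_nhds_unique (l1.congr' key) l2
  linarith

/-- The derivative of a function vanishes almost everywhere on its zero set. -/
theorem ae_fderiv_eq_zero {v : Euc 3 → ℝ} (hv : Continuous v) :
    ∀ᵐ x, v x = 0 → fderiv ℝ v x = 0 := by
  let s := {x | v x = 0} ∩ {x | DifferentiableAt ℝ v x}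
  have hs : MeasurableSet s := (isClosed_singleton.preimage hv).measurableSet.inter
    (measurableSet_of_differentiableAt ℝ v)
  let e : Euc 3 := EuclideanSpace.single 0 1
  have h1 : ApproximatesLinearOn (fun x => v x • e) (0 : Euc 3 →L[ℝ] Euc 3) s 0 := by
    intro x hx y hy
    have h1 : v x = 0 := hx.1
    have h2 : v y = 0 := hy.1
    simp [h1, h2]
  have h2 := h1.norm_fderiv_sub_le volume hs (fun x => (fderiv ℝ v x).smulRight e) fun x hx =>
    ((hx.2 : DifferentiableAt ℝ v x).hasFDerivAt.smul_const e).hasFDerivWithinAt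
  rw [ae_restrict_iff' hs] at h2
  filter_upwards [h2] with x hx hx0
  by_cases hd : DifferentiableAt ℝ v x
  · have := hx ⟨hx0, hd⟩
    simpa [e, ← NNReal.coe_le_coe, ContinuousLinearMap.norm_smulRight_apply] using this
  · exact fderiv_zero_of_not_differentiableAt hd

/-- A smooth odd function that vanishes on `[-1, 1]` and is the identity far from `0`. -/
def trunc (t : ℝ) : ℝ := t * Real.smoothTransition (t ^ 2 - 1)

theorem contDiff_trunc {n : ℕ∞} : ContDiff ℝ n trunc :=
  contDiff_id.mul (Real.smoothTransition.contDiff.comp ((contDiff_id.pow 2).sub contDiff_const))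

theorem trunc_eq_zero {t : ℝ} (ht : |t| ≤ 1) : trunc t = 0 := by
  rw [trunc, Real.smoothTransition.zero_of_nonpos (by nlinarith [sq_abs t, abs_nonneg t]), mul_zero]

theorem abs_trunc_le (t : ℝ) : |trunc t| ≤ |t| := by
  rw [trunc, abs_mul, abs_of_nonneg (Real.smoothTransition.nonneg _)]
  exact mul_le_of_le_one_right (abs_nonneg _) (Real.smoothTransition.le_one _)

theorem trunc_eq_self {t : ℝ} (ht : 2 ≤ t ^ 2) : trunc t = t := by
  rw [trunc, Real.smoothTransition.one_of_one_le (by linarith), mul_one]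

theorem deriv_trunc_nonneg (t : ℝ) : 0 ≤ deriv trunc t := by
  have h0 : Differentiable ℝ Real.smoothTransition :=
    (Real.smoothTransition.contDiff (n := 1)).differentiable (by norm_num)
  have h1 := HasDerivAt.comp t (h0 (t ^ 2 - 1)).hasDerivAt ((hasDerivAt_pow 2 t).sub_const 1)
  have h2 := ((hasDerivAt_id t).mul h1).deriv
  have h3 : deriv trunc t = _ := h2
  have h4 : 0 ≤ deriv Real.smoothTransition (t ^ 2 - 1) := Real.smoothTransition.monotone.deriv_nonneg
  rw [h3]
  have h5 := Real.smoothTransition.nonneg (t ^ 2 - 1)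
  simp only [Function.comp, id]
  have : 0 ≤ t * (deriv Real.smoothTransition (t ^ 2 - 1) * ((2 : ℕ) * t ^ (2 - 1))) := by
    norm_num
    nlinarith [mul_nonneg h4 (sq_nonneg t)]
  linarith

theorem deriv_trunc_eq_one {t : ℝ} (ht : 2 < t ^ 2) : deriv trunc t = 1 := by
  have : trunc =ᶠ[𝓝 t] id := by
    filter_upwards [(continuous_pow 2).continuousAt.eventually_const_lt ht] with s hs
    exact trunc_eq_self hs.le
  rw [this.deriv_eq, deriv_id]

theorem exists_deriv_trunc_le : ∃ B : ℝ, 1 ≤ B ∧ ∀ t, |deriv trunc t| ≤ B := by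
  obtain ⟨B, hB⟩ := (isCompact_Icc (a := (-2 : ℝ)) (b := 2)).exists_bound_of_continuousOn
    ((contDiff_trunc (n := 1)).continuous_deriv (by norm_num)).continuousOn
  refine ⟨max B 1, le_max_right _ _, fun t => ?_⟩
  by_cases ht : t ∈ Icc (-2 : ℝ) 2
  · exact (hB t ht).trans (le_max_left _ _)
  · have : 2 < t ^ 2 := by
      by_contra! h
      exact ht ⟨by nlinarith, by nlinarith⟩
    rw [deriv_trunc_eq_one this, abs_one]
    exact le_max_right _ _

/-- A continuous function vanishing on a closed set and smooth outside. -/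
structure IsSmoothOff (Z : Set (Euc 3)) (v : Euc 3 → ℝ) : Prop where
  continuous : Continuous v
  isClosed : IsClosed Z
  eq_zero : ∀ x ∈ Z, v x = 0
  contDiffOn : ContDiffOn ℝ (⊤ : ℕ∞) v Zᶜ

namespace IsSmoothOff

variable {Z : Set (Euc 3)} {v : Euc 3 → ℝ}

/-- The truncation of `v` at height `1 / N`. -/
def cut (v : Euc 3 → ℝ) (N : ℝ) (x : Euc 3) : ℝ := N⁻¹ * trunc (N * v x)

theorem contDiffAt (h : IsSmoothOff Z v) {x : Euc 3} (hx : x ∉ Z) : ContDiffAt ℝ (⊤ : ℕ∞) v x :=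
  h.contDiffOn.contDiffAt (h.isClosed.isOpen_compl.mem_nhds hx)

theorem cut_eventuallyEq (h : IsSmoothOff Z v) {x : Euc 3} (hx : v x = 0) (N : ℝ) :
    cut v N =ᶠ[𝓝 x] fun _ => 0 := by
  have h1 : Tendsto (fun y => |N * v y|) (𝓝 x) (𝓝 0) := by
    have := h.continuous
    have h2 : Continuous fun y => |N * v y| := by fun_prop
    simpa [hx] using h2.tendsto x
  filter_upwards [h1.eventually_lt_const one_pos] with y hy
  rw [cut, trunc_eq_zero hy.le, mul_zero]

theorem contDiff_cut (h : IsSmoothOff Z v) (N : ℝ) : ContDiff ℝ (⊤ : ℕ∞) (cut v N) := by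
  rw [contDiff_iff_contDiffAt]
  intro x
  by_cases hx : x ∈ Z
  · exact contDiffAt_const.congr_of_eventuallyEq (h.cut_eventuallyEq (h.eq_zero x hx) N)
  · exact contDiffAt_const.mul (contDiff_trunc.contDiffAt.comp x
      (contDiffAt_const.mul (h.contDiffAt hx)))

theorem abs_cut_le (v : Euc 3 → ℝ) {N : ℝ} (hN : 0 < N) (x : Euc 3) : |cut v N x| ≤ |v x| := by
  rw [cut, abs_mul, abs_of_pos (inv_pos.2 hN)]
  refine (mul_le_mul_of_nonneg_left (abs_trunc_le _) (inv_pos.2 hN).le).trans_eq ?_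
  rw [abs_mul, abs_of_pos hN]
  field_simp

theorem fderiv_cut (h : IsSmoothOff Z v) {N : ℝ} (hN : 0 < N) (x : Euc 3) :
    fderiv ℝ (cut v N) x = deriv trunc (N * v x) • fderiv ℝ v x := by
  by_cases hx : x ∈ Z
  · have h0 := h.eq_zero x hx
    have h1 : deriv trunc 0 = 0 := by
      have : trunc =ᶠ[𝓝 0] fun _ => 0 := by
        filter_upwards [Metric.closedBall_mem_nhds (0 : ℝ) one_pos] with t ht
        exact trunc_eq_zero (by simpa using ht)
      rw [this.deriv_eq, deriv_const]
    rw [(h.cut_eventuallyEq h0 N).fderiv_eq, h0, mul_zero, h1, zero_smul]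
    simp
  · have h1 := ((h.contDiffAt hx).differentiableAt (by simp)).hasFDerivAt
    have h2 : HasDerivAt trunc (deriv trunc (N * v x)) (N * v x) :=
      ((contDiff_trunc (n := 1)).differentiable (by norm_num) _).hasDerivAt
    have h3 := (h2.comp_hasFDerivAt x (h1.const_mul N)).const_mul N⁻¹
    have h4 : fderiv ℝ (cut v N) x = _ := h3.fderiv
    rw [h4, smul_smul, smul_smul]
    congr 1
    field_simp

theorem tendsto_cut (v : Euc 3 → ℝ) (x : Euc 3) :
    Tendsto (fun n : ℕ => cut v (n + 1) x) atTop (𝓝 (v x)) := by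
  by_cases hx : v x = 0
  · have : ∀ n : ℕ, cut v (n + 1) x = v x := fun n => by simp [cut, hx, trunc]
    simp [this]
  · refine tendsto_const_nhds.congr' ?_
    have h1 : Tendsto (fun n : ℕ => ((n : ℝ) + 1) ^ 2 * v x ^ 2) atTop atTop :=
      ((tendsto_pow_atTop two_ne_zero).comp (tendsto_atTop_add_const_right _ _
        tendsto_natCast_atTop_atTop)).atTop_mul_const (by positivity)
    filter_upwards [h1.eventually_gt_atTop 2] with n hn
    rw [cut, trunc_eq_self (by rw [mul_pow]; exact hn.le)]
    field_simp

theorem tendsto_deriv_trunc {t : ℝ} (ht : t ≠ 0) :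
    Tendsto (fun n : ℕ => deriv trunc ((n + 1) * t)) atTop (𝓝 1) := by
  refine tendsto_const_nhds.congr' ?_
  have h1 : Tendsto (fun n : ℕ => ((n : ℝ) + 1) ^ 2 * t ^ 2) atTop atTop :=
    ((tendsto_pow_atTop two_ne_zero).comp (tendsto_atTop_add_const_right _ _
      tendsto_natCast_atTop_atTop)).atTop_mul_const (by positivity)
  filter_upwards [h1.eventually_gt_atTop 2] with n hn
  rw [deriv_trunc_eq_one (by rwa [mul_pow])]

end IsSmoothOff

theorem inner_gradient_gradient (v φ : Euc 3 → ℝ) (x : Euc 3) :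
    ⟪gradient v x, gradient φ x⟫ = fderiv ℝ φ x (gradient v x) := by
  rw [real_inner_comm, gradient, InnerProductSpace.toDual_symm_apply]

theorem norm_gradient (v : Euc 3 → ℝ) (x : Euc 3) : ‖gradient v x‖ = ‖fderiv ℝ v x‖ := by
  rw [gradient, LinearIsometryEquiv.norm_map]

namespace IsSmoothOff

variable {Z : Set (Euc 3)} {v : Euc 3 → ℝ} {R : ℝ}

theorem continuous_apply_gradient (h : IsSmoothOff Z v) {L : Euc 3 → Euc 3 →L[ℝ] ℝ}
    (hL : Continuous L) (hZ : ∀ x ∈ Z, L =ᶠ[𝓝 x] fun _ => 0) :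
    Continuous fun x => L x (gradient v x) := by
  rw [continuous_iff_continuousAt]
  intro x
  by_cases hx : x ∈ Z
  · refine continuousAt_const (y := (0 : ℝ)) |>.congr ?_
    filter_upwards [hZ x hx] with y hy
    rw [hy]; rfl
  · have h1 : ContinuousAt (fderiv ℝ v) x :=
      ((h.contDiffAt hx).fderiv_right (m := 0) (by simp)).continuousAt
    have h2 : ContinuousAt (gradient v) x :=
      (LinearIsometryEquiv.continuous _).continuousAt.comp h1
    exact hL.continuousAt.clm_apply h2

/-- A Caccioppoli estimate. -/
theorem integrableOn_norm_fderiv (h : IsSmoothOff Z v) (hR : 0 < R) (hZ : Z ⊆ ball 0 R)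
    (hw : ∀ φ : Euc 3 → ℝ, ContDiff ℝ (⊤ : ℕ∞) φ → HasCompactSupport φ →
      (∀ x ∈ Z, φ =ᶠ[𝓝 x] fun _ => 0) → ∫ x, ⟪gradient v x, gradient φ x⟫ = 0) :
    IntegrableOn (fun x => ‖fderiv ℝ v x‖) (ball 0 R) := by
  let ζ : ContDiffBump (0 : Euc 3) := ⟨R, R + 1, hR, by linarith⟩
  have hζ : ContDiff ℝ (⊤ : ℕ∞) ζ := ζ.contDiff
  have hζ1 : ∀ x ∈ ball (0 : Euc 3) R, ζ =ᶠ[𝓝 x] fun _ => 1 := fun x hx => by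
    filter_upwards [isOpen_ball.mem_nhds hx] with y hy
    exact ζ.one_of_mem_closedBall (ball_subset_closedBall hy)
  have hDζ : ∀ x ∈ Z, fderiv ℝ ζ =ᶠ[𝓝 x] fun _ => 0 := fun x hx => by
    filter_upwards [(hζ1 x (hZ hx)).fderiv (𝕜 := ℝ)] with y hy
    rw [hy]; simp
  have hDζc : Continuous (fderiv ℝ ζ) := hζ.continuous_fderiv (by simp)
  have supp : ∀ q : Euc 3 → ℝ, (∀ x, x ∉ tsupport ζ → q x = 0) → HasCompactSupport q :=
    fun q hq => HasCompactSupport.intro ζ.hasCompactSupport hq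
  have hDζ0 : ∀ x, x ∉ tsupport ζ → fderiv ℝ ζ x = 0 := fun x hx =>
    image_eq_zero_of_notMem_tsupport (fun h' => hx (tsupport_fderiv_subset ℝ h'))
  let A : ℝ → Euc 3 → ℝ := fun N x => ζ x * fderiv ℝ (cut v N) x (gradient v x)
  let B : ℝ → Euc 3 → ℝ := fun N x => cut v N x * fderiv ℝ ζ x (gradient v x)
  have hDcut : ∀ N, Continuous (fderiv ℝ (cut v N)) := fun N =>
    (h.contDiff_cut N).continuous_fderiv (by simp)
  have hAc : ∀ N, Continuous (A N) := fun N => by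
    refine hζ.continuous.mul (h.continuous_apply_gradient (hDcut N) fun x hx => ?_)
    filter_upwards [(h.cut_eventuallyEq (h.eq_zero x hx) N).fderiv (𝕜 := ℝ)] with y hy
    rw [hy]; simp
  have hAi : ∀ N, Integrable (A N) := fun N => (hAc N).integrable_of_hasCompactSupport
    (supp _ fun x hx => by simp only [A, image_eq_zero_of_notMem_tsupport hx, zero_mul])
  have hDv := h.continuous_apply_gradient hDζc hDζ
  have hBi : ∀ N, Integrable (B N) := fun N =>
    ((h.contDiff_cut N).continuous.mul hDv).integrable_of_hasCompactSupport
      (supp _ fun x hx => by simp [hDζ0 x hx])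
  have hvi : Integrable fun x => v x * fderiv ℝ ζ x (gradient v x) :=
    (h.continuous.mul hDv).integrable_of_hasCompactSupport
      (supp _ fun x hx => by simp [hDζ0 x hx])
  set K := ∫ x, ‖v x * fderiv ℝ ζ x (gradient v x)‖
  have hAB : ∀ N, 0 < N → ∫ x, A N x ≤ K := by
    intro N hN
    have h1 := hw (fun x => ζ x * cut v N x) (hζ.mul (h.contDiff_cut N))
      (ζ.hasCompactSupport.mul_right) (fun x hx => by
        filter_upwards [h.cut_eventuallyEq (h.eq_zero x hx) N] with y hy
        rw [hy, mul_zero])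
    have h2 : ∀ x, ⟪gradient v x, gradient (fun x => ζ x * cut v N x) x⟫ = A N x + B N x := by
      intro x
      rw [inner_gradient_gradient, fderiv_fun_mul (hζ.differentiable (by simp) x)
        ((h.contDiff_cut N).differentiable (by simp) x)]
      simp [A, B]
    simp only [h2] at h1
    rw [integral_add (hAi N) (hBi N)] at h1
    have h3 : -∫ x, B N x ≤ K := by
      refine (neg_le_abs _).trans ((norm_integral_le_integral_norm (B N)).trans ?_)
      refine integral_mono (hBi N).norm hvi.norm fun x => ?_
      simp only [B, norm_mul]
      exact mul_le_mul_of_nonneg_right (abs_cut_le v hN x) (norm_nonneg _)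
    linarith
  have hA : ∀ N, 0 < N → ∀ x, A N x = ζ x * (deriv trunc (N * v x) * ‖fderiv ℝ v x‖ ^ 2) := by
    intro N hN x
    simp only [A]
    rw [h.fderiv_cut hN, _root_.smul_apply, ← inner_gradient_gradient,
      real_inner_self_eq_norm_sq, norm_gradient, smul_eq_mul]
  have hA0 : ∀ N, 0 < N → ∀ x, 0 ≤ A N x := fun N hN x => by
    rw [hA N hN]
    have := deriv_trunc_nonneg (N * v x)
    have := ζ.nonneg (x := x)
    positivity
  have hsq : Integrable fun x => ζ x * ‖fderiv ℝ v x‖ ^ 2 := by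
    have hm : Measurable fun x => ζ x * ‖fderiv ℝ v x‖ ^ 2 :=
      hζ.continuous.measurable.mul ((measurable_fderiv ℝ v).norm.pow_const 2)
    refine ⟨hm.aestronglyMeasurable, ?_⟩
    rw [hasFiniteIntegral_iff_ofReal (Eventually.of_forall fun x =>
      mul_nonneg ζ.nonneg (by positivity))]
    have h1 : ∫⁻ x, ENNReal.ofReal (ζ x * ‖fderiv ℝ v x‖ ^ 2) =
        ∫⁻ x, liminf (fun n : ℕ => ENNReal.ofReal (A (n + 1) x)) atTop := by
      refine lintegral_congr_ae ?_
      filter_upwards [ae_fderiv_eq_zero h.continuous] with x hx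
      refine (Tendsto.liminf_eq (ENNReal.tendsto_ofReal ?_)).symm
      simp only [fun n : ℕ => hA (n + 1) (by positivity) x]
      by_cases hv : v x = 0
      · simp [hx hv]
      · simpa using ((tendsto_deriv_trunc hv).mul_const (‖fderiv ℝ v x‖ ^ 2)).const_mul (ζ x)
    rw [h1]
    refine (lintegral_liminf_le fun n => (hAc _).measurable.ennreal_ofReal).trans_lt ?_
    refine lt_of_le_of_lt (b := ENNReal.ofReal K) ?_ ENNReal.ofReal_lt_top
    refine liminf_le_of_frequently_le' (Frequently.of_forall fun n : ℕ => ?_)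
    rw [← ofReal_integral_eq_lintegral_ofReal (hAi _)
      (Eventually.of_forall (hA0 _ (by positivity)))]
    exact ENNReal.ofReal_le_ofReal (hAB _ (by positivity))
  have h1 : IntegrableOn (fun x => 1 + ζ x * ‖fderiv ℝ v x‖ ^ 2) (ball 0 R) :=
    (integrableOn_const measure_ball_lt_top.ne).add hsq.integrableOn
  refine h1.mono' (measurable_fderiv ℝ v).norm.aestronglyMeasurable ?_
  filter_upwards [ae_restrict_mem measurableSet_ball] with x hx
  rw [ζ.one_of_mem_closedBall (ball_subset_closedBall hx), norm_norm]
  nlinarith [sq_nonneg (‖fderiv ℝ v x‖ - 1)]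

/-- Integration by parts against a test function. -/
theorem integral_fderiv_mul (h : IsSmoothOff Z v)
    (hint : IntegrableOn (fun x => ‖fderiv ℝ v x‖) (ball 0 R)) {ψ : Euc 3 → ℝ}
    (hψ : ContDiff ℝ (⊤ : ℕ∞) ψ) (hc : HasCompactSupport ψ) (hψR : ∀ x, R ≤ ‖x‖ → ψ x = 0)
    (e : Euc 3) :
    Integrable (fun x => fderiv ℝ v x e * ψ x) ∧
      ∫ x, fderiv ℝ v x e * ψ x = -∫ x, v x * fderiv ℝ ψ x e := by
  have hDψ : Continuous fun x => fderiv ℝ ψ x e :=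
    (hψ.continuous_fderiv (by simp)).clm_apply continuous_const
  have hDψc : HasCompactSupport fun x => fderiv ℝ ψ x e :=
    (hc.fderiv ℝ).mono' fun x hx => subset_closure fun h0 => hx (by simp [h0])
  obtain ⟨C, hC⟩ := hψ.continuous.bounded_above_of_compact_support hc
  have hdom : Integrable fun x => (ball (0 : Euc 3) R).indicator (fun x => ‖fderiv ℝ v x‖) x *
      (‖e‖ * C) := by
    refine Integrable.mul_const ?_ _
    rwa [integrable_indicator_iff measurableSet_ball]
  have hle : ∀ x, ‖fderiv ℝ v x e * ψ x‖ ≤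
      (ball (0 : Euc 3) R).indicator (fun x => ‖fderiv ℝ v x‖) x * (‖e‖ * C) := by
    intro x
    by_cases hx : x ∈ ball (0 : Euc 3) R
    · rw [indicator_of_mem hx, norm_mul, ← mul_assoc]
      exact mul_le_mul ((fderiv ℝ v x).le_opNorm e) (hC x) (norm_nonneg _) (by positivity)
    · rw [indicator_of_notMem hx, hψR x (by simpa using hx)]
      simp
  have hm : Measurable fun x => fderiv ℝ v x e * ψ x :=
    (measurable_fderiv_apply_const ℝ v e).mul hψ.continuous.measurable
  refine ⟨hdom.mono' hm.aestronglyMeasurable (Eventually.of_forall hle), ?_⟩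
  obtain ⟨B, hB1, hB⟩ := exists_deriv_trunc_le
  have key : ∀ n : ℕ, ∫ x, fderiv ℝ (cut v (n + 1)) x e * ψ x =
      -∫ x, cut v (n + 1) x * fderiv ℝ ψ x e := by
    intro n
    have hs := h.contDiff_cut (n + 1)
    rw [integral_mul_fderiv_eq_neg_fderiv_mul_of_integrable, neg_neg]
    · exact (((hs.continuous_fderiv (by simp)).clm_apply continuous_const).mul
        hψ.continuous).integrable_of_hasCompactSupport hc.mul_left
    · exact (hs.continuous.mul hDψ).integrable_of_hasCompactSupport hDψc.mul_left
    · exact (hs.continuous.mul hψ.continuous).integrable_of_hasCompactSupport hc.mul_left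
    · exact fun x _ => hs.differentiable (by simp) x
    · exact fun x _ => hψ.differentiable (by simp) x
  have t1 : Tendsto (fun n : ℕ => ∫ x, fderiv ℝ (cut v (n + 1)) x e * ψ x) atTop
      (𝓝 (∫ x, fderiv ℝ v x e * ψ x)) := by
    refine tendsto_integral_of_dominated_convergence _ (fun n => ?_) (hdom.const_mul B)
      (fun n => Eventually.of_forall fun x => ?_) ?_
    · exact ((measurable_fderiv_apply_const ℝ _ e).mul hψ.continuous.measurable).aestronglyMeasurable
    · rw [h.fderiv_cut (by positivity), _root_.smul_apply, smul_eq_mul, mul_assoc,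
        norm_mul]
      exact mul_le_mul (hB _) (hle x) (norm_nonneg _) (by linarith)
    · filter_upwards [ae_fderiv_eq_zero h.continuous] with x hx
      simp only [fun n : ℕ => h.fderiv_cut (show (0 : ℝ) < n + 1 by positivity) x]
      by_cases hv : v x = 0
      · simp [hx hv]
      · simpa using ((tendsto_deriv_trunc hv).mul_const (fderiv ℝ v x e)).mul_const (ψ x)
  have t2 : Tendsto (fun n : ℕ => ∫ x, cut v (n + 1) x * fderiv ℝ ψ x e) atTop
      (𝓝 (∫ x, v x * fderiv ℝ ψ x e)) := by
    refine tendsto_integral_of_dominated_convergence (fun x => ‖v x * fderiv ℝ ψ x e‖)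
      (fun n => ?_) (((h.continuous.mul hDψ).integrable_of_hasCompactSupport hDψc.mul_left).norm)
      (fun n => Eventually.of_forall fun x => ?_) (Eventually.of_forall fun x => ?_)
    · exact ((h.contDiff_cut _).continuous.mul hDψ).aestronglyMeasurable
    · rw [norm_mul, norm_mul]
      exact mul_le_mul_of_nonneg_right (abs_cut_le v (by positivity) x) (norm_nonneg _)
    · exact (tendsto_cut v x).mul_const _
  simp only [key] at t1
  exact tendsto_nhds_unique t1 t2.neg

end IsSmoothOff

theorem integral_fderiv_eq_zero {ψ : Euc 3 → ℝ} (hψ : ContDiff ℝ (⊤ : ℕ∞) ψ)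
    (hc : HasCompactSupport ψ) (e : Euc 3) :
    Integrable (fun x => fderiv ℝ ψ x e) ∧ ∫ x, fderiv ℝ ψ x e = 0 := by
  have hDψ : Continuous fun x => fderiv ℝ ψ x e :=
    (hψ.continuous_fderiv (by simp)).clm_apply continuous_const
  have hi := hDψ.integrable_of_hasCompactSupport (μ := volume)
    ((hc.fderiv ℝ).mono' fun x hx => subset_closure fun h0 => hx (by simp [h0]))
  refine ⟨hi, ?_⟩
  have := integral_mul_fderiv_eq_neg_fderiv_mul_of_integrable (μ := (volume : Measure (Euc 3)))
    (f := fun _ => (1 : ℝ)) (g := ψ) (v := e) (by simp) (by simpa using hi)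
    (by simpa using hψ.continuous.integrable_of_hasCompactSupport hc) (fun x _ => by simp)
    fun x _ => hψ.differentiable (by simp) x
  simpa using this

theorem sum_coord_mul (φ : Euc 3 → ℝ) (x w : Euc 3) :
    fderiv ℝ φ x w = ∑ i, w i * fderiv ℝ φ x (EuclideanSpace.single i 1) := by
  conv_lhs => rw [← (EuclideanSpace.basisFun (Fin 3) ℝ).sum_repr w]
  simp

theorem gradient_apply (v : Euc 3 → ℝ) (x : Euc 3) (i : Fin 3) :
    gradient v x i = fderiv ℝ v x (EuclideanSpace.single i 1) := by
  have : ⟪gradient v x, EuclideanSpace.single i (1 : ℝ)⟫ = _ :=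
    InnerProductSpace.toDual_symm_apply
  rw [← this, EuclideanSpace.inner_single_right]
  simp

theorem contDiff_fderiv_single {φ : Euc 3 → ℝ} (hφ : ContDiff ℝ (⊤ : ℕ∞) φ) (e : Euc 3) :
    ContDiff ℝ (⊤ : ℕ∞) fun x => fderiv ℝ φ x e :=
  (hφ.fderiv_right (m := (⊤ : ℕ∞)) (by simp)).clm_apply contDiff_const

theorem hasCompactSupport_fderiv_single {φ : Euc 3 → ℝ} (hc : HasCompactSupport φ) (e : Euc 3) :
    HasCompactSupport fun x => fderiv ℝ φ x e :=
  (hc.fderiv ℝ).mono' fun x hx => subset_closure fun h0 => hx (by simp [h0])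

theorem integrable_mul_lap {v φ : Euc 3 → ℝ} (hv : Continuous v) (hφ : ContDiff ℝ (⊤ : ℕ∞) φ)
    (hc : HasCompactSupport φ) (i : Fin 3) :
    Integrable fun x => v x * fderiv ℝ (fun z => fderiv ℝ φ z (EuclideanSpace.single i 1)) x
      (EuclideanSpace.single i 1) :=
  (hv.mul (contDiff_fderiv_single (contDiff_fderiv_single hφ _) _).continuous)
    |>.integrable_of_hasCompactSupport
      (hasCompactSupport_fderiv_single (hasCompactSupport_fderiv_single hc _) _).mul_left

theorem IsSmoothOff.integral_inner_gradient {Z : Set (Euc 3)} {v φ : Euc 3 → ℝ} {R : ℝ}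
    (h : IsSmoothOff Z v) (hint : IntegrableOn (fun x => ‖fderiv ℝ v x‖) (ball 0 R))
    (hφ : ContDiff ℝ (⊤ : ℕ∞) φ) (hc : HasCompactSupport φ) (hφR : tsupport φ ⊆ ball 0 R) :
    Integrable (fun x => fderiv ℝ φ x (gradient v x)) ∧
      ∫ x, fderiv ℝ φ x (gradient v x) = -∫ x, v x * lap φ x := by
  have key := fun i : Fin 3 => h.integral_fderiv_mul hint
    (contDiff_fderiv_single hφ (EuclideanSpace.single i 1))
    (hasCompactSupport_fderiv_single hc _) (fun x hx => by
      have : x ∉ tsupport φ := fun h' => by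
        have := hφR h'
        rw [mem_ball_zero_iff] at this
        linarith
      have : fderiv ℝ φ x = 0 :=
        image_eq_zero_of_notMem_tsupport (fun h' => this (tsupport_fderiv_subset ℝ h'))
      rw [this]; rfl) (EuclideanSpace.single i 1)
  have h1 : ∀ x, fderiv ℝ φ x (gradient v x) = ∑ i, fderiv ℝ v x (EuclideanSpace.single i 1) *
      fderiv ℝ φ x (EuclideanSpace.single i 1) := fun x => by
    rw [sum_coord_mul]
    simp only [gradient_apply]
  simp only [h1, lap, Finset.mul_sum]
  refine ⟨integrable_finsetSum _ fun i _ => (key i).1, ?_⟩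
  rw [integral_finsetSum _ fun i _ => (key i).1,
    integral_finsetSum _ fun i _ => integrable_mul_lap h.continuous hφ hc i,
    ← Finset.sum_neg_distrib]
  exact Finset.sum_congr rfl fun i _ => (key i).2

theorem integral_affine_mul_lap {φ : Euc 3 → ℝ} (hφ : ContDiff ℝ (⊤ : ℕ∞) φ)
    (hc : HasCompactSupport φ) (a : Euc 3) (c : ℝ) : ∫ x, (⟪a, x⟫ + c) * lap φ x = 0 := by
  have hℓ : Continuous fun x : Euc 3 => ⟪a, x⟫ + c := by fun_prop
  simp only [lap, Finset.mul_sum]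
  rw [integral_finsetSum _ fun i _ => integrable_mul_lap hℓ hφ hc i]
  refine Finset.sum_eq_zero fun i _ => ?_
  have hf : ∀ x, HasFDerivAt (fun x : Euc 3 => ⟪a, x⟫ + c) (innerSL ℝ a) x := fun x =>
    (innerSL ℝ a).hasFDerivAt.add_const c
  have hψ := contDiff_fderiv_single hφ (EuclideanSpace.single i 1)
  have hψc := hasCompactSupport_fderiv_single hc (EuclideanSpace.single i 1)
  obtain ⟨h1, h2⟩ := integral_fderiv_eq_zero hφ hc (EuclideanSpace.single i 1)
  rw [integral_mul_fderiv_eq_neg_fderiv_mul_of_integrable]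
  · simp only [(hf _).fderiv]
    rw [integral_const_mul, h2, mul_zero, neg_zero]
  · simp only [(hf _).fderiv]
    exact h1.const_mul _
  · exact integrable_mul_lap hℓ hφ hc i
  · exact (hℓ.mul hψ.continuous).integrable_of_hasCompactSupport hψc.mul_left
  · exact fun x _ => (hf x).differentiableAt
  · exact fun x _ => hψ.differentiable (by simp) x

/-- The density representing a solution that is linear in the inclusion. The correction on the
set of non-differentiability accounts for the default value of the gradient there. -/
def solDensity (Ω : Set (Euc 3)) (k : ℝ) (u : Euc 3 → ℝ) (x : Euc 3) : ℝ :=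
  (k - 1) * Ω.indicator (fun _ => 1) x + -1 * {x | ¬DifferentiableAt ℝ u x}.indicator (fun _ => 1) x

section

variable {Ω : Set (Euc 3)} {k c R : ℝ} {a b : Euc 3} {u : Euc 3 → ℝ}

theorem IsCondSol.isSmoothOff (hu : IsCondSol 3 Ω k a u)
    (hlin : ∀ x ∈ Ω, u x = ⟪b, x⟫ + c) :
    IsSmoothOff (closure Ω) (fun x => u x - (⟪b, x⟫ + c)) where
  continuous := hu.1.sub (by fun_prop)
  isClosed := isClosed_closure
  eq_zero := fun x hx => by
    have h1 : IsClosed {x | u x - (⟪b, x⟫ + c) = 0} :=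
      isClosed_singleton.preimage (hu.1.sub (by fun_prop))
    exact closure_minimal (fun y hy => by simp [hlin y hy]) h1 hx
  contDiffOn := hu.2.2.1.sub
    ((contDiff_const.inner ℝ contDiff_id).add contDiff_const).contDiffOn

theorem IsCondSol.notMem_of_not_differentiableAt (hΩ : IsOpen Ω) (hu : IsCondSol 3 Ω k a u)
    {x : Euc 3} (hx : ¬DifferentiableAt ℝ u x) : x ∉ Ω ∧ x ∈ closure Ω := by
  refine ⟨fun h => hx ?_, ?_⟩
  · exact (hu.2.1.contDiffAt (hΩ.mem_nhds h)).differentiableAt (by simp)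
  · by_contra h
    exact hx ((hu.2.2.1.contDiffAt (isClosed_closure.isOpen_compl.mem_nhds h)).differentiableAt
      (by simp))

theorem IsCondSol.isDensity (hΩ : IsOpen Ω) (hu : IsCondSol 3 Ω k a u)
    (hR : closure Ω ⊆ ball 0 R) : IsDensity (solDensity Ω k u) (|k - 1| * 1 + |-1| * 1) R := by
  have h1 := ((IsDensity.indicator_one hΩ.measurableSet (subset_closure.trans hR)).const_mul
    (k - 1)).add ((IsDensity.indicator_one (s := {x | ¬DifferentiableAt ℝ u x})
    (measurableSet_of_differentiableAt ℝ u).compl fun x hx =>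
      hR (hu.notMem_of_not_differentiableAt hΩ hx).2).const_mul (-1))
  rwa [max_self] at h1

theorem IsCondSol.weak_identity (hΩ : IsOpen Ω) (hu : IsCondSol 3 Ω k a u)
    (hlin : ∀ x ∈ Ω, u x = ⟪b, x⟫ + c) (φ : Euc 3 → ℝ) (x : Euc 3) :
    (1 + (k - 1) * Set.indicator Ω (fun _ => (1 : ℝ)) x) * ⟪gradient u x, gradient φ x⟫ =
      fderiv ℝ φ x (gradient (fun x => u x - (⟪b, x⟫ + c)) x) + fderiv ℝ φ x b +
        solDensity Ω k u x * fderiv ℝ φ x b := by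
  have hA : HasFDerivAt (fun x : Euc 3 => ⟪b, x⟫ + c) (innerSL ℝ b) x :=
    (innerSL ℝ b).hasFDerivAt.add_const c
  rw [inner_gradient_gradient, solDensity]
  by_cases hd : DifferentiableAt ℝ u x
  · have h1 : gradient (fun x => u x - (⟪b, x⟫ + c)) x = gradient u x - b := by
      have h2 : HasFDerivAt (fun x => u x - (⟪b, x⟫ + c)) _ x := hd.hasFDerivAt.sub hA
      rw [gradient, gradient, h2.fderiv, map_sub]
      congr 1
      exact (InnerProductSpace.toDual ℝ (Euc 3)).symm_apply_apply b
    have h2 : x ∉ {x | ¬DifferentiableAt ℝ u x} := fun h => h hd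
    rw [indicator_of_notMem h2, h1, map_sub]
    by_cases hx : x ∈ Ω
    · have h3 : gradient u x = b := by
        have : u =ᶠ[𝓝 x] fun x => ⟪b, x⟫ + c := by
          filter_upwards [hΩ.mem_nhds hx] with y hy using hlin y hy
        rw [gradient, this.fderiv_eq, hA.fderiv]
        exact (InnerProductSpace.toDual ℝ (Euc 3)).symm_apply_apply b
      rw [indicator_of_mem hx, h3]
      ring
    · rw [indicator_of_notMem hx]
      ring
  · have h1 : ¬DifferentiableAt ℝ (fun x => u x - (⟪b, x⟫ + c)) x := fun h =>
      hd ((h.add hA.differentiableAt).congr_of_eventuallyEq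
        (Eventually.of_forall fun y => by simp))
    have h2 : x ∈ {x | ¬DifferentiableAt ℝ u x} := hd
    rw [indicator_of_mem h2, indicator_of_notMem (hu.notMem_of_not_differentiableAt hΩ hd).1,
      gradient_eq_zero_of_not_differentiableAt hd, gradient_eq_zero_of_not_differentiableAt h1]
    simp

theorem IsCondSol.eq_inner_fieldPot (hΩ : IsOpen Ω) (hu : IsCondSol 3 Ω k a u)
    (hlin : ∀ x ∈ Ω, u x = ⟪b, x⟫ + c) (hR : closure Ω ⊆ ball 0 R) (x : Euc 3) :
    u x - ⟪a, x⟫ = ⟪fieldPot (solDensity Ω k u) x, b⟫ := by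
  have hs := hu.isSmoothOff hlin
  have hf := hu.isDensity hΩ hR
  set v := fun x => u x - (⟪b, x⟫ + c) with hv
  have hint : ∀ R', R < R' → 0 < R' → IntegrableOn (fun x => ‖fderiv ℝ v x‖) (ball 0 R') := by
    intro R' hRR hR'
    refine hs.integrableOn_norm_fderiv hR' (hR.trans (ball_subset_ball hRR.le))
      fun φ hφ hc hφZ => ?_
    have h1 := hu.2.2.2.1 φ hφ hc
    simp only [hu.weak_identity hΩ hlin] at h1
    have h0 : ∀ x ∈ closure Ω, fderiv ℝ φ x = 0 := fun x hx => by
      rw [(hφZ x hx).fderiv_eq]; simp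
    have h2 : ∀ x, solDensity Ω k u x * fderiv ℝ φ x b = 0 := by
      intro x
      by_cases hx : x ∈ closure Ω
      · simp [h0 x hx]
      · have hx1 : x ∉ Ω := fun h => hx (subset_closure h)
        have hx2 : x ∉ {x | ¬DifferentiableAt ℝ u x} := fun h =>
          hx (hu.notMem_of_not_differentiableAt hΩ h).2
        simp [solDensity, hx1, indicator_of_notMem hx2]
    obtain ⟨h3, h4⟩ := integral_fderiv_eq_zero hφ hc b
    have h5 : Integrable fun x => fderiv ℝ φ x (gradient v x) := by
      refine (hs.continuous_apply_gradient (hφ.continuous_fderiv (by simp)) fun x hx =>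
        ?_).integrable_of_hasCompactSupport ((hc.fderiv ℝ).mono' fun x hx =>
          subset_closure fun h0 => hx (by simp [h0]))
      filter_upwards [(hφZ x hx).fderiv (𝕜 := ℝ)] with y hy
      rw [hy]; simp
    simp only [h2, add_zero] at h1
    rw [integral_add h5 h3, h4, add_zero] at h1
    simpa only [inner_gradient_gradient] using h1
  refine _root_.eq_inner_fieldPot (v := fun x => u x - ⟪a, x⟫) (hu.1.sub (by fun_prop)) ?_ hf ?_ x
  · obtain ⟨C, R₀, hC, hR₀, hdec⟩ := hu.2.2.2.2
    rw [← Metric.cobounded_eq_cocompact]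
    have h1 : Tendsto (fun x : Euc 3 => C * ‖x‖ ^ (1 - ((3 : ℕ) : ℤ))) (Bornology.cobounded _)
        (𝓝 0) := by
      have := (tendsto_zpow_atTop_zero (𝕜 := ℝ) (n := 1 - ((3 : ℕ) : ℤ)) (by norm_num)).comp
        (tendsto_norm_cobounded_atTop (E := Euc 3))
      simpa using this.const_mul C
    refine squeeze_zero_norm' ?_ h1
    filter_upwards [tendsto_norm_cobounded_atTop.eventually_ge_atTop R₀] with x hx
    exact hdec x hx
  · intro φ hφ hc
    obtain ⟨R₁, hR₁⟩ := hc.isCompact.isBounded.subset_ball 0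
    set R' := max (max R R₁ + 1) 1
    have hRR : max R R₁ + 1 ≤ R' := le_max_left _ _
    have hl := le_max_left R R₁
    have hr := le_max_right R R₁
    obtain ⟨h1, h2⟩ := hs.integral_inner_gradient (hint R' (by linarith)
      (one_pos.trans_le (le_max_right _ _))) hφ hc
        (hR₁.trans (ball_subset_ball (by linarith)))
    obtain ⟨h3, h4⟩ := integral_fderiv_eq_zero hφ hc b
    have h5 : Integrable fun x => solDensity Ω k u x * fderiv ℝ φ x b :=
      h3.bdd_mul (c := |k - 1| * 1 + |-1| * 1) hf.measurable.aestronglyMeasurable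
        (Eventually.of_forall hf.bound)
    have h6 := hu.2.2.2.1 φ hφ hc
    simp only [hu.weak_identity hΩ hlin] at h6
    rw [integral_add (by exact h1.add h3) h5, integral_add h1 h3, h4, h2, add_zero] at h6
    have hlap : ∀ {w : Euc 3 → ℝ}, Continuous w → Integrable fun x => w x * lap φ x := by
      intro w hw
      simp only [lap, Finset.mul_sum]
      exact integrable_finsetSum _ fun i _ => integrable_mul_lap hw hφ hc i
    have h7 : ∫ x, v x * lap φ x = ∫ x, (u x - ⟪a, x⟫) * lap φ x := by
      have h8 : ∀ x, v x * lap φ x =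
          (u x - ⟪a, x⟫) * lap φ x + (⟪a - b, x⟫ + -c) * lap φ x := fun x => by
        rw [inner_sub_left]; simp only [hv]; ring
      simp only [h8]
      rw [integral_add (hlap (w := fun x => u x - ⟪a, x⟫) (hu.1.sub (by fun_prop)))
        (hlap (w := fun x => ⟪a - b, x⟫ + -c) (by fun_prop)),
        integral_affine_mul_lap hφ hc, add_zero]
    linarith

end

/-- The quadratic form with eigenbasis `e` and eigenvalues `m`. -/
def ellForm (e : OrthonormalBasis (Fin 3) ℝ (Euc 3)) (m : Fin 3 → ℝ) (x y : Euc 3) : ℝ :=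
  ∑ i, m i * (⟪e i, x⟫ * ⟪e i, y⟫)

/-- The open ellipsoid with center `s`, principal axes `e` and squared size `t`. -/
def ell (e : OrthonormalBasis (Fin 3) ℝ (Euc 3)) (m : Fin 3 → ℝ) (s : Euc 3) (t : ℝ) :
    Set (Euc 3) :=
  {y | ellForm e m (y - s) (y - s) < t}

/-- The depolarization factors of an ellipsoid. -/
def depol (m : Fin 3 → ℝ) (i : Fin 3) : ℝ :=
  3 * (4 * Real.pi)⁻¹ * ∫ y in ball (0 : Euc 3) 1, m i * y i ^ 2 / ∑ j, m j * y j ^ 2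

section

variable (e : OrthonormalBasis (Fin 3) ℝ (Euc 3)) (m : Fin 3 → ℝ)

theorem ellForm_comm (x y : Euc 3) : ellForm e m x y = ellForm e m y x := by
  simp only [ellForm, mul_comm ⟪e _, x⟫]

theorem ellForm_add_left (x y z : Euc 3) :
    ellForm e m (x + y) z = ellForm e m x z + ellForm e m y z := by
  simp only [ellForm, inner_add_right, ← Finset.sum_add_distrib]
  exact Finset.sum_congr rfl fun i _ => by ring

theorem ellForm_smul_left (r : ℝ) (x z : Euc 3) :
    ellForm e m (r • x) z = r * ellForm e m x z := by
  simp only [ellForm, inner_smul_right, Finset.mul_sum]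
  exact Finset.sum_congr rfl fun i _ => by ring

theorem ellForm_add_right (x y z : Euc 3) :
    ellForm e m x (y + z) = ellForm e m x y + ellForm e m x z := by
  rw [ellForm_comm, ellForm_add_left, ellForm_comm e m y, ellForm_comm e m z]

theorem ellForm_smul_right (r : ℝ) (x z : Euc 3) :
    ellForm e m x (r • z) = r * ellForm e m x z := by
  rw [ellForm_comm, ellForm_smul_left, ellForm_comm]

theorem continuous_ellForm : Continuous fun p : Euc 3 × Euc 3 => ellForm e m p.1 p.2 := by
  unfold ellForm; fun_prop

theorem continuous_ellForm_self : Continuous fun y => ellForm e m y y := by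
  unfold ellForm; fun_prop

theorem sum_inner_sq (y : Euc 3) : ∑ i, ⟪e i, y⟫ ^ 2 = ‖y‖ ^ 2 := e.sum_sq_inner_right y

theorem exists_le_ellForm (hm : ∀ i, 0 < m i) :
    ∃ c : ℝ, 0 < c ∧ ∀ y, c * ‖y‖ ^ 2 ≤ ellForm e m y y := by
  obtain ⟨i, -, hi⟩ := Finset.exists_min_image Finset.univ m ⟨0, Finset.mem_univ _⟩
  refine ⟨m i, hm i, fun y => ?_⟩
  rw [← sum_inner_sq e, Finset.mul_sum]
  refine Finset.sum_le_sum fun j hj => ?_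
  rw [← sq]
  exact mul_le_mul_of_nonneg_right (hi j hj) (sq_nonneg _)

theorem ellForm_nonneg (hm : ∀ i, 0 < m i) (y : Euc 3) : 0 ≤ ellForm e m y y := by
  obtain ⟨c, hc, h⟩ := exists_le_ellForm e m hm
  exact (by positivity : (0 : ℝ) ≤ c * ‖y‖ ^ 2).trans (h y)

theorem ellForm_pos (hm : ∀ i, 0 < m i) {y : Euc 3} (hy : y ≠ 0) : 0 < ellForm e m y y := by
  obtain ⟨c, hc, h⟩ := exists_le_ellForm e m hm
  have : 0 < ‖y‖ := norm_pos_iff.2 hy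
  exact (by positivity : (0 : ℝ) < c * ‖y‖ ^ 2).trans_le (h y)

theorem abs_ellForm_le (hm : ∀ i, 0 < m i) (x y : Euc 3) :
    |ellForm e m x y| ≤ (∑ i, m i) * (‖x‖ * ‖y‖) := by
  rw [Finset.sum_mul]
  refine (Finset.abs_sum_le_sum_abs _ _).trans (Finset.sum_le_sum fun i _ => ?_)
  rw [abs_mul, abs_of_pos (hm i), abs_mul]
  refine mul_le_mul_of_nonneg_left (mul_le_mul ?_ ?_ (abs_nonneg _) (norm_nonneg _)) (hm i).le
  · simpa using abs_real_inner_le_norm (e i) x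
  · simpa using abs_real_inner_le_norm (e i) y

theorem isOpen_ell (s : Euc 3) (t : ℝ) : IsOpen (ell e m s t) :=
  isOpen_Iio.preimage ((continuous_ellForm_self e m).comp (continuous_id.sub continuous_const))

theorem exists_ell_subset_ball (hm : ∀ i, 0 < m i) (s : Euc 3) (t : ℝ) :
    ∃ R, ell e m s t ⊆ ball 0 R := by
  obtain ⟨c, hc, h⟩ := exists_le_ellForm e m hm
  refine ⟨‖s‖ + (t / c + 1), fun y hy => ?_⟩
  rw [mem_ball_zero_iff]
  have h1 : c * ‖y - s‖ ^ 2 < t := (h _).trans_lt hy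
  have h2 : ‖y - s‖ ^ 2 < t / c := by rw [lt_div_iff₀ hc]; linarith
  have h3 : ‖y‖ ≤ ‖y - s‖ + ‖s‖ := by simpa using norm_add_le (y - s) s
  nlinarith [sq_nonneg (‖y - s‖ - 1)]

variable {e m}

/-- The length of the chord of an ellipsoid from an interior point. -/
theorem integral_indicator_ell {s x w : Euc 3} {t : ℝ} (hx : x ∈ ell e m s t)
    (hw : 0 < ellForm e m w w) :
    ∫ r : ℝ in Ioi 0, (ell e m s t).indicator (fun _ => (1 : ℝ)) (x + r • w) =
      (-ellForm e m (x - s) w + √(ellForm e m (x - s) w ^ 2 +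
        ellForm e m w w * (t - ellForm e m (x - s) (x - s)))) / ellForm e m w w := by
  set α := ellForm e m w w
  set β := ellForm e m (x - s) w
  set γ := t - ellForm e m (x - s) (x - s) with hγ
  have hγ0 : 0 < γ := sub_pos.2 hx
  set S := √(β ^ 2 + α * γ)
  have hS : S ^ 2 = β ^ 2 + α * γ := Real.sq_sqrt (by positivity)
  have hS0 : 0 ≤ S := Real.sqrt_nonneg _
  have hSβ : β < S := Real.lt_sqrt_of_sq_lt (by nlinarith [mul_pos hw hγ0])
  have hSβ' : -β < S := Real.lt_sqrt_of_sq_lt (by nlinarith [mul_pos hw hγ0])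
  have key : ∀ r : ℝ, r ∈ Ioi (0 : ℝ) → (ell e m s t).indicator (fun _ => (1 : ℝ)) (x + r • w) =
      (Ioo 0 ((-β + S) / α)).indicator (fun _ => (1 : ℝ)) r := by
    intro r hr
    have hr0 : 0 < r := hr
    have h1 : x + r • w ∈ ell e m s t ↔ α * r ^ 2 + 2 * β * r < γ := by
      have : ellForm e m (x + r • w - s) (x + r • w - s) =
          ellForm e m (x - s) (x - s) + 2 * β * r + α * r ^ 2 := by
        rw [show x + r • w - s = (x - s) + r • w by abel]
        simp only [ellForm_add_left, ellForm_add_right, ellForm_smul_left, ellForm_smul_right,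
          ellForm_comm e m w (x - s)]
        ring
      rw [ell, mem_ofPred_eq, this, hγ]
      constructor <;> intro h <;> linarith
    have h2 : α * r ^ 2 + 2 * β * r < γ ↔ r < (-β + S) / α := by
      rw [lt_div_iff₀ hw]
      constructor
      · intro h
        by_contra! h'
        nlinarith
      · intro h
        have h3 : 0 < α * r + β + S := by nlinarith [mul_pos hw hr0]
        have h4 : 0 < S - (α * r + β) := by linarith
        nlinarith [mul_pos h3 h4]
    by_cases h : r < (-β + S) / α
    · rw [indicator_of_mem (h1.2 (h2.2 h)), indicator_of_mem (mem_Ioo.2 ⟨hr0, h⟩)]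
    · rw [indicator_of_notMem fun h' => h (h2.1 (h1.1 h')),
        indicator_of_notMem fun h' => h (mem_Ioo.1 h').2]
  rw [setIntegral_congr_fun measurableSet_Ioi key, integral_indicator measurableSet_Ioo,
    Measure.restrict_restrict measurableSet_Ioo, inter_eq_left.2 Ioo_subset_Ioi_self,
    setIntegral_const, smul_eq_mul, mul_one, measureReal_def, Real.volume_Ioo, sub_zero,
    ENNReal.toReal_ofReal]
  exact div_nonneg (by linarith) hw.le

theorem integrableOn_indicator_ell {s x w : Euc 3} {t : ℝ} (hm : ∀ i, 0 < m i) (hw : ‖w‖ = 1) :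
    IntegrableOn (fun r : ℝ => (ell e m s t).indicator (fun _ => (1 : ℝ)) (x + r • w)) (Ioi 0) := by
  obtain ⟨R, hR⟩ := exists_ell_subset_ball e m hm s t
  have hmeas : Measurable fun r : ℝ => (ell e m s t).indicator (fun _ => (1 : ℝ)) (x + r • w) :=
    (measurable_const.indicator (isOpen_ell e m s t).measurableSet).comp (by fun_prop)
  have h1 : Integrable ((Icc 0 (R + ‖x‖)).indicator fun _ : ℝ => (1 : ℝ)) :=
    (integrable_indicator_iff measurableSet_Icc).2 (integrableOn_const (by simp))
  refine h1.integrableOn.mono' hmeas.aestronglyMeasurable ?_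
  filter_upwards [ae_restrict_mem measurableSet_Ioi] with r hr
  have hr0 : 0 < r := hr
  by_cases h : x + r • w ∈ ell e m s t
  · have h2 := hR h
    rw [mem_ball_zero_iff] at h2
    have h3 := norm_sub_le (x + r • w) x
    rw [add_sub_cancel_left, norm_smul, hw, mul_one, Real.norm_of_nonneg hr0.le] at h3
    rw [indicator_of_mem h, indicator_of_mem (mem_Icc.2 ⟨hr0.le, by linarith⟩)]
    simp
  · rw [indicator_of_notMem h, norm_zero]
    exact indicator_nonneg (fun _ _ => zero_le_one) r

theorem integrableOn_form_div (hm : ∀ i, 0 < m i) (w h : Euc 3) :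
    IntegrableOn (fun y => ⟪y, w⟫ * ellForm e m h y / ellForm e m y y) (ball 0 1) := by
  obtain ⟨c, hc, hle⟩ := exists_le_ellForm e m hm
  have hmeas : Measurable fun y => ⟪y, w⟫ * ellForm e m h y / ellForm e m y y := by
    unfold ellForm; fun_prop
  refine (integrableOn_const measure_ball_lt_top.ne
    (C := ‖w‖ * ((∑ i, m i) * ‖h‖) / c)).mono' hmeas.aestronglyMeasurable
    (Eventually.of_forall fun y => ?_)
  rcases eq_or_ne y 0 with rfl | hy
  · have := Finset.sum_nonneg fun i (_ : i ∈ Finset.univ) => (hm i).le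
    simp; positivity
  have h0 := ellForm_pos e m hm hy
  rw [norm_div, Real.norm_of_nonneg h0.le, norm_mul, div_le_div_iff₀ h0 hc]
  have h1 := abs_real_inner_le_norm y w
  have h2 := abs_ellForm_le e m hm h y
  calc _ ≤ ‖y‖ * ‖w‖ * ((∑ i, m i) * (‖h‖ * ‖y‖)) * c := by
        gcongr <;> assumption
    _ = ‖w‖ * ((∑ i, m i) * ‖h‖) * (c * ‖y‖ ^ 2) := by ring
    _ ≤ _ := by
        have := Finset.sum_nonneg fun i (_ : i ∈ Finset.univ) => (hm i).le
        exact mul_le_mul_of_nonneg_left (hle y) (by positivity)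

theorem inner_fieldPot_ell (hm : ∀ i, 0 < m i) {s x : Euc 3} {t : ℝ} (hx : x ∈ ell e m s t)
    (w : Euc 3) : ⟪fieldPot ((ell e m s t).indicator fun _ => 1) x, w⟫ =
      -(3 * (4 * Real.pi)⁻¹ *
        ∫ y in ball 0 1, ⟪y, w⟫ * ellForm e m (x - s) y / ellForm e m y y) := by
  obtain ⟨R, hR⟩ := exists_ell_subset_ball e m hm s t
  set χ : Euc 3 → ℝ := (ell e m s t).indicator fun _ => 1 with hχ
  have hd : IsDensity χ 1 R := IsDensity.indicator_one (isOpen_ell e m s t).measurableSet hR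
  have hi : Integrable fun y => χ y * ⟪newtonField (x - y), w⟫ :=
    ((hd.integrable_field x).inner_const w).congr
      (Eventually.of_forall fun y => by simp [inner_smul_left])
  have h0 : ⟪fieldPot χ x, w⟫ = ∫ y, χ y * ⟪newtonField (x - y), w⟫ := by
    rw [fieldPot, real_inner_comm, ← integral_inner (hd.integrable_field x)]
    simp only [inner_smul_right, real_inner_comm]
  have hi1 : Integrable fun z => χ (x - z) * ⟪newtonField z, w⟫ := by
    simpa using hi.comp_sub_left x
  have h1 : ⟪fieldPot χ x, w⟫ = ∫ z, χ (x - z) * ⟪newtonField z, w⟫ := by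
    rw [h0, ← integral_sub_left_eq_self _ _ x]
    simp
  have hi2 : Integrable fun z => χ (x + z) * ⟪newtonField z, w⟫ := by
    simpa [newtonField_neg] using hi1.comp_neg.neg
  have h2 : ⟪fieldPot χ x, w⟫ = -∫ z, χ (x + z) * ⟪newtonField z, w⟫ := by
    rw [h1, ← integral_neg_eq_self, ← integral_neg]
    simp [newtonField_neg]
  let g : Euc 3 → ℝ := fun z => 2⁻¹ * (χ (x - z) * ⟪newtonField z, w⟫ -
    χ (x + z) * ⟪newtonField z, w⟫)
  let H : Euc 3 → ℝ := fun y => -(4 * Real.pi)⁻¹ *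
    (⟪y, w⟫ * ellForm e m (x - s) y / ellForm e m y y)
  have hg : Integrable g := (hi1.sub hi2).const_mul 2⁻¹
  have h3 : ⟪fieldPot χ x, w⟫ = ∫ z, g z := by
    rw [integral_const_mul, integral_sub hi1 hi2]
    linarith
  rw [h3, integral_eq_of_radial (H := H) hg ?_ ?_ ((integrableOn_form_div hm w (x - s)).const_mul _),
    integral_const_mul]
  · ring
  · intro y hy
    have hy0 : y ≠ 0 := fun h => by simp [h] at hy
    have hα := ellForm_pos e m hm hy0
    have hα' : 0 < ellForm e m (-y) (-y) := ellForm_pos e m hm (neg_ne_zero.2 hy0)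
    have e1 := integral_indicator_ell hx hα
    have e2 := integral_indicator_ell hx hα'
    have i1 := integrableOn_indicator_ell (e := e) (s := s) (x := x) (t := t) hm hy
    have i2 := integrableOn_indicator_ell (e := e) (s := s) (x := x) (t := t) hm
      ((norm_neg y).trans hy)
    have n1 : ellForm e m (-y) (-y) = ellForm e m y y := by simp [ellForm]
    have n2 : ellForm e m (x - s) (-y) = -ellForm e m (x - s) y := by simp [ellForm]
    rw [n1, n2, neg_sq, neg_neg] at e2
    have h4 : ∀ r ∈ Ioi (0 : ℝ), r ^ 2 * g (r • y) = 2⁻¹ * ⟪newtonField y, w⟫ *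
        (χ (x + r • -y) - χ (x + r • y)) := by
      intro r hr
      have hr0 : 0 < r := hr
      simp only [g, newtonField_smul hr0, inner_smul_left, smul_neg, ← sub_eq_add_neg]
      simp
      field_simp
    rw [setIntegral_congr_fun measurableSet_Ioi h4, integral_const_mul, integral_sub i2 i1, e1, e2]
    simp only [newtonField, hy, H, inner_smul_left]
    simp
    field_simp
    ring
  · intro r y hr
    simp only [H, ellForm_smul_left, ellForm_smul_right, inner_smul_left]
    simp
    rcases eq_or_ne y 0 with rfl | hy
    · simp
    have hα := ellForm_pos e m hm hy
    field_simp

end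

theorem setIntegral_ball_comp (σ : Euc 3 ≃ₗᵢ[ℝ] Euc 3) (f : Euc 3 → ℝ) :
    ∫ y in ball 0 1, f (σ y) = ∫ y in ball 0 1, f y := by
  have h := σ.measurePreserving.setIntegral_preimage_emb
    σ.toHomeomorph.measurableEmbedding f (ball 0 1)
  rwa [LinearIsometryEquiv.preimage_ball, map_zero] at h

section

variable {e : OrthonormalBasis (Fin 3) ℝ (Euc 3)} {m : Fin 3 → ℝ}

theorem ellForm_apply_left (i : Fin 3) (y : Euc 3) : ellForm e m (e i) y = m i * ⟪e i, y⟫ := by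
  simp [ellForm, e.inner_eq_ite]

theorem depol_eq (i : Fin 3) :
    depol m i = 3 * (4 * Real.pi)⁻¹ *
      ∫ y in ball 0 1, m i * ⟪e i, y⟫ ^ 2 / ellForm e m y y := by
  rw [depol, ← setIntegral_ball_comp e.repr]
  simp [ellForm, OrthonormalBasis.repr_apply_apply, sq]

theorem integral_form_div (hm : ∀ i, 0 < m i) (h : Euc 3) (i : Fin 3) :
    3 * (4 * Real.pi)⁻¹ * ∫ y in ball 0 1, ⟪y, e i⟫ * ellForm e m h y / ellForm e m y y =
      depol m i * ⟪e i, h⟫ := by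
  let σ : Euc 3 ≃ₗᵢ[ℝ] Euc 3 := (Submodule.span ℝ {e i}).reflection
  have hσ : ∀ y, σ y = (2 * ⟪e i, y⟫) • e i - y := fun y => by
    have := Submodule.reflection_singleton_apply (𝕜 := ℝ) (e i) y
    simp only [e.norm_eq_one] at this
    rw [show σ y = _ from this]
    simp [two_smul, two_mul, add_smul]
  have h1 := setIntegral_ball_comp σ fun y => ⟪y, e i⟫ * ellForm e m h y / ellForm e m y y
  have h2 : ∀ y, ⟪σ y, e i⟫ * ellForm e m h (σ y) / ellForm e m (σ y) (σ y) =
      2 * ⟪e i, h⟫ * (m i * ⟪e i, y⟫ ^ 2 / ellForm e m y y) -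
        ⟪y, e i⟫ * ellForm e m h y / ellForm e m y y := by
    intro y
    have e1 : ⟪σ y, e i⟫ = ⟪e i, y⟫ := by
      rw [hσ, inner_sub_left, inner_smul_left, real_inner_comm (e i) y]
      simp; ring
    have e2 : ∀ z, ellForm e m z (σ y) = 2 * ⟪e i, y⟫ * (m i * ⟪e i, z⟫) - ellForm e m z y := by
      intro z
      rw [hσ, sub_eq_add_neg, ellForm_add_right, ellForm_smul_right, ellForm_comm e m z (e i),
        ellForm_apply_left, ← neg_one_smul ℝ y, ellForm_smul_right]
      ring
    have e3 : ellForm e m (σ y) (σ y) = ellForm e m y y := by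
      rw [e2, ellForm_comm e m (σ y) y, e2, real_inner_comm (σ y), e1]
      ring
    rw [e3, e1, e2, real_inner_comm (e i) y]
    ring
  have hi := integrableOn_form_div (e := e) hm (e i) h
  have hi2 := (integrableOn_form_div (e := e) hm (e i) (e i)).congr_fun
    (g := fun y => m i * ⟪e i, y⟫ ^ 2 / ellForm e m y y) (fun y _ => by
      simp only [ellForm_apply_left]
      rw [real_inner_comm]; ring) measurableSet_ball
  simp only [h2] at h1
  rw [integral_sub (hi2.const_mul _) hi, integral_const_mul] at h1
  rw [depol_eq (e := e)]
  linear_combination (-(3 * (4 * Real.pi)⁻¹ / 2)) * h1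

/-- The field of an ellipsoid is affine inside. -/
theorem inner_fieldPot_ell_apply (hm : ∀ i, 0 < m i) {s x : Euc 3} {t : ℝ}
    (hx : x ∈ ell e m s t) (i : Fin 3) :
    ⟪fieldPot ((ell e m s t).indicator fun _ => 1) x, e i⟫ = -(depol m i * ⟪e i, x - s⟫) := by
  rw [inner_fieldPot_ell hm hx, integral_form_div hm]

end

theorem ball_eq_ell (s : Euc 3) {r : ℝ} (hr : 0 < r) :
    ball s r = ell (EuclideanSpace.basisFun (Fin 3) ℝ) (fun _ => 1) s (r ^ 2) := by
  ext y
  simp only [ell, ellForm, mem_ofPred_eq, mem_ball, dist_eq_norm, one_mul, ← sq, sum_inner_sq]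
  exact (pow_lt_pow_iff_left₀ (norm_nonneg _) hr.le two_ne_zero).symm

/-- Inside a ball, the field of the ball is affine. -/
theorem exists_fieldPot_ball (s : Euc 3) {r : ℝ} (hr : 0 < r) (b : Euc 3) :
    ∃ w : Euc 3, ∀ x ∈ ball s r,
      ⟪fieldPot ((ball s r).indicator fun _ => 1) x, b⟫ = ⟪w, x - s⟫ := by
  let e := EuclideanSpace.basisFun (Fin 3) ℝ
  refine ⟨-∑ i, (⟪e i, b⟫ * depol (fun _ => 1) i) • e i, fun x hx => ?_⟩
  have h : ∀ i, _ := inner_fieldPot_ell_apply (e := e) (m := fun _ => 1) (fun _ => one_pos)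
    (ball_eq_ell s hr ▸ hx)
  rw [← ball_eq_ell s hr] at h
  rw [← e.sum_inner_mul_inner, inner_neg_left, sum_inner, ← Finset.sum_neg_distrib]
  refine Finset.sum_congr rfl fun i _ => ?_
  rw [h, inner_smul_left]
  simp
  ring

theorem contDiffOn_newtonField : ContDiffOn ℝ 2 newtonField ({0}ᶜ : Set (Euc 3)) := by
  intro z hz
  have h : ContDiffAt ℝ 2 (fun z : Euc 3 => ‖z‖) z := contDiffAt_norm ℝ hz
  refine ContDiffAt.contDiffWithinAt ?_
  refine ContDiffAt.smul (ContDiffAt.neg (contDiffAt_const.mul ((h.pow 3).inv ?_))) contDiffAt_id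
  exact pow_ne_zero 3 (norm_ne_zero_iff.2 hz)

/-- Second differences of the Newtonian field on the unit sphere. -/
theorem exists_norm_second_difference_unit_le : ∃ C : ℝ, 0 < C ∧ ∀ p h : Euc 3, ‖p‖ = 1 →
    ‖h‖ ≤ 2⁻¹ →
    ‖newtonField (p + h) + newtonField (p - h) - (2 : ℝ) • newtonField p‖ ≤ C * ‖h‖ ^ 2 := by
  let U : Set (Euc 3) := {0}ᶜ
  have hU : IsOpen U := isOpen_compl_singleton
  have h1 : ContDiffOn ℝ 1 (fderiv ℝ newtonField) U :=
    contDiffOn_newtonField.fderiv_of_isOpen hU (by norm_num)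
  have h2 : ContinuousOn (fderiv ℝ (fderiv ℝ newtonField)) U :=
    h1.continuousOn_fderiv_of_isOpen hU le_rfl
  let S : Set (Euc 3) := closedBall 0 2 \ ball 0 2⁻¹
  have hS : IsCompact S := (isCompact_closedBall 0 2).diff isOpen_ball
  have hSU : S ⊆ U := by
    rintro z ⟨-, hz⟩ rfl
    exact hz (mem_ball_self (by norm_num))
  obtain ⟨C, hC⟩ : ∃ C, ∀ z ∈ S, ‖fderiv ℝ (fderiv ℝ newtonField) z‖ ≤ C := by
    obtain ⟨C, hC⟩ := (hS.image_of_continuousOn ((continuous_norm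
      (E := Euc 3 →L[ℝ] Euc 3 →L[ℝ] Euc 3)).comp_continuousOn (h2.mono hSU))).bddAbove
    exact ⟨C, fun z hz => hC (mem_image_of_mem _ hz)⟩
  have hball : ∀ p : Euc 3, ‖p‖ = 1 → closedBall p 2⁻¹ ⊆ S := by
    intro p hp z hz
    rw [mem_closedBall, dist_eq_norm] at hz
    have a1 := norm_sub_norm_le z p
    have a2 := norm_sub_norm_le p z
    rw [norm_sub_rev] at a2
    constructor
    · rw [mem_closedBall_zero_iff]; linarith
    · rw [mem_ball_zero_iff]; linarith
  have key : ∀ p h : Euc 3, ‖p‖ = 1 → ‖h‖ ≤ 2⁻¹ →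
      ‖newtonField (p + h) - newtonField p - fderiv ℝ newtonField p h‖ ≤
        max C 1 * ‖h‖ * ‖h‖ := by
    intro p h hp hh
    have hpc : p ∈ closedBall p ‖h‖ := mem_closedBall_self (norm_nonneg h)
    have hsub : closedBall p ‖h‖ ⊆ S := (closedBall_subset_closedBall hh).trans (hball p hp)
    have hd : ∀ z ∈ closedBall p ‖h‖,
        ‖fderiv ℝ newtonField z - fderiv ℝ newtonField p‖ ≤ max C 1 * ‖h‖ := by
      intro z hz
      refine ((convex_closedBall p ‖h‖).norm_image_sub_le_of_norm_fderiv_le (𝕜 := ℝ)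
        (fun y hy => (h1.differentiableOn one_ne_zero).differentiableAt
          (hU.mem_nhds (hSU (hsub hy)))) (fun y hy => hC y (hsub hy)) hpc hz).trans ?_
      rw [← dist_eq_norm]
      exact mul_le_mul (le_max_left _ _) hz dist_nonneg (le_max_of_le_right zero_le_one)
    have := (convex_closedBall p ‖h‖).norm_image_sub_le_of_norm_fderiv_le' (𝕜 := ℝ)
      (f := newtonField) (φ := fderiv ℝ newtonField p)
      (fun y hy => (contDiffOn_newtonField.differentiableOn two_ne_zero).differentiableAt
          (hU.mem_nhds (hSU (hsub hy)))) hd hpc (y := p + h) (by simp)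
    simpa using this
  refine ⟨2 * max C 1, by positivity, fun p h hp hh => ?_⟩
  have k1 := key p h hp hh
  have k2 := key p (-h) hp (by simpa using hh)
  rw [norm_neg, map_neg] at k2
  calc _ = ‖(newtonField (p + h) - newtonField p - fderiv ℝ newtonField p h) +
        (newtonField (p + -h) - newtonField p - -fderiv ℝ newtonField p h)‖ := by
        rw [two_smul, ← sub_eq_add_neg]; congr 1; abel
    _ ≤ _ := (norm_add_le _ _).trans (by linarith)

/-- Second differences of the Newtonian field. -/
theorem exists_norm_second_difference_le : ∃ C : ℝ, 0 < C ∧ ∀ p h : Euc 3, p ≠ 0 →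
    ‖h‖ ≤ 2⁻¹ * ‖p‖ →
    ‖newtonField (p + h) + newtonField (p - h) - (2 : ℝ) • newtonField p‖ ≤
      C * ‖h‖ ^ 2 * (‖p‖ ^ 4)⁻¹ := by
  obtain ⟨C, hC, H⟩ := exists_norm_second_difference_unit_le
  refine ⟨C, hC, fun p h hp hh => ?_⟩
  set r := ‖p‖ with hr
  have hr0 : 0 < r := norm_pos_iff.2 hp
  have h1 := H (r⁻¹ • p) (r⁻¹ • h) (by rw [norm_smul, norm_inv, norm_norm, inv_mul_cancel₀ hr0.ne'])
    (by rw [norm_smul, norm_inv, Real.norm_of_nonneg hr0.le, inv_mul_le_iff₀ hr0]; linarith)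
  rw [← smul_add, ← smul_sub, newtonField_smul (inv_pos.2 hr0), newtonField_smul (inv_pos.2 hr0),
    newtonField_smul (inv_pos.2 hr0), smul_comm (2 : ℝ), ← smul_add, ← smul_sub, norm_smul,
    norm_smul] at h1
  rw [norm_inv, norm_inv, Real.norm_of_nonneg hr0.le, Real.norm_of_nonneg (by positivity)] at h1
  have h2 := mul_le_mul_of_nonneg_left h1 (by positivity : 0 ≤ (r ^ 2)⁻¹)
  calc _ = _ := ?_
    _ ≤ _ := h2
    _ = _ := ?_
  · field_simp
  · field_simp

theorem IsDensity.norm_setIntegral_le {g : Euc 3 → ℝ} {M R : ℝ} (hg : IsDensity g M R) {B : Set (Euc 3)}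
    {l δ : ℝ} (hl : 0 < l) (hδ : ∫ y in B, |g y| ≤ δ)
    (x : Euc 3) :
    ‖∫ y in B, g y • newtonField (x - y)‖ ≤ M * l + (4 * Real.pi)⁻¹ * (l ^ 2)⁻¹ * δ := by
  have hπ := Real.pi_pos
  let k : Euc 3 → ℝ := (ball 0 l).indicator fun z => (‖z‖ ^ 2)⁻¹
  have hk : Integrable k := (integrable_indicator_iff measurableSet_ball).2
    (integrableOn_norm_inv_sq l)
  have hk0 : ∀ z, 0 ≤ k z := fun z => indicator_nonneg (fun _ _ => by positivity) z
  have hk1 : Integrable fun y => M * (4 * Real.pi)⁻¹ * k (x - y) :=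
    (hk.comp_sub_left x).const_mul _
  have hg1 : Integrable fun y => (4 * Real.pi)⁻¹ * (l ^ 2)⁻¹ * |g y| := hg.integrable.abs.const_mul _
  have hM := hg.nonneg
  have hpt : ∀ y, ‖g y • newtonField (x - y)‖ ≤
      M * (4 * Real.pi)⁻¹ * k (x - y) + (4 * Real.pi)⁻¹ * (l ^ 2)⁻¹ * |g y| := by
    intro y
    rw [norm_smul, norm_newtonField, Real.norm_eq_abs]
    by_cases h : ‖x - y‖ < l
    · have : k (x - y) = (‖x - y‖ ^ 2)⁻¹ := indicator_of_mem (mem_ball_zero_iff.2 h) _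
      rw [this]
      have h1 : |g y| * ((4 * Real.pi)⁻¹ * (‖x - y‖ ^ 2)⁻¹) ≤
          M * ((4 * Real.pi)⁻¹ * (‖x - y‖ ^ 2)⁻¹) :=
        mul_le_mul_of_nonneg_right (hg.bound y) (by positivity)
      have h2 : 0 ≤ (4 * Real.pi)⁻¹ * (l ^ 2)⁻¹ * |g y| := by positivity
      linarith
    · have h1 : (‖x - y‖ ^ 2)⁻¹ ≤ (l ^ 2)⁻¹ := by
        have := not_lt.1 h
        gcongr
      have h2 : |g y| * ((4 * Real.pi)⁻¹ * (‖x - y‖ ^ 2)⁻¹) ≤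
          |g y| * ((4 * Real.pi)⁻¹ * (l ^ 2)⁻¹) := by gcongr
      have h3 : 0 ≤ M * (4 * Real.pi)⁻¹ * k (x - y) := mul_nonneg (by positivity) (hk0 _)
      linarith
  have hmain : ∫ y in B, M * (4 * Real.pi)⁻¹ * k (x - y) ≤ M * l := by
    refine (setIntegral_le_integral hk1 (Eventually.of_forall fun y =>
      mul_nonneg (by positivity) (hk0 _))).trans_eq ?_
    rw [integral_const_mul, integral_sub_left_eq_self, integral_indicator measurableSet_ball,
      setIntegral_norm_inv_sq hl.le]
    field_simp
  calc _ ≤ ∫ y in B, ‖g y • newtonField (x - y)‖ := norm_integral_le_integral_norm _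
    _ ≤ ∫ y in B, (M * (4 * Real.pi)⁻¹ * k (x - y) + (4 * Real.pi)⁻¹ * (l ^ 2)⁻¹ * |g y|) :=
        integral_mono (hg.integrable_field x).norm.integrableOn (hk1.add hg1).integrableOn hpt
    _ = _ := integral_add hk1.integrableOn hg1.integrableOn
    _ ≤ _ := add_le_add hmain (by
        rw [integral_const_mul]
        exact mul_le_mul_of_nonneg_left hδ (by positivity))

/-- Second differences of the field of a density which is small near a point. -/
theorem exists_second_difference_fieldPot_le : ∃ C : ℝ, 0 < C ∧
    ∀ (g : Euc 3 → ℝ) (M R : ℝ), IsDensity g M R → ∀ (x₀ p h : Euc 3) (ρ η : ℝ),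
    0 < ρ → 0 < η → ‖p - x₀‖ + ‖h‖ ≤ ρ / 2 → ∫ y in ball x₀ (2 * ρ), |g y| ≤ η ^ 3 * ρ ^ 3 →
    ‖fieldPot g (p + h) + fieldPot g (p - h) - (2 : ℝ) • fieldPot g p‖ ≤
      C * (M + 1) * (η * ρ + ‖h‖ ^ 2 / ρ) := by
  obtain ⟨C, hC, H⟩ := exists_norm_second_difference_le
  have hπ := Real.pi_pos
  refine ⟨4 + C * (4 * Real.pi), by positivity, fun g M R hg x₀ p h ρ η hρ hη hph hδ => ?_⟩
  set B := ball x₀ (2 * ρ)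
  have hM := hg.nonneg
  have near : ∀ x, ‖∫ y in B, g y • newtonField (x - y)‖ ≤ (M + 1) * (η * ρ) := by
    intro x
    refine (hg.norm_setIntegral_le (mul_pos hη hρ) hδ x).trans ?_
    have : (4 * Real.pi)⁻¹ ≤ 1 := inv_le_one_of_one_le₀ (by linarith [Real.pi_gt_three])
    have h2 : (4 * Real.pi)⁻¹ * ((η * ρ) ^ 2)⁻¹ * (η ^ 3 * ρ ^ 3) =
        (4 * Real.pi)⁻¹ * (η * ρ) := by field_simp
    rw [h2]
    nlinarith [mul_pos hη hρ]
  have hfar : ∀ y ∈ Bᶜ, ‖g y • newtonField (p + h - y) + g y • newtonField (p - h - y) -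
      (2 : ℝ) • (g y • newtonField (p - y))‖ ≤
      M * (C * ‖h‖ ^ 2) * (ball (0 : Euc 3) ρ)ᶜ.indicator (fun z => (‖z‖ ^ 4)⁻¹) (p - y) := by
    intro y hy
    have h1 : 2 * ρ ≤ ‖y - x₀‖ := by simpa [B, dist_eq_norm] using hy
    have h2 : ‖y - x₀‖ ≤ ‖p - y‖ + ‖p - x₀‖ := by
      rw [norm_sub_rev p y]; simpa using norm_add_le (y - p) (p - x₀)
    have h3 := norm_nonneg h
    have h3' := norm_nonneg (p - x₀)
    have h4 : ρ ≤ ‖p - y‖ := by linarith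
    rw [indicator_of_mem (by simpa using h4)]
    have h5 := H (p - y) h (norm_pos_iff.1 (hρ.trans_le h4)) (by linarith)
    rw [show p + h - y = p - y + h by abel, show p - h - y = p - y - h by abel,
      smul_comm (2 : ℝ), ← smul_add, ← smul_sub, norm_smul, mul_assoc M]
    exact mul_le_mul (hg.bound y) h5 (norm_nonneg _) hM
  obtain ⟨i4, e4⟩ := integrableOn_norm_inv_four hρ
  have i4' := (integrable_indicator_iff measurableSet_ball.compl).2 i4
  have hk1 := (i4'.comp_sub_left p).const_mul (M * (C * ‖h‖ ^ 2))
  have far : ‖∫ y in Bᶜ, (g y • newtonField (p + h - y) + g y • newtonField (p - h - y) -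
      (2 : ℝ) • (g y • newtonField (p - y)))‖ ≤ M * (C * ‖h‖ ^ 2) * (4 * Real.pi / ρ) := by
    refine (norm_integral_le_of_norm_le hk1.integrableOn
      ((ae_restrict_mem measurableSet_ball.compl).mono hfar)).trans ?_
    refine (setIntegral_le_integral hk1 (Eventually.of_forall fun y =>
      mul_nonneg (by positivity) (indicator_nonneg (fun _ _ => by positivity) _))).trans_eq ?_
    rw [integral_const_mul, integral_sub_left_eq_self, integral_indicator measurableSet_ball.compl,
      e4]
  have hsplit : ∀ x, fieldPot g x = (∫ y in B, g y • newtonField (x - y)) +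
      ∫ y in Bᶜ, g y • newtonField (x - y) := fun x =>
    (integral_add_compl measurableSet_ball (hg.integrable_field x)).symm
  have hi : ∀ x, IntegrableOn (fun y => g y • newtonField (x - y)) Bᶜ := fun x =>
    (hg.integrable_field x).integrableOn
  have hi1 : IntegrableOn (fun y => g y • newtonField (p + h - y) + g y • newtonField (p - h - y))
    Bᶜ := (hi _).add (hi _)
  have hi2 : IntegrableOn (fun y => (2 : ℝ) • (g y • newtonField (p - y))) Bᶜ :=
    (hi p).smul (2 : ℝ)
  rw [integral_sub hi1 hi2, integral_add (hi _) (hi _),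
    integral_smul] at far
  set P := fun x => ∫ y in B, g y • newtonField (x - y)
  set Q := fun x => ∫ y in Bᶜ, g y • newtonField (x - y)
  calc _ = ‖(P (p + h) + P (p - h) - (2 : ℝ) • P p) + (Q (p + h) + Q (p - h) - (2 : ℝ) • Q p)‖ := by
        rw [hsplit, hsplit, hsplit, smul_add]; congr 1; abel
    _ ≤ ‖P (p + h) + P (p - h) - (2 : ℝ) • P p‖ + ‖Q (p + h) + Q (p - h) - (2 : ℝ) • Q p‖ :=
        norm_add_le _ _
    _ ≤ (‖P (p + h)‖ + ‖P (p - h)‖ + ‖(2 : ℝ) • P p‖) + M * (C * ‖h‖ ^ 2) * (4 * Real.pi / ρ) :=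
        add_le_add ((norm_sub_le _ _).trans (add_le_add_left (norm_add_le _ _) _)) far
    _ ≤ (4 * ((M + 1) * (η * ρ))) + (M + 1) * (C * ‖h‖ ^ 2) * (4 * Real.pi / ρ) := by
        have := near p
        rw [norm_smul, Real.norm_two]
        gcongr
        · linarith [near (p + h), near (p - h), near p]
        · linarith
    _ ≤ _ := by
        have a1 : 0 ≤ (M + 1) * (η * ρ) * (C * (4 * Real.pi)) := by positivity
        have a2 : 0 ≤ (M + 1) * (‖h‖ ^ 2 / ρ) * 4 := by positivity
        have : (M + 1) * (C * ‖h‖ ^ 2) * (4 * Real.pi / ρ) =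
          (M + 1) * (‖h‖ ^ 2 / ρ) * (C * (4 * Real.pi)) := by ring
        rw [this]; linarith

theorem volume_real_ball (x : Euc 3) {r : ℝ} (hr : 0 ≤ r) :
    volume.real (ball x r) = r ^ 3 * (Real.pi * 4 / 3) := by
  rw [measureReal_def, Measure.addHaar_ball volume x hr, ENNReal.toReal_mul, ← measureReal_def,
    volume_real_unitBall, ENNReal.toReal_ofReal (by positivity)]
  simp

/-- Lebesgue density points. -/
theorem ae_volume_ball_diff_le (F : Set (Euc 3)) (hF : MeasurableSet F) :
    ∀ᵐ x ∂volume.restrict F, ∀ τ : ℝ, 0 < τ → ∃ r₀ : ℝ, 0 < r₀ ∧ ∀ r, 0 < r → r < r₀ →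
      volume.real (ball x r \ F) ≤ τ * r ^ 3 := by
  filter_upwards [Besicovitch.ae_tendsto_measure_inter_div volume F] with x hx τ hτ
  set V := Real.pi * 4 / 3
  have hV : 0 < V := by positivity
  have h1 := (ENNReal.tendsto_toReal ENNReal.one_ne_top).comp hx
  have h2 := h1.eventually (lt_mem_nhds (a := 1 - τ / V) 
    (by rw [ENNReal.toReal_one]; linarith [div_pos hτ hV]))
  obtain ⟨r₀, hr₀, h3⟩ := mem_nhdsGT_iff_exists_Ioo_subset.1 h2
  refine ⟨r₀, hr₀, fun r hr hrr => ?_⟩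
  have h4 : 1 - τ / V < volume.real (F ∩ closedBall x r) / volume.real (closedBall x r) := by
    simpa [measureReal_def] using h3 ⟨hr, hrr⟩
  rw [Measure.addHaar_real_closedBall_eq_addHaar_real_ball, volume_real_ball x hr.le,
    lt_div_iff₀ (by positivity)] at h4
  have h5 := measureReal_inter_add_sdiff (μ := volume) (s := closedBall x r) hF
    measure_closedBall_lt_top.ne
  rw [Measure.addHaar_real_closedBall_eq_addHaar_real_ball, volume_real_ball x hr.le,
    inter_comm] at h5
  have h6 : volume.real (ball x r \ F) ≤ volume.real (closedBall x r \ F) :=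
    measureReal_mono (sdiff_subset_sdiff_left ball_subset_closedBall)
      ((measure_mono sdiff_subset).trans_lt measure_closedBall_lt_top).ne
  have h7 : (1 - τ / V) * (r ^ 3 * V) = r ^ 3 * V - τ * r ^ 3 := by field_simp
  change (1 - τ / V) * (r ^ 3 * V) < _ at h4
  change _ = r ^ 3 * V at h5
  linarith

/-- Near a density point of `F`, every point is an end point of a short segment whose midpoint and
other end point are in `F`. -/
theorem exists_midpoint {F : Set (Euc 3)} {x₀ x : Euc 3} {r : ℝ} (hr : 0 < r)
    (hx : ‖x - x₀‖ ≤ r) (hF : volume.real (ball x₀ (3 * r) \ F) ≤ 1 / 54 * (3 * r) ^ 3) :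
    ∃ p ∈ F, p ∈ ball x₀ r ∧ (2 : ℝ) • p - x ∈ F := by
  by_contra! hcon
  set G := ball x₀ (3 * r) \ F
  have hG : volume G ≠ ⊤ := ((measure_mono sdiff_subset).trans_lt measure_ball_lt_top).ne
  set G' := (fun p : Euc 3 => (2 : ℝ) • p) ⁻¹' ((fun p => p + -x) ⁻¹' G) with hG'
  have hv : volume G' = ENNReal.ofReal (1 / 8) * volume G := by
    rw [hG', Measure.addHaar_preimage_smul volume two_ne_zero, measure_preimage_add_right]
    norm_num
  have hsub : ball x₀ r ⊆ G ∪ G' := by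
    intro p hp
    rw [mem_ball, dist_eq_norm] at hp
    by_cases h : p ∈ F
    · right
      refine ⟨?_, fun h' => hcon p h (by rwa [mem_ball, dist_eq_norm]) (by
        rwa [sub_eq_add_neg])⟩
      rw [mem_ball, dist_eq_norm]
      have e : (2 : ℝ) • p + -x - x₀ = (2 : ℝ) • (p - x₀) - (x - x₀) := by
        rw [smul_sub, two_smul ℝ x₀]; abel
      rw [e]
      have := norm_sub_le ((2 : ℝ) • (p - x₀)) (x - x₀)
      rw [norm_smul, Real.norm_two] at this
      linarith
    · left
      exact ⟨by rw [mem_ball, dist_eq_norm]; linarith, h⟩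
  have hG't : volume G' ≠ ⊤ := by rw [hv]; exact ENNReal.mul_ne_top ENNReal.ofReal_ne_top hG
  have h1 := (measureReal_mono hsub (measure_union_ne_top hG hG't)).trans
    (measureReal_union_le (μ := volume) G G')
  have h2 : volume.real G' = 1 / 8 * volume.real G := by
    rw [measureReal_def, hv, ENNReal.toReal_mul, ENNReal.toReal_ofReal (by norm_num)]; rfl
  rw [h2, volume_real_ball x₀ hr.le] at h1
  have := Real.pi_gt_three
  have h3 : 0 < r ^ 3 := by positivity
  nlinarith

/-- A function given by the field of a density, which vanishes on a set where the density is
constant, is differentiable at the density points of this set. -/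
theorem differentiableAt_of_density_point {f v : Euc 3 → ℝ} {M R c : ℝ} {a b x₀ : Euc 3}
    {F : Set (Euc 3)} (hf : IsDensity f M R) (hF : MeasurableSet F)
    (hv : ∀ x, v x = ⟪fieldPot f x, b⟫ + ⟪a, x⟫ + c) (hF0 : ∀ x ∈ F, v x = 0)
    (hF1 : ∀ x ∈ F, f x = -1) (hx₀ : x₀ ∈ F)
    (hd : ∀ τ : ℝ, 0 < τ → ∃ r₀ : ℝ, 0 < r₀ ∧ ∀ r, 0 < r → r < r₀ →
      volume.real (ball x₀ r \ F) ≤ τ * r ^ 3) : DifferentiableAt ℝ v x₀ := by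
  obtain ⟨C, hC, H⟩ := exists_second_difference_fieldPot_le
  obtain ⟨w, hw⟩ := exists_fieldPot_ball x₀ one_pos b
  have hχ : IsDensity ((ball x₀ 1).indicator fun _ => 1) 1 (1 + ‖x₀‖) :=
    IsDensity.indicator_one measurableSet_ball (ball_subset_ball' (by simp))
  have hg := hf.add hχ
  set g : Euc 3 → ℝ := fun y => f y + (ball x₀ 1).indicator (fun _ => 1) y with hgdef
  have hM : 0 ≤ M := hf.nonneg
  set K := C * (M + 1 + 1) * ‖b‖ with hK
  have hK0 : 0 ≤ K := by positivity
  refine HasFDerivAt.differentiableAt (f' := 0)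
    ((hasFDerivAt_iff_isLittleO).2 (Asymptotics.isLittleO_iff.2 fun ε hε => ?_))
  obtain ⟨ε₁, hε₁, hε8, hεK⟩ : ∃ ε₁ : ℝ, 0 < ε₁ ∧ ε₁ ≤ 1 / 8 ∧ K * 5 * ε₁ ≤ ε := by
    refine ⟨min (1 / 8) (ε / (K * 5 + 1)), lt_min (by norm_num) (by positivity),
      min_le_left _ _, ?_⟩
    calc K * 5 * min (1 / 8) (ε / (K * 5 + 1)) ≤ (K * 5 + 1) * (ε / (K * 5 + 1)) :=
          mul_le_mul (by linarith) (min_le_right _ _) (by positivity) (by positivity)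
      _ = ε := by field_simp
  obtain ⟨r₀, hr₀, hd⟩ := hd (min (1 / 54) ((ε₁ ^ 2) ^ 3 / (8 * (M + 1)))) (by positivity)
  filter_upwards [ball_mem_nhds x₀ (show 0 < min r₀ 1 * ε₁ / 2 by positivity)] with x hx
  rw [mem_ball, dist_eq_norm] at hx
  rw [hF0 x₀ hx₀]
  set r := ‖x - x₀‖ with hr
  rcases (norm_nonneg (x - x₀)).eq_or_lt with h0 | hr0
  · rw [eq_comm, norm_eq_zero, sub_eq_zero] at h0
    have hr1 : 0 ≤ r := norm_nonneg _
    simp only [h0, hF0 x₀ hx₀, sub_self, map_zero, norm_zero]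
    positivity
  rw [← hr] at hr0
  set ρ := r / ε₁ with hρ
  have hρ0 : 0 < ρ := by positivity
  have hrρ : r = ε₁ * ρ := by rw [hρ]; field_simp
  have hρ1 : 2 * ρ < min r₀ 1 := by
    rw [hrρ] at hx
    nlinarith
  have hρr := hρ1.trans_le (min_le_left _ _)
  have hρ2 := hρ1.trans_le (min_le_right _ _)
  have h8 : r ≤ 1 / 8 * ρ := by rw [hrρ]; exact mul_le_mul_of_nonneg_right hε8 hρ0.le
  obtain ⟨p, hpF, hp, hqF⟩ := exists_midpoint hr0 hr.ge
    ((hd (3 * r) (by positivity) (by linarith)).trans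
      (mul_le_mul_of_nonneg_right (min_le_left _ _) (by positivity)))
  rw [mem_ball, dist_eq_norm] at hp
  have hh : ‖x - p‖ ≤ 2 * r := by
    have := norm_sub_le (x - x₀) (p - x₀)
    rw [sub_sub_sub_cancel_right] at this
    linarith
  have hint : ∫ y in ball x₀ (2 * ρ), |g y| ≤ (ε₁ ^ 2) ^ 3 * ρ ^ 3 := by
    have hi : IntegrableOn ((ball x₀ (2 * ρ) \ F).indicator fun _ => M + 1) (ball x₀ (2 * ρ)) :=
      (integrableOn_const measure_ball_lt_top.ne).indicator (measurableSet_ball.diff hF)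
    have h1 : ∫ y in ball x₀ (2 * ρ), |g y| ≤
        ∫ y in ball x₀ (2 * ρ), (ball x₀ (2 * ρ) \ F).indicator (fun _ => M + 1) y := by
      refine setIntegral_mono_on hg.integrable.abs.integrableOn hi measurableSet_ball fun y hy => ?_
      by_cases h : y ∈ F
      · rw [indicator_of_notMem (fun h' => h'.2 h)]
        have : y ∈ ball x₀ 1 := ball_subset_ball hρ2.le hy
        simp [hgdef, hF1 y h, this]
      · rw [indicator_of_mem (show y ∈ _ \ F from ⟨hy, h⟩)]
        exact hg.bound y
    rw [setIntegral_indicator (measurableSet_ball.diff hF), inter_eq_right.2 sdiff_subset,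
      setIntegral_const, smul_eq_mul] at h1
    have h2 := (hd (2 * ρ) (by positivity) hρr).trans
      (mul_le_mul_of_nonneg_right (min_le_right _ _) (by positivity))
    refine (h1.trans (mul_le_mul_of_nonneg_right h2 (by positivity))).trans_eq ?_
    field_simp
    ring
  have hD := H g (M + 1) _ hg x₀ p (x - p) ρ (ε₁ ^ 2) hρ0 (by positivity) (by linarith) hint
  have hvg : ∀ y ∈ ball x₀ 1, v y = ⟪fieldPot g y, b⟫ + ⟪a - w, y⟫ + (c + ⟪w, x₀⟫) := by
    intro y hy
    rw [hv, hgdef, fieldPot_add hf hχ, inner_add_left, hw y hy, inner_sub_right, inner_sub_left]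
    ring
  have e1 : v x = ⟪fieldPot g (p + (x - p)) + fieldPot g (p - (x - p)) -
      (2 : ℝ) • fieldPot g p, b⟫ := by
    have e2 : p - (x - p) = (2 : ℝ) • p - x := by rw [two_smul]; abel
    have m1 : x ∈ ball x₀ 1 := by rw [mem_ball, dist_eq_norm]; linarith
    have m2 : p ∈ ball x₀ 1 := by rw [mem_ball, dist_eq_norm]; linarith
    have m3 : (2 : ℝ) • p - x ∈ ball x₀ 1 := by
      rw [mem_ball, dist_eq_norm, ← e2, show p - (x - p) - x₀ = (p - x₀) - (x - p) by abel]
      linarith [norm_sub_le (p - x₀) (x - p)]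
    have v1 := hvg x m1
    have v2 := hvg p m2
    have v3 := hvg _ m3
    rw [hF0 p hpF] at v2
    rw [hF0 _ hqF, inner_sub_right, inner_smul_right] at v3
    rw [e2, add_sub_cancel, inner_sub_left, inner_add_left, inner_smul_left]
    simp only [conj_trivial]
    linarith
  have hfin : ‖v x‖ ≤ K * (ε₁ ^ 2 * ρ + ‖x - p‖ ^ 2 / ρ) := by
    rw [e1]
    refine (norm_inner_le_norm _ _).trans ((mul_le_mul_of_nonneg_right hD (norm_nonneg b)).trans_eq ?_)
    rw [hK]; ring
  have h5 : ‖x - p‖ ^ 2 / ρ ≤ 4 * ε₁ * r := by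
    rw [div_le_iff₀ hρ0]
    calc ‖x - p‖ ^ 2 ≤ (2 * r) ^ 2 := pow_le_pow_left₀ (norm_nonneg _) hh 2
      _ = _ := by rw [mul_pow, sq r]; nth_rewrite 2 [hrρ]; ring
  simp only [sub_zero, zero_apply]
  calc ‖v x‖ ≤ K * (ε₁ ^ 2 * ρ + ‖x - p‖ ^ 2 / ρ) := hfin
    _ ≤ K * (ε₁ * r + 4 * ε₁ * r) := by
        have : ε₁ ^ 2 * ρ = ε₁ * r := by rw [hrρ]; ring
        rw [this]
        exact mul_le_mul_of_nonneg_left (by linarith) hK0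
    _ = K * 5 * ε₁ * r := by ring
    _ ≤ ε * r := mul_le_mul_of_nonneg_right hεK hr0.le

section

variable {Ω : Set (Euc 3)} {k c : ℝ} {a b : Euc 3} {u : Euc 3 → ℝ}

theorem IsCondSol.volume_not_differentiableAt (hΩ : IsOpen Ω) (hbd : Bornology.IsBounded Ω)
    (hu : IsCondSol 3 Ω k a u) (hlin : ∀ x ∈ Ω, u x = ⟪b, x⟫ + c) :
    volume {x | ¬DifferentiableAt ℝ u x} = 0 := by
  obtain ⟨R, hR⟩ := hbd.closure.subset_ball 0
  set F := {x | ¬DifferentiableAt ℝ u x}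
  have hF : MeasurableSet F := (measurableSet_of_differentiableAt ℝ u).compl
  rw [← Measure.restrict_eq_zero, ← ae_eq_bot, ← Filter.empty_mem_iff_bot]
  filter_upwards [ae_volume_ball_diff_le F hF, ae_restrict_mem hF] with x hx hxF
  refine hxF ?_
  have h1 : DifferentiableAt ℝ (fun x => u x - (⟪b, x⟫ + c)) x :=
    differentiableAt_of_density_point (a := a - b) (b := b) (c := -c)
      (hu.isDensity hΩ hR) hF (fun y => by
        rw [← hu.eq_inner_fieldPot hΩ hlin hR, inner_sub_left]; ring)
      (fun y hy => (hu.isSmoothOff hlin).eq_zero y (hu.notMem_of_not_differentiableAt hΩ hy).2)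
      (fun y hy => by
        have h2 : y ∈ {x | ¬DifferentiableAt ℝ u x} := hy
        rw [solDensity, indicator_of_notMem (hu.notMem_of_not_differentiableAt hΩ hy).1,
          indicator_of_mem h2]
        ring) hxF hx
  have h2 : DifferentiableAt ℝ (fun x : Euc 3 => ⟪b, x⟫ + c) x :=
    ((innerSL ℝ b).hasFDerivAt.add_const c).differentiableAt
  exact (h1.add h2).congr_of_eventuallyEq (Eventually.of_forall fun y => by simp)

theorem IsCondSol.inner_fieldPot_indicator (hΩ : IsOpen Ω) (hbd : Bornology.IsBounded Ω)
    (hu : IsCondSol 3 Ω k a u) (hlin : ∀ x ∈ Ω, u x = ⟪b, x⟫ + c) {x : Euc 3} (hx : x ∈ Ω) :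
    (k - 1) * ⟪fieldPot (Ω.indicator fun _ => 1) x, b⟫ = ⟪b - a, x⟫ + c := by
  obtain ⟨R, hR⟩ := hbd.closure.subset_ball 0
  have h1 := hu.eq_inner_fieldPot hΩ hlin hR x
  have h2 : fieldPot (solDensity Ω k u) x =
      fieldPot (fun y => (k - 1) * Ω.indicator (fun _ => 1) y) x := by
    refine integral_congr_ae ?_
    filter_upwards [measure_eq_zero_iff_ae_notMem.1 (hu.volume_not_differentiableAt hΩ hbd hlin)]
      with y hy
    have h3 : y ∉ {x | ¬DifferentiableAt ℝ u x} := hy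
    simp only [solDensity, indicator_of_notMem h3]
    simp
  rw [h2, fieldPot_const_mul, inner_smul_left, hlin x hx] at h1
  rw [conj_trivial] at h1
  rw [inner_sub_left]
  linarith

end

theorem exists_add_smul_mem {Ω : Set (Euc 3)} (hΩ : IsOpen Ω) {x w : Euc 3} (hx : x ∈ Ω) :
    ∃ ε : ℝ, 0 < ε ∧ x + ε • w ∈ Ω := by
  have h : Tendsto (fun ε : ℝ => x + ε • w) (𝓝[>] 0) (𝓝 x) := by
    have : Continuous fun ε : ℝ => x + ε • w := by fun_prop
    simpa using (this.tendsto 0).mono_left nhdsWithin_le_nhds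
  obtain ⟨ε, h1, h2⟩ := ((h.eventually (hΩ.mem_nhds hx)).and self_mem_nhdsWithin).exists
  exact ⟨ε, h2, h1⟩

/-- The field of the inclusion is affine in the inclusion. -/
theorem exists_fieldPot_eq_affine {Ω : Set (Euc 3)} (hne : Ω.Nonempty)
    (hbd : Bornology.IsBounded Ω) (hΩ : IsOpen Ω) {k : ℝ} (hk : k ≠ 1)
    (hall : ∀ a : Euc 3, ∃ u : Euc 3 → ℝ, IsCondSol 3 Ω k a u ∧ IsLinIn 3 Ω u) :
    ∃ (L : Euc 3 →L[ℝ] Euc 3) (β : Euc 3), ∀ x ∈ closure Ω,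
      fieldPot (Ω.indicator fun _ => 1) x = L x + β := by
  obtain ⟨R, hR⟩ := hbd.subset_ball 0
  set T := fieldPot (Ω.indicator fun _ => 1)
  have hT : Continuous T := (IsDensity.indicator_one hΩ.measurableSet hR).continuous_fieldPot
  let e := EuclideanSpace.basisFun (Fin 3) ℝ
  have h1 : ∀ i, ∃ (b : Euc 3) (c : ℝ), ∀ x ∈ Ω, (k - 1) * ⟪T x, b⟫ = ⟪b - e i, x⟫ + c := by
    intro i
    obtain ⟨u, hu, b, c, hlin⟩ := hall (e i)
    exact ⟨b, c, fun x hx => hu.inner_fieldPot_indicator hΩ hbd hlin hx⟩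
  choose b c hbc using h1
  let B : Euc 3 →ₗ[ℝ] Euc 3 := e.toBasis.constr ℝ b
  have hB : ∀ a, B a = ∑ i, ⟪e i, a⟫ • b i := by
    intro a
    conv_lhs => rw [← e.sum_repr' a]
    rw [map_sum]
    refine Finset.sum_congr rfl fun i _ => ?_
    rw [map_smul]
    congr 1
    rw [← e.coe_toBasis, e.toBasis.constr_basis]
  let γ : Euc 3 → ℝ := fun a => ∑ i, ⟪e i, a⟫ * c i
  have h2 : ∀ a, ∀ x ∈ Ω, (k - 1) * ⟪T x, B a⟫ = ⟪B a - a, x⟫ + γ a := by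
    intro a x hx
    have e3 : ⟪a, x⟫ = ∑ i, ⟪e i, a⟫ * ⟪e i, x⟫ := by
      rw [← e.sum_inner_mul_inner]
      simp only [real_inner_comm]
    rw [inner_sub_left, e3, hB, inner_sum, sum_inner, Finset.mul_sum, ← Finset.sum_sub_distrib,
      ← Finset.sum_add_distrib]
    refine Finset.sum_congr rfl fun i _ => ?_
    rw [inner_smul_left, inner_smul_right]
    have := hbc i x hx
    rw [inner_sub_left] at this
    simp only [conj_trivial]
    linear_combination ⟪e i, a⟫ * this
  have hinj : Function.Injective B := by
    refine (injective_iff_map_eq_zero B).2 fun a ha => ?_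
    by_contra h0
    obtain ⟨x, hx⟩ := hne
    obtain ⟨ε, hε, hx'⟩ := exists_add_smul_mem (w := a) hΩ hx
    have e1 := h2 a x hx
    have e2 := h2 a _ hx'
    rw [ha, inner_zero_right, zero_sub, inner_neg_left, mul_zero] at e1 e2
    rw [inner_add_right, inner_smul_right] at e2
    have : 0 < ⟪a, a⟫ := real_inner_self_pos.2 h0
    nlinarith
  have hsurj := LinearMap.injective_iff_surjective.1 hinj
  choose G hG using fun i => hsurj (e i)
  have hk' : k - 1 ≠ 0 := sub_ne_zero.2 hk
  refine ⟨∑ i, ((k - 1)⁻¹ • innerSL ℝ (e i - G i)).smulRight (e i),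
    ∑ i, ((k - 1)⁻¹ * γ (G i)) • e i, fun x hx => ?_⟩
  have hcl : IsClosed {x | T x = (∑ i, ((k - 1)⁻¹ • innerSL ℝ (e i - G i)).smulRight (e i)) x +
    ∑ i, ((k - 1)⁻¹ * γ (G i)) • e i} := isClosed_eq hT (by fun_prop)
  refine closure_minimal (fun y hy => ?_) hcl hx
  rw [mem_ofPred_eq, ← e.sum_repr' (T y), sum_apply, ← Finset.sum_add_distrib]
  refine Finset.sum_congr rfl fun i _ => ?_
  have h3 := h2 (G i) y hy
  rw [hG, real_inner_comm] at h3
  rw [ContinuousLinearMap.smulRight_apply, ← add_smul]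
  congr 1
  simp only [_root_.smul_apply, innerSL_apply_apply, smul_eq_mul]
  field_simp
  linarith

/-- The field of a set points to the side on which the set lies. -/
theorem inner_fieldPot_neg {D : Set (Euc 3)} (hD : MeasurableSet D) (hbd : Bornology.IsBounded D)
    (hpos : volume D ≠ 0) {x w : Euc 3} (hw : ∀ y ∈ D, 0 < ⟪x - y, w⟫) :
    ⟪fieldPot (D.indicator fun _ => 1) x, w⟫ < 0 := by
  obtain ⟨R, hR⟩ := hbd.subset_ball 0
  have hd := IsDensity.indicator_one hD hR
  have h0 : ⟪fieldPot (D.indicator fun _ => 1) x, w⟫ =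
      -∫ y, D.indicator (fun y => (4 * Real.pi)⁻¹ * (‖x - y‖ ^ 3)⁻¹ * ⟪x - y, w⟫) y := by
    rw [fieldPot, real_inner_comm, ← integral_inner (hd.integrable_field x), ← integral_neg]
    congr 1
    ext y
    by_cases hy : y ∈ D
    · simp [hy, newtonField, inner_smul_right, real_inner_comm]
    · simp [hy]
  have hi : Integrable
      (D.indicator fun y => (4 * Real.pi)⁻¹ * (‖x - y‖ ^ 3)⁻¹ * ⟪x - y, w⟫) := by
    refine ((hd.integrable_field x).inner_const w).neg.congr (Eventually.of_forall fun y => ?_)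
    by_cases hy : y ∈ D
    · simp [hy, newtonField, inner_smul_left]
    · simp [hy]
  have hp : ∀ y ∈ D, 0 < (4 * Real.pi)⁻¹ * (‖x - y‖ ^ 3)⁻¹ * ⟪x - y, w⟫ := by
    intro y hy
    have h1 := hw y hy
    have h2 : 0 < ‖x - y‖ := norm_pos_iff.2 fun h => by simp [h] at h1
    positivity
  rw [h0, neg_lt_zero, integral_pos_iff_support_of_nonneg
    (fun y => indicator_nonneg (fun y hy => (hp y hy).le) y) hi]
  refine (pos_iff_ne_zero.2 hpos).trans_le (measure_mono fun y hy => ?_)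
  rw [Function.mem_support, indicator_of_mem hy]
  exact (hp y hy).ne'

theorem IsDensity.integral_mul_inner_fieldPot {f g : Euc 3 → ℝ} {M R M' R' : ℝ}
    (hf : IsDensity f M R) (hg : IsDensity g M' R') (w : Euc 3) :
    ∫ x, g x * ⟪fieldPot f x, w⟫ = -∫ y, f y * ⟪fieldPot g y, w⟫ := by
  let k : Euc 3 → ℝ := (ball 0 (R' + R)).indicator fun z => ⟪newtonField z, w⟫
  have hk : Integrable k := (integrable_indicator_iff measurableSet_ball).2
    ((integrableOn_newtonField _).inner_const w)
  have h1 : Integrable (fun p : Euc 3 × Euc 3 => g p.1 * (f p.2 * k (p.1 - p.2)))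
      (volume.prod volume) := by
    refine Integrable.bdd_mul (c := M') (hf.integrable.convolution_integrand
      (ContinuousLinearMap.mul ℝ ℝ) hk) ?_ (Eventually.of_forall fun p => hg.bound p.1)
    exact (hg.measurable.comp measurable_fst).aestronglyMeasurable
  have h2 : ∀ x y, g x * (f y * k (x - y)) = g x * (f y * ⟪newtonField (x - y), w⟫) := by
    intro x y
    rcases le_or_gt R' ‖x‖ with hx | hx
    · rw [hg.eq_zero x hx, zero_mul, zero_mul]
    rcases le_or_gt R ‖y‖ with hy | hy
    · rw [hf.eq_zero y hy, zero_mul, zero_mul]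
    rw [show k (x - y) = _ from indicator_of_mem (mem_ball_zero_iff.2
      ((norm_sub_le x y).trans_lt (add_lt_add hx hy))) _]
  have h3 : ∀ {f : Euc 3 → ℝ} {M R : ℝ}, IsDensity f M R → ∀ x,
      ∫ y, f y * ⟪newtonField (x - y), w⟫ = ⟪fieldPot f x, w⟫ := by
    intro f M R hf x
    rw [fieldPot, real_inner_comm, ← integral_inner (hf.integrable_field x)]
    simp only [inner_smul_right, real_inner_comm]
  have h4 := integral_integral_swap (f := fun x y => g x * (f y * k (x - y))) h1
  simp only [h2] at h4
  simp only [integral_const_mul, h3 hf] at h4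
  rw [h4, ← integral_neg]
  congr 1
  ext y
  rw [← h3 hg, ← integral_const_mul, ← integral_neg]
  congr 1
  ext x
  rw [← neg_sub, newtonField_neg, inner_neg_left]
  ring

/-- The Newtonian field is the gradient of a fundamental solution. -/
theorem sum_inner_fieldPot_fderiv {φ : Euc 3 → ℝ} (hφ : ContDiff ℝ (⊤ : ℕ∞) φ)
    (hc : HasCompactSupport φ) {M R : ℝ}
    (hd : ∀ i, IsDensity (fun x => fderiv ℝ φ x (EuclideanSpace.single i 1)) M R) (y : Euc 3) :
    ∑ i, ⟪fieldPot (fun x => fderiv ℝ φ x (EuclideanSpace.single i 1)) y,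
      EuclideanSpace.single i (1 : ℝ)⟫ = -φ y := by
  have hi : ∀ i : Fin 3, Integrable fun x => fderiv ℝ φ x (EuclideanSpace.single i 1) *
      ⟪newtonField (y - x), EuclideanSpace.single i (1 : ℝ)⟫ := fun i =>
    (((hd i).integrable_field y).inner_const (EuclideanSpace.single i (1 : ℝ))).congr
      (Eventually.of_forall fun x => by simp only [inner_smul_left, conj_trivial])
  have h1 : ∀ i : Fin 3, ⟪fieldPot (fun x => fderiv ℝ φ x (EuclideanSpace.single i 1)) y,
      EuclideanSpace.single i (1 : ℝ)⟫ = ∫ x, fderiv ℝ φ x (EuclideanSpace.single i 1) *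
      ⟪newtonField (y - x), EuclideanSpace.single i (1 : ℝ)⟫ := by
    intro i
    rw [fieldPot, real_inner_comm, ← integral_inner ((hd i).integrable_field y)]
    simp only [inner_smul_right, real_inner_comm]
  have h2 : ∀ x, ∑ i : Fin 3, fderiv ℝ φ x (EuclideanSpace.single i 1) *
      ⟪newtonField (y - x), EuclideanSpace.single i (1 : ℝ)⟫ =
        fderiv ℝ φ x (newtonField (y - x)) := by
    intro x
    rw [sum_coord_mul φ x (newtonField (y - x))]
    refine Finset.sum_congr rfl fun i _ => ?_
    rw [EuclideanSpace.inner_single_right]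
    simp [mul_comm]
  have hsum := integrable_finsetSum Finset.univ fun i _ => hi i
  simp only [h1]
  rw [← integral_finsetSum _ fun i _ => hi i]
  simp only [h2] at hsum ⊢
  rw [← integral_add_left_eq_self _ y]
  have hg := hsum.comp_add_left y
  rw [integral_eq_of_radial (H := fun _ => -((4 * Real.pi)⁻¹ * φ y)) hg ?_ (fun _ _ _ => rfl)
    (integrableOn_const measure_ball_lt_top.ne), setIntegral_const, volume_real_unitBall]
  · simp only [smul_eq_mul]; field_simp
  · intro w hw
    have e1 : ∀ r : ℝ, HasDerivAt (fun r : ℝ => φ (y + r • w)) (fderiv ℝ φ (y + r • w) w) r := by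
      intro r
      have a1 : HasDerivAt (fun r : ℝ => y + r • w) w r := by
        simpa using ((hasDerivAt_id r).smul_const w).const_add y
      exact ((hφ.differentiable (by simp)) _).hasFDerivAt.comp_hasDerivAt r a1
    have e2 : ∀ r ∈ Ioi (0 : ℝ), r ^ 2 * fderiv ℝ φ (y + r • w) (newtonField (y - (y + r • w))) =
        (4 * Real.pi)⁻¹ * deriv (fun r : ℝ => φ (y + r • w)) r := by
      intro r hr
      have hr0 : 0 < r := hr
      rw [(e1 r).deriv, sub_add_cancel_left, newtonField_neg, newtonField_smul hr0, newtonField, hw]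
      simp
      field_simp
    have hcs : HasCompactSupport fun r : ℝ => φ (y + r • w) := by
      obtain ⟨ρ, hρ⟩ := hc.isCompact.isBounded.subset_ball 0
      refine HasCompactSupport.intro (isCompact_Icc (a := -(ρ + ‖y‖)) (b := ρ + ‖y‖))
        fun r hr => image_eq_zero_of_notMem_tsupport fun h => hr ?_
      have a1 := hρ h
      rw [mem_ball_zero_iff] at a1
      have a2 := norm_sub_le (y + r • w) y
      rw [add_sub_cancel_left, norm_smul, hw, mul_one, Real.norm_eq_abs] at a2
      exact abs_le.1 (by linarith)
    have hC : ContDiff ℝ 1 fun r : ℝ => φ (y + r • w) :=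
      (hφ.of_le (by simp)).comp (by fun_prop)
    rw [setIntegral_congr_fun measurableSet_Ioi e2, integral_const_mul,
      hcs.integral_Ioi_deriv_eq hC 0]
    simp

theorem isDensity_fderiv {φ : Euc 3 → ℝ} (hφ : ContDiff ℝ (⊤ : ℕ∞) φ)
    (hc : HasCompactSupport φ) : ∃ M R : ℝ,
    ∀ i, IsDensity (fun x => fderiv ℝ φ x (EuclideanSpace.single i 1)) M R := by
  have h : ∀ i : Fin 3, ∃ M : ℝ, ∀ x, |fderiv ℝ φ x (EuclideanSpace.single i 1)| ≤ M := by
    intro i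
    obtain ⟨M, hM⟩ := (hasCompactSupport_fderiv_single hc (EuclideanSpace.single i 1)).exists_bound_of_continuous
      (contDiff_fderiv_single hφ _).continuous
    exact ⟨M, hM⟩
  choose M hM using h
  obtain ⟨R, hR⟩ := hc.isCompact.isBounded.subset_ball 0
  refine ⟨∑ i, |M i|, R, fun i => ⟨(contDiff_fderiv_single hφ _).continuous.measurable,
    fun x => ?_, fun x hx => ?_⟩⟩
  · exact (hM i x).trans ((le_abs_self _).trans
      (Finset.single_le_sum (f := fun i => |M i|) (fun _ _ => abs_nonneg _) (Finset.mem_univ i)))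
  · have : x ∉ tsupport φ := fun h => by
      have := hR h
      rw [mem_ball_zero_iff] at this
      linarith
    rw [image_eq_zero_of_notMem_tsupport fun h => this (tsupport_fderiv_subset ℝ h)]
    rfl

/-- The potential field of an open set is divergence free up to a constant there. -/
theorem sum_inner_single_of_fieldPot_eq {Ω : Set (Euc 3)} (hΩ : IsOpen Ω) (hne : Ω.Nonempty)
    (hbd : Bornology.IsBounded Ω) {L : Euc 3 →L[ℝ] Euc 3} {β : Euc 3}
    (hL : ∀ x ∈ Ω, fieldPot (Ω.indicator fun _ => 1) x = L x + β) :
    ∑ i, ⟪L (EuclideanSpace.single i 1), EuclideanSpace.single i (1 : ℝ)⟫ = -1 := by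
  obtain ⟨c, hcΩ⟩ := hne
  obtain ⟨r, hr, hrΩ⟩ := Metric.isOpen_iff.1 hΩ c hcΩ
  obtain ⟨R, hR⟩ := hbd.subset_ball 0
  let φ : ContDiffBump c := ⟨r / 4, r / 2, by positivity, by linarith⟩
  have hφ : ContDiff ℝ (⊤ : ℕ∞) φ := φ.contDiff
  have hc := φ.hasCompactSupport
  have hts : tsupport φ ⊆ Ω := by
    rw [φ.tsupport_eq]
    exact (closedBall_subset_ball (show r / 2 < r by linarith)).trans hrΩ
  have hpos : 0 < ∫ x, φ x := φ.integral_pos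
  obtain ⟨M, R', hd⟩ := isDensity_fderiv hφ hc
  have hχ := IsDensity.indicator_one hΩ.measurableSet hR
  have h1 : ∀ i : Fin 3, ∫ x, fderiv ℝ φ x (EuclideanSpace.single i 1) *
      ⟪fieldPot (Ω.indicator fun _ => 1) x, EuclideanSpace.single i (1 : ℝ)⟫ =
        -(⟪L (EuclideanSpace.single i 1), EuclideanSpace.single i (1 : ℝ)⟫ * ∫ x, φ x) := by
    intro i
    set e : Euc 3 := EuclideanSpace.single i 1
    have a0 : ∀ x, HasFDerivAt (fun x => ⟪L x + β, e⟫) ((innerSL ℝ e).comp L) x := by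
      intro x
      have : HasFDerivAt (fun x => L x + β) L x := L.hasFDerivAt.add_const β
      have := (innerSL ℝ e).hasFDerivAt.comp x this
      simpa [Function.comp_def, real_inner_comm] using this
    have a1 : ∀ x, fderiv ℝ (fun x => ⟪L x + β, e⟫ * φ x) x e =
        ⟪L x + β, e⟫ * fderiv ℝ φ x e + ⟪L e, e⟫ * φ x := by
      intro x
      have : HasFDerivAt (fun x => ⟪L x + β, e⟫ * φ x) _ x :=
        (a0 x).mul ((hφ.differentiable (by simp)) x).hasFDerivAt
      rw [this.fderiv]
      simp [real_inner_comm, mul_comm]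
    have hψ : ContDiff ℝ (⊤ : ℕ∞) fun x => ⟪L x + β, e⟫ :=
      ((L.contDiff.add contDiff_const).inner ℝ contDiff_const)
    obtain ⟨-, h0⟩ := integral_fderiv_eq_zero (hψ.mul hφ) (hc.mul_left) e
    have i1 : Integrable fun x => ⟪L x + β, e⟫ * fderiv ℝ φ x e :=
      (hψ.continuous.mul (contDiff_fderiv_single hφ e).continuous).integrable_of_hasCompactSupport
        (hasCompactSupport_fderiv_single hc e).mul_left
    have i2 : Integrable fun x => ⟪L e, e⟫ * φ x :=
      (φ.continuous.integrable_of_hasCompactSupport hc).const_mul _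
    have h0' : ∫ x, (⟪L x + β, e⟫ * fderiv ℝ φ x e + ⟪L e, e⟫ * φ x) = 0 := by
      rw [← h0]
      exact integral_congr_ae (Eventually.of_forall fun x => (a1 x).symm)
    rw [integral_add i1 i2, integral_const_mul] at h0'
    rw [← eq_neg_iff_add_eq_zero.2 h0']
    refine integral_congr_ae (Eventually.of_forall fun x => ?_)
    by_cases hx : x ∈ tsupport φ
    · simp only [hL x (hts hx), mul_comm]
    · have : fderiv ℝ φ x = 0 :=
        image_eq_zero_of_notMem_tsupport fun h => hx (tsupport_fderiv_subset ℝ h)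
      simp [this]
  have h2 : ∑ i : Fin 3, ∫ x, fderiv ℝ φ x (EuclideanSpace.single i 1) *
      ⟪fieldPot (Ω.indicator fun _ => 1) x, EuclideanSpace.single i (1 : ℝ)⟫ = ∫ x, φ x := by
    have i3 : ∀ i : Fin 3, Integrable fun y => Ω.indicator (fun _ => (1 : ℝ)) y *
        ⟪fieldPot (fun x => fderiv ℝ φ x (EuclideanSpace.single i 1)) y,
          EuclideanSpace.single i (1 : ℝ)⟫ := fun i => by
      have hF : Continuous fun y : Euc 3 =>
          ⟪fieldPot (fun x => fderiv ℝ φ x (EuclideanSpace.single i 1)) (-y),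
            EuclideanSpace.single i (1 : ℝ)⟫ :=
        ((hd i).continuous_fieldPot.comp continuous_neg).inner continuous_const
      simpa using hχ.integrable_of_continuous hF 0
    simp only [hχ.integral_mul_inner_fieldPot (hd _)]
    rw [Finset.sum_neg_distrib, ← integral_finsetSum _ fun i _ => i3 i, ← integral_neg]
    refine integral_congr_ae (Eventually.of_forall fun x => ?_)
    simp only [← Finset.mul_sum, sum_inner_fieldPot_fderiv hφ hc hd]
    by_cases hx : x ∈ Ω
    · simp [hx]
    · simp [hx, image_eq_zero_of_notMem_tsupport fun h => hx (hts h)]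
  simp only [h1] at h2
  rw [Finset.sum_neg_distrib, ← Finset.sum_mul] at h2
  have : (∑ i, ⟪L (EuclideanSpace.single i 1), EuclideanSpace.single i (1 : ℝ)⟫ + 1) *
    ∫ x, φ x = 0 := by linarith
  linarith [(mul_eq_zero.1 this).resolve_right hpos.ne']

theorem isSymmetric_of_fieldPot_eq {Ω : Set (Euc 3)} (hΩ : IsOpen Ω) (hne : Ω.Nonempty)
    (hbd : Bornology.IsBounded Ω) {L : Euc 3 →L[ℝ] Euc 3} {β : Euc 3}
    (hL : ∀ x ∈ Ω, fieldPot (Ω.indicator fun _ => 1) x = L x + β) :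
    (L : Euc 3 →ₗ[ℝ] Euc 3).IsSymmetric := by
  obtain ⟨c, hcΩ⟩ := hne
  obtain ⟨R, hR⟩ := hbd.subset_ball 0
  have hχ := IsDensity.indicator_one hΩ.measurableSet hR
  have h1 : ∀ᶠ y in 𝓝 c, HasFDerivAt (densityPot (Ω.indicator fun _ => 1))
      (innerSL ℝ (L y + β)) y := by
    filter_upwards [hΩ.mem_nhds hcΩ] with y hy
    rw [← hL y hy]
    exact hχ.hasFDerivAt_densityPot y
  have h2 : HasFDerivAt (fun y => innerSL ℝ (L y + β)) ((innerSL ℝ).comp L) c :=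
    (innerSL ℝ).hasFDerivAt.comp c (L.hasFDerivAt.add_const β)
  intro v w
  have := second_derivative_symmetric_of_eventually h1 h2 v w
  simpa [real_inner_comm] using this

theorem eigenvalue_neg_of_fieldPot_eq {Ω : Set (Euc 3)} (hΩ : IsOpen Ω) (hne : Ω.Nonempty)
    (hbd : Bornology.IsBounded Ω) {L : Euc 3 →L[ℝ] Euc 3} {β : Euc 3}
    (hL : ∀ x ∈ closure Ω, fieldPot (Ω.indicator fun _ => 1) x = L x + β) {e : Euc 3} {l : ℝ}
    (he : e ≠ 0) (hl : ∀ x, ⟪L x, e⟫ = l * ⟪x, e⟫) : l < 0 := by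
  have hK : IsCompact (closure Ω) := hbd.isCompact_closure
  have hcont : ContinuousOn (fun x => ⟪x, e⟫) (closure Ω) := by fun_prop
  have hpos : volume Ω ≠ 0 := (hΩ.measure_pos volume hne).ne'
  obtain ⟨x1, hx1, hmax⟩ := hK.exists_isMaxOn hne.closure hcont
  obtain ⟨x0, hx0, hmin⟩ := hK.exists_isMinOn hne.closure hcont
  have hs : ∀ y ∈ Ω, ∀ w : Euc 3, w ≠ 0 → ∃ y' ∈ Ω, ⟪y, w⟫ < ⟪y', w⟫ := by
    intro y hy w hw
    obtain ⟨ε, hε, h⟩ := exists_add_smul_mem (w := w) hΩ hy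
    refine ⟨_, h, ?_⟩
    rw [inner_add_left, inner_smul_left, real_inner_self_eq_norm_sq]
    have : 0 < ε * ‖w‖ ^ 2 := mul_pos hε (by positivity)
    simpa using this
  have h1 : ⟪fieldPot (Ω.indicator fun _ => 1) x1, e⟫ < 0 := by
    refine inner_fieldPot_neg hΩ.measurableSet hbd hpos fun y hy => ?_
    obtain ⟨y', hy', h⟩ := hs y hy e he
    have : ⟪y', e⟫ ≤ ⟪x1, e⟫ := hmax (subset_closure hy')
    rw [inner_sub_left]
    linarith
  have h0 : ⟪fieldPot (Ω.indicator fun _ => 1) x0, -e⟫ < 0 := by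
    refine inner_fieldPot_neg hΩ.measurableSet hbd hpos fun y hy => ?_
    obtain ⟨y', hy', h⟩ := hs y hy (-e) (neg_ne_zero.2 he)
    have : ⟪x0, e⟫ ≤ ⟪y', e⟫ := hmin (subset_closure hy')
    simp only [inner_neg_right, inner_sub_left] at h ⊢
    linarith
  rw [hL _ hx1, inner_add_left, hl] at h1
  rw [hL _ hx0, inner_neg_right, inner_add_left, hl] at h0
  have h2 : ⟪x0, e⟫ ≤ ⟪x1, e⟫ := hmax hx0
  by_contra! h
  nlinarith

/-- The logarithm of the quotient of the diagonal form with entries `m` by the standard one. -/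
def logRatio (m : Fin 3 → ℝ) (y : Euc 3) : ℝ :=
  Real.log (∑ j, m j * y j ^ 2) - Real.log (∑ j, y j ^ 2)

theorem sum_sq_pos {y : Euc 3} (hy : y ≠ 0) : 0 < ∑ j, y j ^ 2 := by
  rw [← EuclideanSpace.real_norm_sq_eq]
  positivity

theorem sum_mul_sq_pos {m : Fin 3 → ℝ} (hm : ∀ j, 0 < m j) {y : Euc 3} (hy : y ≠ 0) :
    0 < ∑ j, m j * y j ^ 2 := by
  obtain ⟨j, -, hj⟩ := Finset.exists_lt_of_sum_lt
    (show ∑ j : Fin 3, (0 : ℝ) < ∑ j, y j ^ 2 by simpa using sum_sq_pos hy)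
  exact Finset.sum_pos' (fun j _ => mul_nonneg (hm j).le (sq_nonneg _))
    ⟨j, Finset.mem_univ _, mul_pos (hm j) hj⟩

theorem measurable_logRatio (m : Fin 3 → ℝ) : Measurable (logRatio m) := by
  unfold logRatio
  have : ∀ j : Fin 3, Measurable fun y : Euc 3 => y j := fun j => by fun_prop
  fun_prop

theorem abs_logRatio_le {m : Fin 3 → ℝ} {a b : ℝ} (ha : 0 < a) (hm : ∀ j, a ≤ m j)
    (hb : ∀ j, m j ≤ b) (y : Euc 3) : |logRatio m y| ≤ |Real.log a| + |Real.log b| := by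
  rcases eq_or_ne y 0 with rfl | hy
  · simp [logRatio]
    positivity
  have hs := sum_sq_pos hy
  have hb0 : 0 < b := ha.trans_le ((hm 0).trans (hb 0))
  have h1 : a * ∑ j, y j ^ 2 ≤ ∑ j, m j * y j ^ 2 := by
    rw [Finset.mul_sum]
    exact Finset.sum_le_sum fun j _ => mul_le_mul_of_nonneg_right (hm j) (sq_nonneg _)
  have h2 : ∑ j, m j * y j ^ 2 ≤ b * ∑ j, y j ^ 2 := by
    rw [Finset.mul_sum]
    exact Finset.sum_le_sum fun j _ => mul_le_mul_of_nonneg_right (hb j) (sq_nonneg _)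
  have h3 := Real.log_le_log (by positivity) h1
  have h4 := Real.log_le_log (sum_mul_sq_pos (fun j => ha.trans_le (hm j)) hy) h2
  rw [Real.log_mul ha.ne' hs.ne'] at h3
  rw [Real.log_mul hb0.ne' hs.ne'] at h4
  rw [logRatio, abs_le]
  constructor
  · linarith [neg_abs_le (Real.log a), abs_nonneg (Real.log b)]
  · linarith [le_abs_self (Real.log b), abs_nonneg (Real.log a)]

theorem exists_bounds_fin_three {m : Fin 3 → ℝ} (hm : ∀ j, 0 < m j) :
    ∃ a b, 0 < a ∧ (∀ j, a ≤ m j) ∧ ∀ j, m j ≤ b := by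
  obtain ⟨i, hi⟩ := Finite.exists_min m
  obtain ⟨k, hk⟩ := Finite.exists_max m
  exact ⟨m i, m k, hm i, hi, hk⟩

theorem integrableOn_logRatio {m : Fin 3 → ℝ} (hm : ∀ j, 0 < m j) :
    IntegrableOn (logRatio m) (ball 0 1) := by
  obtain ⟨a, b, ha, h1, h2⟩ := exists_bounds_fin_three hm
  exact Measure.integrableOn_of_bounded measure_ball_lt_top.ne
    (measurable_logRatio m).aestronglyMeasurable
    (Eventually.of_forall fun y => abs_logRatio_le ha h1 h2 y)

/-- A functional whose critical points solve `depol m = α`. -/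
def depolEnergy (α m : Fin 3 → ℝ) : ℝ :=
  3 * (4 * Real.pi)⁻¹ * (∫ y in ball 0 1, logRatio m y) - ∑ j, α j * Real.log (m j)

theorem depolEnergy_one (α : Fin 3 → ℝ) : depolEnergy α 1 = 0 := by
  simp [depolEnergy, logRatio]

theorem ae_ne_zero : ∀ᵐ y ∂(volume.restrict (ball (0 : Euc 3) 1)), y ≠ 0 :=
  ae_restrict_of_ae (compl_mem_ae_iff.2 (measure_singleton 0))

theorem depolEnergy_smul {α m : Fin 3 → ℝ} (hα : ∑ j, α j = 1) (hm : ∀ j, 0 < m j) {s : ℝ}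
    (hs : 0 < s) : depolEnergy α (s • m) = depolEnergy α m := by
  have h1 : ∫ y in ball 0 1, logRatio (s • m) y =
      ∫ y in ball (0 : Euc 3) 1, (logRatio m y + Real.log s) := by
    refine integral_congr_ae (ae_ne_zero.mono fun y hy => ?_)
    simp only [logRatio, Pi.smul_apply, smul_eq_mul, mul_assoc]
    rw [← Finset.mul_sum, Real.log_mul hs.ne' (sum_mul_sq_pos hm hy).ne']
    ring
  have h2 : ∀ j, Real.log ((s • m) j) = Real.log s + Real.log (m j) := fun j => by
    rw [Pi.smul_apply, smul_eq_mul, Real.log_mul hs.ne' (hm j).ne']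
  rw [depolEnergy, h1, integral_add (integrableOn_logRatio hm)
    (integrableOn_const measure_ball_lt_top.ne), setIntegral_const, volume_real_unitBall]
  simp only [h2, mul_add, Finset.sum_add_distrib, ← Finset.sum_mul, hα, depolEnergy, smul_eq_mul]
  field_simp
  ring

theorem integrableOn_log_coord (k : Fin 3) :
    IntegrableOn (fun y : Euc 3 => Real.log (y k)) (ball 0 1) := by
  have hlog : Integrable ((Ioc (-1 : ℝ) 1).indicator Real.log) := by
    rw [integrable_indicator_iff measurableSet_Ioc]
    exact (intervalIntegrable_iff_integrableOn_Ioc_of_le (by norm_num)).1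
      intervalIntegral.intervalIntegrable_log'
  have hone : Integrable ((Ioc (-1 : ℝ) 1).indicator fun _ => (1 : ℝ)) := by
    rw [integrable_indicator_iff measurableSet_Ioc]
    exact integrableOn_const measure_Ioc_lt_top.ne
  let g : Fin 3 → ℝ → ℝ := fun j => if j = k then (Ioc (-1 : ℝ) 1).indicator Real.log
    else (Ioc (-1 : ℝ) 1).indicator fun _ => (1 : ℝ)
  have hg : ∀ j, Integrable (g j) := by
    intro j
    by_cases h : j = k
    · simpa [g, h] using hlog
    · simpa [g, h] using hone
  have h1 : Integrable fun y : Fin 3 → ℝ => ∏ j, g j (y j) := Integrable.fintype_prod hg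
  have h2 : Integrable fun y : Euc 3 => ∏ j, g j (y j) :=
    ((PiLp.volume_preserving_ofLp (Fin 3)).integrable_comp h1.aestronglyMeasurable).2 h1
  refine h2.integrableOn.congr_fun (fun y hy => ?_) measurableSet_ball
  have h3 : ∀ j, y j ∈ Ioc (-1 : ℝ) 1 := by
    intro j
    rw [mem_ball_zero_iff] at hy
    have := abs_lt.1 ((PiLp.norm_apply_le y j).trans_lt hy)
    exact ⟨this.1, this.2.le⟩
  have h4 : ∀ j, g j (y j) = if j = k then Real.log (y j) else 1 := by
    intro j
    by_cases h : j = k <;> simp [g, h, indicator_of_mem, h3]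
  simp only [h4]
  simp

theorem ae_coord_ne_zero (k : Fin 3) :
    ∀ᵐ y ∂(volume.restrict (ball (0 : Euc 3) 1)), y k ≠ 0 := by
  refine ae_restrict_of_ae (compl_mem_ae_iff.2 ?_)
  have : {y : Euc 3 | y k = 0} = ((EuclideanSpace.proj k : Euc 3 →L[ℝ] ℝ) : Euc 3 →ₗ[ℝ] ℝ).ker := by
    ext y
    simp
  refine (congrArg volume this).trans (Measure.addHaar_submodule _ _ fun h => ?_)
  have := congrArg (fun f : Euc 3 →ₗ[ℝ] ℝ => f (EuclideanSpace.single k 1))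
    (LinearMap.ker_eq_top.1 h)
  simp at this

theorem exists_pos_of_depolEnergy_nonpos {α : Fin 3 → ℝ} (hα : ∀ j, 0 < α j) :
    ∃ δ, 0 < δ ∧ δ ≤ 1 ∧ ∀ (m : Fin 3 → ℝ) (k : Fin 3), (∀ j, 0 < m j) → (∀ j, m j ≤ 1) →
      m k = 1 → depolEnergy α m ≤ 0 → ∀ j, δ ≤ m j := by
  let c : Fin 3 → ℝ := fun k => 3 * (4 * Real.pi)⁻¹ * ∫ y in ball (0 : Euc 3) 1, 2 * Real.log (y k)
  obtain ⟨C, hC⟩ : ∃ C : ℝ, ∀ k, -C ≤ c k := by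
    obtain ⟨k, hk⟩ := Finite.exists_min c
    exact ⟨-c k, by simpa using hk⟩
  have key : ∀ (m : Fin 3 → ℝ) (k : Fin 3), (∀ j, 0 < m j) → (∀ j, m j ≤ 1) →
      m k = 1 → depolEnergy α m ≤ 0 → ∀ j, Real.exp (-C / α j) ≤ m j := by
    intro m k hm hm1 hk hE j
    have h1 : ∫ y in ball (0 : Euc 3) 1, 2 * Real.log (y k) ≤ ∫ y in ball 0 1, logRatio m y := by
      refine setIntegral_mono_on_ae ((integrableOn_log_coord k).const_mul 2)
        (integrableOn_logRatio hm) measurableSet_ball ?_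
      have := (ae_restrict_iff' measurableSet_ball).1 (ae_coord_ne_zero k)
      filter_upwards [this] with y hyk hy
      have hyk := hyk hy
      have hy0 : y ≠ 0 := by
        rintro rfl
        simp at hyk
      rw [mem_ball_zero_iff] at hy
      have a1 : y k ^ 2 ≤ ∑ j, m j * y j ^ 2 := by
        have := Finset.single_le_sum (f := fun j => m j * y j ^ 2)
          (fun j _ => mul_nonneg (hm j).le (sq_nonneg _)) (Finset.mem_univ k)
        simpa [hk] using this
      have a2 : ∑ j, y j ^ 2 ≤ 1 := by
        rw [← EuclideanSpace.real_norm_sq_eq]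
        exact pow_le_one₀ (norm_nonneg _) hy.le
      have a3 := Real.log_le_log (by positivity) a1
      have a4 := Real.log_nonpos (sum_sq_pos hy0).le a2
      rw [Real.log_pow] at a3
      rw [logRatio]
      push_cast at a3
      linarith
    have h2 : c k ≤ 3 * (4 * Real.pi)⁻¹ * ∫ y in ball 0 1, logRatio m y :=
      mul_le_mul_of_nonneg_left h1 (by positivity)
    have h3 : -(α j * Real.log (m j)) ≤ -∑ j, α j * Real.log (m j) := by
      rw [← Finset.sum_neg_distrib]
      exact Finset.single_le_sum (f := fun j => -(α j * Real.log (m j))) (fun j _ =>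
        neg_nonneg.2 (mul_nonpos_of_nonneg_of_nonpos (hα j).le
          (Real.log_nonpos (hm j).le (hm1 j)))) (Finset.mem_univ j)
    rw [depolEnergy] at hE
    rw [← Real.le_log_iff_exp_le (hm j), div_le_iff₀ (hα j)]
    linarith [hC k]
  obtain ⟨i, hi⟩ := Finite.exists_min fun j => Real.exp (-C / α j)
  refine ⟨min 1 (Real.exp (-C / α i)), by positivity, min_le_left _ _, fun m k h1 h2 h3 h4 j => ?_⟩
  exact (min_le_right _ _).trans ((hi j).trans (key m k h1 h2 h3 h4 j))

theorem continuousOn_depolEnergy (α : Fin 3 → ℝ) {δ : ℝ} (hδ : 0 < δ) :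
    ContinuousOn (depolEnergy α) (Icc (fun _ => δ) 1) := by
  have hpos : ∀ m ∈ Icc (fun _ => δ) (1 : Fin 3 → ℝ), ∀ j, 0 < m j := fun m hm j =>
    hδ.trans_le (hm.1 j)
  have h1 : ContinuousOn (fun m : Fin 3 → ℝ => ∫ y in ball 0 1, logRatio m y)
      (Icc (fun _ => δ) 1) := by
    refine continuousOn_of_dominated (bound := fun _ => |Real.log δ| + |Real.log 1|)
      (fun m _ => (measurable_logRatio m).aestronglyMeasurable)
      (fun m hm => Eventually.of_forall fun y => abs_logRatio_le hδ hm.1 hm.2 y)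
      (integrableOn_const measure_ball_lt_top.ne) (ae_ne_zero.mono fun y hy => ?_)
    unfold logRatio
    refine ContinuousOn.sub (ContinuousOn.log (by fun_prop) fun m hm => ?_) continuousOn_const
    exact (sum_mul_sq_pos (hpos m hm) hy).ne'
  unfold depolEnergy
  refine (continuousOn_const.mul h1).sub (continuousOn_finsetSum _ fun j _ =>
    continuousOn_const.mul (ContinuousOn.log (by fun_prop) fun m hm => (hpos m hm j).ne'))

theorem exists_min_depolEnergy {α : Fin 3 → ℝ} (hα : ∀ j, 0 < α j) (hα1 : ∑ j, α j = 1) :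
    ∃ m : Fin 3 → ℝ, (∀ j, 0 < m j) ∧
      ∀ m', (∀ j, 0 < m' j) → depolEnergy α m ≤ depolEnergy α m' := by
  obtain ⟨δ, hδ, hδ1, h⟩ := exists_pos_of_depolEnergy_nonpos hα
  have h1 : (1 : Fin 3 → ℝ) ∈ Icc (fun _ => δ) (1 : Fin 3 → ℝ) := ⟨fun _ => hδ1, le_rfl⟩
  obtain ⟨m, hm, hmin⟩ := isCompact_Icc.exists_isMinOn ⟨_, h1⟩ (continuousOn_depolEnergy α hδ)
  refine ⟨m, fun j => hδ.trans_le (hm.1 j), fun m' hm' => ?_⟩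
  obtain ⟨k, hk⟩ := Finite.exists_max m'
  have hs : ∀ j, 0 < ((m' k)⁻¹ • m') j := fun j => mul_pos (inv_pos.2 (hm' k)) (hm' j)
  have hs1 : ∀ j, ((m' k)⁻¹ • m') j ≤ 1 := fun j => by
    simpa [inv_mul_le_iff₀ (hm' k)] using hk j
  rw [← depolEnergy_smul hα1 hm' (inv_pos.2 (hm' k))]
  rcases le_or_gt (depolEnergy α ((m' k)⁻¹ • m')) 0 with h0 | h0
  · exact hmin ⟨h _ k hs hs1 (by simp [(hm' k).ne']) h0, hs1⟩
  · exact (hmin h1).trans (by simpa [depolEnergy_one] using h0.le)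

theorem hasDerivAt_depolEnergy (α : Fin 3 → ℝ) {m : Fin 3 → ℝ} (hm : ∀ j, 0 < m j) (i : Fin 3) :
    HasDerivAt (fun t => depolEnergy α (Function.update m i t))
      ((depol m i - α i) / m i) (m i) := by
  have hup : ∀ t, 0 < t → ∀ j, 0 < Function.update m i t j := by
    intro t ht j
    rcases eq_or_ne j i with rfl | h
    · simpa using ht
    · simpa [h] using hm j
  have hui : ∀ (t : ℝ) j, HasDerivAt (fun t => Function.update m i t j)
      (if j = i then 1 else 0) t := by
    intro t j
    rcases eq_or_ne j i with rfl | h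
    · simpa using hasDerivAt_id' t
    · simpa [h] using hasDerivAt_const t (m j)
  have hs : Ioi (m i / 2) ∈ 𝓝 (m i) := Ioi_mem_nhds (half_lt_self (hm i))
  have hb : ∀ᵐ y ∂(volume.restrict (ball (0 : Euc 3) 1)), ∀ t ∈ Ioi (m i / 2),
      ‖y i ^ 2 / ∑ j, Function.update m i t j * y j ^ 2‖ ≤ (m i / 2)⁻¹ := by
    refine ae_ne_zero.mono fun y hy t (ht : m i / 2 < t) => ?_
    have ht0 : 0 < t := (half_pos (hm i)).trans ht
    have a1 := sum_mul_sq_pos (hup t ht0) hy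
    have a2 : t * y i ^ 2 ≤ ∑ j, Function.update m i t j * y j ^ 2 := by
      have := Finset.single_le_sum (f := fun j => Function.update m i t j * y j ^ 2)
        (fun j _ => mul_nonneg (hup t ht0 j).le (sq_nonneg _)) (Finset.mem_univ i)
      simpa using this
    rw [Real.norm_of_nonneg (by positivity), div_le_iff₀ a1, ← div_eq_inv_mul,
      le_div_iff₀ (half_pos (hm i))]
    nlinarith [sq_nonneg (y i)]
  have hd : ∀ᵐ y ∂(volume.restrict (ball (0 : Euc 3) 1)), ∀ t ∈ Ioi (m i / 2),
      HasDerivAt (fun t => logRatio (Function.update m i t) y)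
        (y i ^ 2 / ∑ j, Function.update m i t j * y j ^ 2) t := by
    refine ae_ne_zero.mono fun y hy t (ht : m i / 2 < t) => ?_
    have ht0 : 0 < t := (half_pos (hm i)).trans ht
    have a1 : HasDerivAt (fun t => ∑ j, Function.update m i t j * y j ^ 2) (y i ^ 2) t := by
      have := HasDerivAt.fun_sum (u := Finset.univ) fun j _ => (hui t j).mul_const (y j ^ 2)
      simpa using this
    exact (a1.log (sum_mul_sq_pos (hup t ht0) hy).ne').sub_const _
  have hmeas : Measurable fun y : Euc 3 =>
      y i ^ 2 / ∑ j, Function.update m i (m i) j * y j ^ 2 := by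
    have : ∀ j : Fin 3, Measurable fun y : Euc 3 => y j := fun j => by fun_prop
    fun_prop
  obtain ⟨-, h1⟩ := hasDerivAt_integral_of_dominated_loc_of_deriv_le hs
    (Eventually.of_forall fun t => (measurable_logRatio _).aestronglyMeasurable)
    (integrableOn_logRatio (hup (m i) (hm i))) hmeas.aestronglyMeasurable hb
    (integrableOn_const measure_ball_lt_top.ne) hd
  have h2 : HasDerivAt (fun t => ∑ j, α j * Real.log (Function.update m i t j))
      (α i / m i) (m i) := by
    have := HasDerivAt.fun_sum (u := Finset.univ) fun j _ =>
      ((hui (m i) j).log (hup _ (hm i) j).ne').const_mul (α j)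
    simpa [ite_div, div_eq_mul_inv] using this
  refine ((h1.const_mul (3 * (4 * Real.pi)⁻¹)).sub h2).congr_deriv ?_
  have h3 : ∀ y : Euc 3, m i * y i ^ 2 / ∑ j, m j * y j ^ 2 =
      m i * (y i ^ 2 / ∑ j, m j * y j ^ 2) := fun y => mul_div_assoc _ _ _
  rw [depol]
  simp only [h3, integral_const_mul, Function.update_eq_self]
  have := hm i
  field_simp

/-- Every positive triple with sum one consists of the depolarization factors of an ellipsoid. -/
theorem exists_depol_eq {α : Fin 3 → ℝ} (hα : ∀ j, 0 < α j) (hα1 : ∑ j, α j = 1) :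
    ∃ m : Fin 3 → ℝ, (∀ j, 0 < m j) ∧ ∀ j, depol m j = α j := by
  obtain ⟨m, hm, hmin⟩ := exists_min_depolEnergy hα hα1
  refine ⟨m, hm, fun i => ?_⟩
  have h1 : IsLocalMin (fun t => depolEnergy α (Function.update m i t)) (m i) := by
    filter_upwards [Ioi_mem_nhds (hm i)] with t ht
    rw [Function.update_eq_self]
    refine hmin _ fun j => ?_
    rcases eq_or_ne j i with rfl | h
    · simpa using ht
    · simpa [h] using hm j
  have h2 := h1.hasDerivAt_eq_zero (hasDerivAt_depolEnergy α hm i)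
  linarith [(div_eq_zero_iff.1 h2).resolve_right (hm i).ne']

section

variable (e : OrthonormalBasis (Fin 3) ℝ (Euc 3)) (m : Fin 3 → ℝ)

theorem ellForm_add_smul_self (x d : Euc 3) (t : ℝ) :
    ellForm e m (x + t • d) (x + t • d) =
      ellForm e m x x + 2 * t * ellForm e m x d + t ^ 2 * ellForm e m d d := by
  simp only [ellForm_add_left, ellForm_add_right, ellForm_smul_left, ellForm_smul_right,
    ellForm_comm e m d x]
  ring

/-- A homothetic copy of an ellipsoid of least size containing a given compact set has contact
points in every half-space. -/
theorem exists_min_ell (hm : ∀ i, 0 < m i) {K : Set (Euc 3)} (hK : IsCompact K)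
    (hne : K.Nonempty) : ∃ (s : Euc 3) (ρ : ℝ), (∀ x ∈ K, ellForm e m (x - s) (x - s) ≤ ρ) ∧
      ∀ d, ∃ x ∈ K, ellForm e m (x - s) (x - s) = ρ ∧ 0 ≤ ellForm e m (x - s) d := by
  let q : Euc 3 → Euc 3 → ℝ := fun s x => ellForm e m (x - s) (x - s)
  have hq : Continuous fun p : Euc 3 × Euc 3 => q p.1 p.2 :=
    (continuous_ellForm_self e m).comp (continuous_snd.sub continuous_fst)
  let f : Euc 3 → ℝ := fun s => sSup (q s '' K)
  have hf : Continuous f := hK.continuous_sSup hq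
  have hqs : ∀ s, Continuous (q s) := fun s =>
    (continuous_ellForm_self e m).comp (continuous_id.sub continuous_const)
  have hle : ∀ s, ∀ x ∈ K, q s x ≤ f s := fun s x hx =>
    le_csSup (hK.image (hqs s)).bddAbove (mem_image_of_mem _ hx)
  have hex : ∀ s, ∃ x ∈ K, q s x = f s := fun s =>
    (hK.image (hqs s)).sSup_mem (hne.image _)
  obtain ⟨x0, hx0⟩ := hne
  obtain ⟨c, hc, hcq⟩ := exists_le_ellForm e m hm
  obtain ⟨s, hs⟩ : ∃ s, ∀ s', f s ≤ f s' := by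
    refine hf.exists_forall_le' x0 ?_
    have h1 : Tendsto (fun s : Euc 3 => c * ‖x0 - s‖ ^ 2) (cocompact _) atTop := by
      have a1 : Tendsto (fun s : Euc 3 => ‖x0 - s‖) (cocompact _) atTop := by
        have := tendsto_dist_left_cocompact_atTop x0
        exact this.congr fun s => dist_eq_norm x0 s
      exact ((tendsto_pow_atTop two_ne_zero).comp a1).const_mul_atTop hc
    filter_upwards [h1.eventually_ge_atTop (f x0)] with s h
    exact h.trans ((hcq _).trans (hle s x0 hx0))
  refine ⟨s, f s, hle s, fun d => ?_⟩
  let t : ℕ → ℝ := fun n => 1 / ((n : ℝ) + 1)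
  have ht : Tendsto t atTop (𝓝 0) := tendsto_one_div_add_atTop_nhds_zero_nat
  have ht0 : ∀ n, 0 < t n := fun n => Nat.one_div_pos_of_nat
  clear_value t
  choose x hxK hx using fun n => hex (s - t n • d)
  obtain ⟨y, hy, φ, hφ, hxy⟩ := hK.tendsto_subseq hxK
  have htφ : Tendsto (fun n => t (φ n)) atTop (𝓝 0) := ht.comp hφ.tendsto_atTop
  have hsφ : Tendsto (fun n => s - t (φ n) • d) atTop (𝓝 s) := by
    have h1 : Continuous fun r : ℝ => s - r • d := by fun_prop
    have h2 := (h1.tendsto 0).comp htφ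
    rwa [zero_smul, sub_zero] at h2
  refine ⟨y, hy, ?_, ?_⟩
  · have h1 := (hq.tendsto (s, y)).comp (hsφ.prodMk_nhds hxy)
    have h2 : Tendsto (fun n => f (s - t (φ n) • d)) atTop (𝓝 (f s)) := (hf.tendsto s).comp hsφ
    refine tendsto_nhds_unique h1 (h2.congr fun n => (hx _).symm)
  · have h1 : ∀ n, 0 ≤ 2 * ellForm e m (x n - s) d + t n * ellForm e m d d := by
      intro n
      have a1 : q (s - t n • d) (x n) = q s (x n) + 2 * t n * ellForm e m (x n - s) d +
          t n ^ 2 * ellForm e m d d := by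
        rw [← ellForm_add_smul_self]
        simp only [q, sub_sub_eq_add_sub, sub_add_eq_add_sub]
      have a2 := hle s _ (hxK n)
      have a3 := hs (s - t n • d)
      have a4 : 0 ≤ t n * (2 * ellForm e m (x n - s) d + t n * ellForm e m d d) := by
        linarith [hx n]
      exact nonneg_of_mul_nonneg_right a4 (ht0 n)
    have h2 : Tendsto (fun n => 2 * ellForm e m (x (φ n) - s) d + t (φ n) * ellForm e m d d) atTop
        (𝓝 (2 * ellForm e m (y - s) d + 0 * ellForm e m d d)) := by
      have a1 := ((continuous_ellForm e m).tendsto (y - s, d)).comp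
        ((hxy.sub_const s).prodMk_nhds (tendsto_const_nhds (x := d)))
      exact (a1.const_mul 2).add (htφ.mul_const _)
    have := ge_of_tendsto' h2 fun n => h1 _
    linarith

theorem subset_ell_of_isOpen (hm : ∀ i, 0 < m i) {Ω : Set (Euc 3)} (hΩ : IsOpen Ω) {s : Euc 3}
    {ρ : ℝ} (h : ∀ x ∈ Ω, ellForm e m (x - s) (x - s) ≤ ρ) : Ω ⊆ ell e m s ρ := by
  intro x hx
  obtain ⟨w, hw, hB⟩ : ∃ w : Euc 3, w ≠ 0 ∧ 0 ≤ ellForm e m (x - s) w := by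
    rcases eq_or_ne (x - s) 0 with h0 | h0
    · exact ⟨e 0, e.orthonormal.ne_zero 0, by simp [h0, ellForm]⟩
    · exact ⟨x - s, h0, ellForm_nonneg e m hm _⟩
  obtain ⟨ε, hε, hx'⟩ := exists_add_smul_mem (w := w) hΩ hx
  have h1 := h _ hx'
  rw [add_sub_right_comm, ellForm_add_smul_self] at h1
  have h2 := mul_pos (pow_pos hε 2) (ellForm_pos e m hm hw)
  have h3 := mul_nonneg hε.le hB
  show ellForm e m (x - s) (x - s) < ρ
  linarith

theorem convex_ell (hm : ∀ i, 0 < m i) (s : Euc 3) (ρ : ℝ) : Convex ℝ (ell e m s ρ) := by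
  refine convex_iff_add_mem.2 fun x (hx : _ < ρ) y (hy : _ < ρ) a b ha hb hab => ?_
  show ellForm e m _ _ < ρ
  obtain rfl : a = 1 - b := by linarith
  have h1 := ellForm_add_smul_self e m (x - s) (y - x) 1
  have h2 := ellForm_add_smul_self e m (x - s) (y - x) b
  rw [show x - s + (1 : ℝ) • (y - x) = y - s by module] at h1
  rw [show x - s + b • (y - x) = (1 - b) • x + b • y - s by module] at h2
  rw [h2]
  have h3 := mul_nonneg (mul_nonneg hb ha) (ellForm_nonneg e m hm (y - x))
  rcases ha.eq_or_lt with h | h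
  · obtain rfl : b = 1 := by linarith
    linarith
  · have h4 := mul_lt_mul_of_pos_left hx h
    have h5 := mul_le_mul_of_nonneg_left hy.le hb
    nlinarith

end

theorem fieldPot_indicator_sdiff {D Ω : Set (Euc 3)} (hD : MeasurableSet D)
    (hΩ : MeasurableSet Ω) (hsub : Ω ⊆ D) (hbd : Bornology.IsBounded D) (x : Euc 3) :
    fieldPot (D.indicator fun _ => 1) x =
      fieldPot ((D \ Ω).indicator fun _ => 1) x + fieldPot (Ω.indicator fun _ => 1) x := by
  obtain ⟨R, hR⟩ := hbd.subset_ball 0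
  rw [← fieldPot_add (IsDensity.indicator_one (hD.diff hΩ) (sdiff_subset.trans hR))
    (IsDensity.indicator_one hΩ (hsub.trans hR))]
  congr 1
  ext y
  by_cases h1 : y ∈ Ω
  · simp [h1, hsub h1]
  · by_cases h2 : y ∈ D <;> simp [h1, h2]

/-- A bounded open set whose field is affine with the same linear part as that of an ellipsoid
fills an ellipsoid up to a null set. -/
theorem volume_ell_sdiff_eq_zero (e : OrthonormalBasis (Fin 3) ℝ (Euc 3)) {m : Fin 3 → ℝ}
    (hm : ∀ i, 0 < m i) {Ω : Set (Euc 3)} (hΩ : IsOpen Ω) (hne : Ω.Nonempty)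
    (hbd : Bornology.IsBounded Ω) {β : Euc 3}
    (hT : ∀ x ∈ closure Ω, ∀ i, ⟪fieldPot (Ω.indicator fun _ => 1) x, e i⟫ =
      -(depol m i * ⟪e i, x⟫) + ⟪β, e i⟫) :
    ∃ s ρ, Ω ⊆ ell e m s ρ ∧ volume (ell e m s ρ \ Ω) = 0 := by
  obtain ⟨s, ρ, hle, hcontact⟩ := exists_min_ell e m hm hbd.isCompact_closure hne.closure
  have hsub := subset_ell_of_isOpen e m hm hΩ fun x hx => hle x (subset_closure hx)
  refine ⟨s, ρ, hsub, ?_⟩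
  set D := ell e m s ρ
  have hDo : IsOpen D := isOpen_ell e m s ρ
  obtain ⟨R, hR⟩ := exists_ell_subset_ball e m hm s ρ
  have hDb : Bornology.IsBounded D := isBounded_ball.subset hR
  have hcT := (IsDensity.indicator_one hDo.measurableSet hR).continuous_fieldPot
  have hTD : ∀ i, ∀ x ∈ closure Ω, ⟪fieldPot (D.indicator fun _ => 1) x, e i⟫ =
      -(depol m i * ⟪e i, x - s⟫) := by
    intro i
    have h1 : EqOn (fun x => ⟪fieldPot (D.indicator fun _ => 1) x, e i⟫)
        (fun x => -(depol m i * ⟪e i, x - s⟫)) Ω :=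
      fun x hx => inner_fieldPot_ell_apply hm (hsub hx) i
    exact h1.closure (hcT.inner continuous_const) (by fun_prop)
  obtain ⟨x0, hx0⟩ := hne
  set d := fieldPot ((D \ Ω).indicator fun _ => 1) x0
  have hconst : ∀ x ∈ closure Ω, fieldPot ((D \ Ω).indicator fun _ => 1) x = d := by
    have h1 : ∀ x ∈ closure Ω, ∀ i, ⟪fieldPot ((D \ Ω).indicator fun _ => 1) x, e i⟫ =
        depol m i * ⟪e i, s⟫ - ⟪β, e i⟫ := by
      intro x hx i
      have h2 := hTD i x hx
      rw [fieldPot_indicator_sdiff hDo.measurableSet hΩ.measurableSet hsub hDb, inner_add_left,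
        hT x hx, inner_sub_right] at h2
      linarith
    intro x hx
    refine InnerProductSpace.ext_inner_left_basis e.toBasis fun i => ?_
    rw [e.coe_toBasis, real_inner_comm, real_inner_comm d]
    exact (h1 x hx i).trans (h1 x0 (subset_closure hx0) i).symm
  by_contra hpos
  obtain ⟨x, hx, hxρ, hxd⟩ := hcontact d
  let w : Euc 3 := ∑ i, (m i * ⟪e i, x - s⟫) • e i
  have hw : ∀ v, ⟪v, w⟫ = ellForm e m (x - s) v := by
    intro v
    simp only [w, inner_sum, inner_smul_right, ellForm, real_inner_comm v, mul_assoc]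
  have h1 : ⟪fieldPot ((D \ Ω).indicator fun _ => 1) x, w⟫ < 0 := by
    refine inner_fieldPot_neg (hDo.measurableSet.diff hΩ.measurableSet)
      (hDb.subset sdiff_subset) hpos fun y hy => ?_
    have a1 : ellForm e m (y - s) (y - s) < ρ := hy.1
    have a2 := ellForm_add_smul_self e m (x - s) (y - s) (-1)
    have a3 := ellForm_nonneg e m hm (x - s + (-1 : ℝ) • (y - s))
    rw [hw, show x - y = (x - s) + (-1 : ℝ) • (y - s) by module, ellForm_add_right,
      ellForm_smul_right]
    linarith
  rw [hconst x hx, hw] at h1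
  linarith

theorem exists_const_of_fieldPot_eq {D : Set (Euc 3)} (hD : IsOpen D) (hc : IsPreconnected D)
    {f : Euc 3 → ℝ} {M R : ℝ} (hf : IsDensity f M R) {L : Euc 3 →L[ℝ] Euc 3} {β : Euc 3}
    (hs : (L : Euc 3 →ₗ[ℝ] Euc 3).IsSymmetric) (hL : ∀ x ∈ D, fieldPot f x = L x + β) :
    ∃ C, ∀ x ∈ D, densityPot f x = 2⁻¹ * ⟪L x, x⟫ + ⟪β, x⟫ + C := by
  have h1 : ∀ x ∈ D, HasFDerivAt
      (fun x => densityPot f x - (2⁻¹ * ⟪L x, x⟫ + ⟪β, x⟫)) (0 : Euc 3 →L[ℝ] ℝ) x := by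
    intro x hx
    have a1 : HasFDerivAt (fun x => ⟪L x, x⟫) _ x := L.hasFDerivAt.inner ℝ (hasFDerivAt_id x)
    have a2 : HasFDerivAt (fun x => ⟪β, x⟫) (innerSL ℝ β) x := (innerSL ℝ β).hasFDerivAt
    refine ((hf.hasFDerivAt_densityPot x).sub ((a1.const_mul 2⁻¹).add a2)).congr_fderiv ?_
    ext v
    have a3 : ⟪L v, x⟫ = ⟪v, L x⟫ := hs v x
    simp [hL x hx, a3, real_inner_comm (L x) v]
    ring
  obtain ⟨C, hC⟩ := hD.exists_is_const_of_fderiv_eq_zero hc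
    (fun x hx => (h1 x hx).differentiableAt.differentiableWithinAt)
    (fun x hx => (h1 x hx).fderiv (𝕜 := ℝ))
  exact ⟨C, fun x hx => by linarith [hC x hx]⟩

theorem exists_newtonPot_eq {Ω : Set (Euc 3)} (hΩ : IsOpen Ω) (hne : Ω.Nonempty)
    (hbd : Bornology.IsBounded Ω) {L : Euc 3 →L[ℝ] Euc 3} {β : Euc 3}
    (hL : ∀ x ∈ closure Ω, fieldPot (Ω.indicator fun _ => 1) x = L x + β) :
    ∃ C, ∀ x ∈ Ω, newtonPot Ω x = 2⁻¹ * ⟪L x, x⟫ + ⟪β, x⟫ + C := by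
  have hL' : ∀ x ∈ Ω, fieldPot (Ω.indicator fun _ => 1) x = L x + β :=
    fun x hx => hL x (subset_closure hx)
  have hs := isSymmetric_of_fieldPot_eq hΩ hne hbd hL'
  let e := hs.eigenvectorBasis (finrank_euclideanSpace_fin (n := 3))
  let l := hs.eigenvalues (finrank_euclideanSpace_fin (n := 3))
  have he : ∀ i, L (e i) = l i • e i := fun i => hs.apply_eigenvectorBasis _ i
  have hLe : ∀ i x, ⟪L x, e i⟫ = l i * ⟪x, e i⟫ := by
    intro i x
    have : ⟪L x, e i⟫ = ⟪x, L (e i)⟫ := hs x (e i)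
    rw [this, he, inner_smul_right]
  have hneg : ∀ i, 0 < -l i := fun i =>
    neg_pos.2 (eigenvalue_neg_of_fieldPot_eq hΩ hne hbd hL (e.orthonormal.ne_zero i) (hLe i))
  have hsum : ∑ i, -l i = 1 := by
    have h1 := sum_inner_single_of_fieldPot_eq hΩ hne hbd hL'
    have h2 := LinearMap.trace_eq_sum_inner (L : Euc 3 →ₗ[ℝ] Euc 3) e
    rw [LinearMap.trace_eq_sum_inner (L : Euc 3 →ₗ[ℝ] Euc 3)
      (EuclideanSpace.basisFun (Fin 3) ℝ)] at h2
    have h3 : ∀ i, ⟪e i, L (e i)⟫ = l i := fun i => by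
      rw [he, inner_smul_right, real_inner_self_eq_norm_sq, e.orthonormal.1 i]
      ring
    simp only [ContinuousLinearMap.coe_coe, EuclideanSpace.basisFun_apply, h3] at h2
    simp only [real_inner_comm (EuclideanSpace.single _ _)] at h1 h2
    rw [Finset.sum_neg_distrib, ← h2, h1, neg_neg]
  obtain ⟨m, hm, hml⟩ := exists_depol_eq hneg hsum
  obtain ⟨s, ρ, hsub, h0⟩ := volume_ell_sdiff_eq_zero e hm hΩ hne hbd (β := β) fun x hx i => by
    rw [hL x hx, inner_add_left, hLe, hml, real_inner_comm x]
    ring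
  have hcl : ell e m s ρ ⊆ closure Ω := by
    have h1 : IsOpen (ell e m s ρ \ closure Ω) := (isOpen_ell e m s ρ).sdiff isClosed_closure
    have h2 : volume (ell e m s ρ \ closure Ω) = 0 :=
      measure_mono_null (sdiff_subset_sdiff_right subset_closure) h0
    exact sdiff_eq_empty.1 (h1.measure_eq_zero_iff volume |>.1 h2)
  obtain ⟨R, hR⟩ := hbd.subset_ball 0
  obtain ⟨C, hC⟩ := exists_const_of_fieldPot_eq (isOpen_ell e m s ρ)
    (convex_ell e m hm s ρ).isPreconnected (IsDensity.indicator_one hΩ.measurableSet hR) hs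
    fun x hx => hL x (hcl hx)
  exact ⟨C, fun x hx => by rw [← densityPot_indicator hΩ.measurableSet, hC x (hsub hx)]⟩

end

/-- If the interior field is uniform for every background field, then the Newtonian
potential of the inclusion agrees on the inclusion with a polynomial of degree ≤ 2. -/
theorem newton_potential_quadratic (Ω : Set (Euc 3))
    (hne : Ω.Nonempty) (hbd : Bornology.IsBounded Ω) (hop : IsOpen Ω)
    (k : ℝ) (hk : 0 < k) (hk1 : k ≠ 1)
    (hall : ∀ a : Euc 3, ∃ u : Euc 3 → ℝ, IsCondSol 3 Ω k a u ∧ IsLinIn 3 Ω u) :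
    ∃ (A : Matrix (Fin 3) (Fin 3) ℝ) (b : Euc 3) (C : ℝ), A.IsSymm ∧
      ∀ x ∈ Ω, newtonPot Ω x = (∑ i, x i * ∑ j, A i j * x j) + ⟪b, x⟫ + C := by
  obtain ⟨L, β, hL⟩ := exists_fieldPot_eq_affine hne hbd hop hk1 hall
  obtain ⟨C, hC⟩ := exists_newtonPot_eq hop hne hbd hL
  have hs := isSymmetric_of_fieldPot_eq hop hne hbd fun x hx => hL x (subset_closure hx)
  have hcol : ∀ (x : Euc 3) (i : Fin 3), L x i = ∑ j, L (EuclideanSpace.single j 1) i * x j := by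
    intro x i
    have h1 : x = ∑ j, x j • EuclideanSpace.single j (1 : ℝ) := by
      simpa using ((EuclideanSpace.basisFun (Fin 3) ℝ).sum_repr x).symm
    conv_lhs => rw [h1]
    simp [mul_comm]
  refine ⟨Matrix.of fun i j => 2⁻¹ * L (EuclideanSpace.single j 1) i, β, C, ?_, fun x hx => ?_⟩
  · ext i j
    have := hs (EuclideanSpace.single i 1) (EuclideanSpace.single j 1)
    simpa [EuclideanSpace.inner_single_left, EuclideanSpace.inner_single_right] using this
  · rw [hC x hx]
    congr 2
    simp only [PiLp.inner_apply, hcol x, Matrix.of_apply, mul_assoc, ← Finset.mul_sum]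
    rw [Finset.mul_sum]
    refine Finset.sum_congr rfl fun i _ => ?_
    simp
    ring
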